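/- For every constant ε > 0 there exist positive constants δ_t(ε), δ_a(ε), and K(ε) such that for every integer-valued function m₀ = m₀(n) with m₀ ≥ (1+ε)·n·log n/6, the random graph process {G_i} on n vertices asymptotically almost surely has the following property: for every integer m with m₀ ≤ m ≤ (1 + ε/6)·m₀, the 2-core of G_m is (1/2 − ε, δ_t, 2, δ_a, K)-resilient with respect to being Hamiltonian. -/

import Mathlib

open MeasureTheory Filter ENNReal

namespace RGP

noncomputable section

variable {V : Type*}

/-- The degree of a vertex. -/
def deg (G : SimpleGraph V) (v : V) : ℕ := (G.neighborSet v).ncard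

/-- `N^ℓ_G(v)`: vertices at distance at most `ℓ` from `v`, excluding `v`. -/
def nbhd (G : SimpleGraph V) (ℓ : ℕ) (v : V) : Set V :=
  {u | u ≠ v ∧ ∃ p : G.Walk v u, p.length ≤ ℓ}

/-- `TINY_{p,δ}(G)`. -/
def TINY (G : SimpleGraph V) (p δ : ℝ) : Set V :=
  {v | (deg G v : ℝ) < δ * (Nat.card V) * p}

/-- `ATYP_{p,δ}(G)`. -/
def ATYP (G : SimpleGraph V) (p δ : ℝ) : Set V :=
  {v | (deg G v : ℝ) < (1 - δ) * (Nat.card V) * p ∨ (1 + δ) * (Nat.card V) * p < (deg G v : ℝ)}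

/-- Edge density `|E| / C(n,2)`. -/
def density (G : SimpleGraph V) : ℝ :=
  (G.edgeSet.ncard : ℝ) / ((Nat.card V).choose 2 : ℕ)

/-- A matching covering all but at most one vertex. -/
def HasNearPerfectMatching (G : SimpleGraph V) : Prop :=
  ∃ M : G.Subgraph, M.IsMatching ∧ (M.vertsᶜ).ncard ≤ 1

/-- Hamiltonicity (for finite vertex types). -/
def IsHam [Finite V] (G : SimpleGraph V) : Prop :=
  letI := Classical.decEq V; letI := Fintype.ofFinite V; G.IsHamiltonian

/-- `α`-resilience with respect to a property `P`. -/
def Resilient (G : SimpleGraph V) (α : ℝ) (P : SimpleGraph V → Prop) : Prop :=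
  ∀ H : SimpleGraph V, H ≤ G → (∀ v, (deg H v : ℝ) ≤ α * (deg G v : ℝ)) → P (G \ H)

/-- `(α, δt, Kt, δa, Ka)`-resilience with respect to a property `P`. -/
def StrongResilient (G : SimpleGraph V) (α δt : ℝ) (Kt : ℕ) (δa : ℝ) (Ka : ℕ)
    (P : SimpleGraph V → Prop) : Prop :=
  ∀ H : SimpleGraph V, H ≤ G →
    (∀ v ∈ TINY G (density G) δt, (deg H v : ℝ) ≤ (deg G v : ℝ) - Kt) →
    (∀ v, v ∈ ATYP G (density G) δa → v ∉ TINY G (density G) δt →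
      (deg H v : ℝ) ≤ (deg G v : ℝ) - Ka) →
    (∀ v, v ∉ TINY G (density G) δt → v ∉ ATYP G (density G) δa →
      (deg H v : ℝ) ≤ α * (deg G v : ℝ)) →
    P (G \ H)

/-! ### The random graph process -/

/-- Potential edges of the complete graph on `Fin n`. -/
abbrev EdgeType (n : ℕ) := {e : Sym2 (Fin n) // ¬ e.IsDiag}

/-- A sample point of the random graph process: a uniformly random ordering of the edges. -/
abbrev ProcessSpace (n : ℕ) := Fin (Fintype.card (EdgeType n)) ≃ EdgeType n

instance (n : ℕ) : MeasurableSpace (ProcessSpace n) := ⊤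

/-- The uniform measure on orderings of the edges of `K_n`. -/
def processMeasure (n : ℕ) : Measure (ProcessSpace n) :=
  (Fintype.card (ProcessSpace n) : ℝ≥0∞)⁻¹ • Measure.sum (fun σ => Measure.dirac σ)

/-- The graph `G_m` of the process: the first `m` edges in the random ordering. -/
def processGraph {n : ℕ} (σ : ProcessSpace n) (m : ℕ) : SimpleGraph (Fin n) :=
  SimpleGraph.fromEdgeSet {e | ∃ i : Fin (Fintype.card (EdgeType n)), (i : ℕ) < m ∧ (σ i : Sym2 (Fin n)) = e}

/-! ### The binomial random graph G(n,p) -/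

abbrev GnpSpace (n : ℕ) := EdgeType n → Bool

/-- The Bernoulli product weight of an outcome. -/
def gnpWeight {n : ℕ} (p : ℝ) (ω : GnpSpace n) : ℝ≥0∞ :=
  ∏ e : EdgeType n, (if ω e then ENNReal.ofReal p else ENNReal.ofReal (1 - p))

/-- The `G(n,p)` probability measure. -/
def gnp (n : ℕ) (p : ℝ) : Measure (GnpSpace n) :=
  Measure.sum (fun ω => gnpWeight p ω • Measure.dirac ω)

/-- The graph determined by an outcome of `G(n,p)`. -/
def gnpGraph {n : ℕ} (ω : GnpSpace n) : SimpleGraph (Fin n) :=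
  SimpleGraph.fromEdgeSet {e | ∃ h : ¬ e.IsDiag, ω ⟨e, h⟩ = true}

/-- Joint distribution of two independent binomial random graphs. -/
def gnp2 (n : ℕ) (p₀ p' : ℝ) : Measure (GnpSpace n × GnpSpace n) :=
  Measure.sum (fun ω : GnpSpace n × GnpSpace n =>
    (gnpWeight p₀ ω.1 * gnpWeight p' ω.2) • Measure.dirac ω)

/-! ### The 2-core -/

/-- The vertex set of the 2-core: the largest set every vertex of which has
at least two neighbours inside the set. -/
def coreSet (G : SimpleGraph V) : Set V :=
  ⋃₀ {S : Set V | ∀ v ∈ S, 2 ≤ ((G.neighborSet v) ∩ S).ncard}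

/-- The 2-core of a graph, as a graph on the corresponding vertex subset. -/
def twoCore (G : SimpleGraph V) : SimpleGraph (coreSet G) := G.induce (coreSet G)

/-! ### Rotations of paths -/

section Posa

open scoped Classical

/-- A path, presented as a list of vertices. -/
def PathL (F : SimpleGraph V) (l : List V) : Prop := l.Nodup ∧ l.IsChain F.Adj

/-- There is a path with `ℓ` vertices from `a` to `b`. -/
def EndP (F : SimpleGraph V) (ℓ : ℕ) (a b : V) : Prop :=
  ∃ l : List V, PathL F l ∧ l.length = ℓ ∧ l.head? = some a ∧ l.getLast? = some b

lemma getLast?_rotate (l₁ l₂ : List V) (x y : V) :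
    (l₁ ++ x :: (y :: l₂).reverse).getLast? = some y := by
  have : l₁ ++ x :: (y :: l₂).reverse = (l₁ ++ x :: l₂.reverse) ++ [y] := by simp
  rw [this, List.getLast?_append]; rfl

/-- Lists obtained from a given one by a sequence of rotations fixing the first vertex. -/
inductive Rot (F : SimpleGraph V) (l₀ : List V) : List V → Prop
  | refl : Rot F l₀ l₀
  | step (l₁ : List V) (x y : V) (l₂ : List V) (u : V) : Rot F l₀ (l₁ ++ x :: y :: l₂) →
      (y :: l₂).getLast? = some u → F.Adj u x → Rot F l₀ (l₁ ++ x :: (y :: l₂).reverse)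

lemma PathL.rotate {F : SimpleGraph V} {l₁ l₂ : List V} {x y u : V}
    (h : PathL F (l₁ ++ x :: y :: l₂)) (hu : (y :: l₂).getLast? = some u) (hux : F.Adj u x) :
    PathL F (l₁ ++ x :: (y :: l₂).reverse) := by
  obtain ⟨h1, h2⟩ := h
  refine ⟨?_, ?_⟩
  · have : (l₁ ++ x :: (y :: l₂).reverse).Perm (l₁ ++ x :: y :: l₂) :=
      ((List.reverse_perm _).cons x).append_left l₁
    exact this.nodup_iff.2 h1
  · rw [List.isChain_append] at h2 ⊢
    refine ⟨h2.1, ?_, ?_⟩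
    · have h3 := h2.2.1
      rw [List.isChain_cons] at h3 ⊢
      refine ⟨?_, ?_⟩
      · intro z hz
        rw [List.head?_reverse, hu] at hz
        cases hz
        exact hux.symm
      · rw [List.isChain_reverse]
        refine h3.2.imp ?_
        intro a b hab
        exact hab.symm
    · simpa using h2.2.2

lemma Rot.spec {F : SimpleGraph V} {l₀ l : List V} (h : Rot F l₀ l) (h0 : PathL F l₀) :
    PathL F l ∧ l.length = l₀.length ∧ l.head? = l₀.head? := by
  induction h with
  | refl => exact ⟨h0, rfl, rfl⟩
  | step l₁ x y l₂ u hr hu hux ih =>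
    refine ⟨ih.1.rotate hu hux, ?_, ?_⟩
    · rw [← ih.2.1]; simp
    · rw [← ih.2.2]; cases l₁ <;> simp

/-- Along rotations, chain conditions survive as long as they hold for the inserted edges. -/
lemma Rot.closure {F : SimpleGraph V} {l₀ : List V} (E : V → V → Prop)
    (hE : ∀ a b, E a b → E b a) (hl₀ : l₀.IsChain E)
    (x : V) (hx : ∀ l, Rot F l₀ l → l.getLast? ≠ some x)
    (hx' : ∀ l w, Rot F l₀ l → l.getLast? = some w → ¬ E x w)
    {l : List V} (h : Rot F l₀ l) :
    l.IsChain (fun p q => (p = x ∨ q = x) → E p q) := by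
  induction h with
  | refl => exact hl₀.imp (fun a b h _ => h)
  | step l₁ a b l₂ u hr hu hua ih =>
    have hb : (l₁ ++ a :: (b :: l₂).reverse).getLast? = some b :=
      getLast?_rotate ..
    have hnew := Rot.step l₁ a b l₂ u hr hu hua
    have hul : (l₁ ++ a :: b :: l₂).getLast? = some u := by
      rw [List.getLast?_append, List.getLast?_cons_cons, hu]; rfl
    rw [List.isChain_append] at ih ⊢
    have h3 := ih.2.1
    rw [List.isChain_cons] at h3
    have hax : a ≠ x := by
      rintro rfl
      exact hx' _ b hnew hb (h3.1 b (by simp) (Or.inl rfl))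
    have hux : u ≠ x := by
      rintro rfl
      exact hx _ hr hul
    refine ⟨ih.1, ?_, by simpa using ih.2.2⟩
    rw [List.isChain_cons]
    refine ⟨?_, ?_⟩
    · intro z hz
      rw [List.head?_reverse, hu] at hz
      cases hz
      rintro (h | h)
      · exact absurd h hax
      · exact absurd h hux
    · rw [List.isChain_reverse]
      refine h3.2.imp ?_
      intro p q hpq h
      exact hE _ _ (hpq h.symm)

/-- Consecutive vertices of a list. -/
def Con (l : List V) (a b : V) : Prop :=
  ∃ i, (l[i]? = some a ∧ l[i+1]? = some b) ∨ (l[i]? = some b ∧ l[i+1]? = some a)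

lemma Con.symm {l : List V} {a b : V} (h : Con l a b) : Con l b a := by
  obtain ⟨i, h⟩ := h
  exact ⟨i, h.symm⟩

lemma isChain_con (l : List V) : l.IsChain (Con l) := by
  rw [List.isChain_iff_getElem]
  intro i hi
  exact ⟨i, Or.inl ⟨by simp, by simp⟩⟩

lemma card_con_le [Fintype V] {l : List V} (hl : l.Nodup) (w : V) :
    (Finset.univ.filter (fun x => Con l x w)).card ≤ 2 := by
  set j := l.idxOf w
  have key : ∀ i, l[i]? = some w → i = j := by
    intro i hi
    obtain ⟨hi1, hi2⟩ := List.getElem?_eq_some_iff.1 hi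
    have := hl.idxOf_getElem i hi1
    rw [hi2] at this
    exact this.symm
  have : (Finset.univ.filter (fun x => Con l x w)).image some ⊆ {l[j+1]?, l[j-1]?} := by
    intro o ho
    obtain ⟨x, hx, rfl⟩ := Finset.mem_image.1 ho
    obtain ⟨i, ⟨h1, h2⟩ | ⟨h1, h2⟩⟩ := (Finset.mem_filter.1 hx).2
    · have := key _ h2
      simp [← this, h1]
    · have := key _ h1
      simp [← this, h2]
  calc _ = ((Finset.univ.filter (fun x => Con l x w)).image some).card :=
        (Finset.card_image_of_injective _ (Option.some_injective _)).symm
    _ ≤ _ := Finset.card_le_card this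
    _ ≤ 2 := Finset.card_le_two

/-- The neighbourhood of a vertex as a finset. -/
def nb [Fintype V] (G : SimpleGraph V) (v : V) : Finset V := Finset.univ.filter (G.Adj v)

/-- The neighbourhood of a set of vertices. -/
def nbS [Fintype V] (G : SimpleGraph V) (S : Finset V) : Finset V :=
  Finset.univ.filter (fun y => ∃ x ∈ S, G.Adj x y)

@[simp] lemma mem_nb [Fintype V] {G : SimpleGraph V} {v w : V} : w ∈ nb G v ↔ G.Adj v w := by
  simp [nb]

@[simp] lemma mem_nbS [Fintype V] {G : SimpleGraph V} {S : Finset V} {w : V} :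
    w ∈ nbS G S ↔ ∃ x ∈ S, G.Adj x w := by
  simp [nbS]

lemma split_at_mem {l : List V} {x u : V} (hx : x ∈ l) (hu : l.getLast? = some u) (hxu : x ≠ u) :
    ∃ l₁ y l₂, l = l₁ ++ x :: y :: l₂ ∧ (y :: l₂).getLast? = some u := by
  obtain ⟨l₁, l₂, rfl⟩ := List.append_of_mem hx
  cases l₂ with
  | nil => simp at hu; exact absurd hu hxu
  | cons y l₂ =>
    refine ⟨l₁, y, l₂, rfl, ?_⟩
    rw [List.getLast?_append, List.getLast?_cons_cons] at hu
    have : (y :: l₂).getLast? ≠ none := by simp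
    obtain ⟨z, hz⟩ := Option.ne_none_iff_exists'.1 this
    rw [hz] at hu ⊢
    exact hu

theorem posa_rotation [Fintype V] (F : SimpleGraph V) (Z : Finset V) (ℓ : ℕ) (a b : V)
    (hab : EndP F ℓ a b)
    (hmax : ∀ l, PathL F l → l.length ≤ ℓ)
    (hcyc : ∀ a b, EndP F ℓ a b → ¬ F.Adj b a)
    (Z1 : ∀ z ∈ Z, (nb F z).card = 2)
    (Z2 : ∀ x ∉ Z, (nb F x ∩ Z).card ≤ 1)
    (Z3 : ∀ y ∉ Z, (Z.filter (fun s => ∃ x ∉ Z, F.Adj y x ∧ F.Adj x s)).card ≤ 2) :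
    ∃ S : Finset V, S.Nonempty ∧ Disjoint S Z ∧ (∀ u ∈ S, EndP F ℓ a u) ∧
      (S ∪ nbS F S).card ≤ 9 * S.card := by
  obtain ⟨l₀, hp0, hlen0, hh0, hl0⟩ := hab
  set S : Finset V := Finset.univ.filter (fun u => ∃ l, Rot F l₀ l ∧ l.getLast? = some u) with hS
  have memS : ∀ u, u ∈ S ↔ ∃ l, Rot F l₀ l ∧ l.getLast? = some u := by simp [hS]
  have hEnd : ∀ l u, Rot F l₀ l → l.getLast? = some u → EndP F ℓ a u := by
    intro l u hl hu
    obtain ⟨h1, h2, h3⟩ := hl.spec hp0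
    exact ⟨l, h1, h2.trans hlen0, h3.trans hh0, hu⟩
  have hin : ∀ l u x, Rot F l₀ l → l.getLast? = some u → F.Adj u x → x ∈ l := by
    intro l u x hl hu hux
    by_contra hx
    obtain ⟨h1, h2, h3⟩ := hl.spec hp0
    have := hmax (l ++ [x]) ⟨?_, ?_⟩
    · simp at this; omega
    · rw [List.nodup_append]
      refine ⟨h1.1, by simp, ?_⟩
      rintro p hp q hq rfl
      simp at hq; subst hq; exact hx hp
    · rw [List.isChain_append]
      refine ⟨h1.2, by simp, ?_⟩
      intro p hp q hq
      rw [hu] at hp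
      cases hp
      simp at hq; subst hq; exact hux
  -- the neighbourhood of `S`
  have hclos : ∀ x ∈ S ∪ nbS F S, x ∈ S ∪ S.biUnion (fun w => Finset.univ.filter (fun x => Con l₀ x w)) := by
    intro x hx
    by_cases hxS : x ∈ S
    · exact Finset.mem_union_left _ hxS
    · apply Finset.mem_union_right
      rw [Finset.mem_union] at hx
      have hx := hx.resolve_left hxS
      rw [mem_nbS] at hx
      obtain ⟨u, hu, hux⟩ := hx
      obtain ⟨l, hl, hlu⟩ := (memS u).1 hu
      by_contra hcon
      simp only [Finset.mem_biUnion, Finset.mem_filter, Finset.mem_univ, true_and, not_exists,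
        not_and] at hcon
      have hch := hl.closure (Con l₀) (fun _ _ => Con.symm) (isChain_con l₀) x
        (fun l hl h => hxS ((memS x).2 ⟨l, hl, h⟩))
        (fun l w hl hw => hcon w ((memS w).2 ⟨l, hl, hw⟩))
      have hxu : x ≠ u := fun h => hxS (h ▸ hu)
      obtain ⟨l₁, y, l₂, rfl, hu2⟩ := split_at_mem (hin l u x hl hlu hux) hlu hxu
      rw [List.isChain_append, List.isChain_cons] at hch
      exact hcon y ((memS y).2 ⟨_, Rot.step l₁ x y l₂ u hl hu2 hux, getLast?_rotate ..⟩)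
        (hch.2.1.1 y (by simp) (Or.inl rfl))
  have hcard : (S ∪ nbS F S).card ≤ 3 * S.card := by
    calc _ ≤ _ := Finset.card_le_card hclos
      _ ≤ S.card + (S.biUnion (fun w => Finset.univ.filter (fun x => Con l₀ x w))).card :=
          Finset.card_union_le _ _
      _ ≤ S.card + S.card * 2 := by
          gcongr
          exact Finset.card_biUnion_le_card_mul _ _ _ (fun w _ => card_con_le hp0.1 w)
      _ = _ := by ring
  -- ends in `Z`
  have hZ : ∀ s ∈ S ∩ Z, ∃ y ∈ S \ Z, ∃ x ∉ Z, F.Adj y x ∧ F.Adj x s := by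
    intro s hs
    rw [Finset.mem_inter] at hs
    obtain ⟨l, hl, hls⟩ := (memS s).1 hs.1
    have hpl := (hl.spec hp0).1
    have main : ∀ x, F.Adj s x → ∀ l₁ y l₂, l = l₁ ++ x :: y :: l₂ →
        (y :: l₂).getLast? = some s → y ≠ s → ∃ y ∈ S \ Z, ∃ x ∉ Z, F.Adj y x ∧ F.Adj x s := by
      intro x hsx l₁ y l₂ hleq hu2 hys
      subst hleq
      have hyS : y ∈ S := (memS y).2 ⟨_, Rot.step l₁ x y l₂ s hl hu2 hsx, getLast?_rotate ..⟩
      have hl1 : l₁ ≠ [] := by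
        rintro rfl
        refine hcyc a s (hEnd _ _ hl hls) ?_
        have h3 := (hl.spec hp0).2.2
        rw [hh0] at h3
        simp at h3
        rw [← h3]; exact hsx
      obtain ⟨l₃, q, rfl⟩ := List.eq_nil_or_concat l₁ |>.resolve_left hl1
      have hch := hpl.2
      have hnd := hpl.1
      rw [List.isChain_append, List.isChain_cons] at hch
      have hxy : F.Adj x y := hch.2.1.1 y (by simp)
      have hqx : F.Adj q x := hch.2.2 q (by simp) x (by simp)
      have hs2 : s ∈ y :: l₂ := List.mem_of_getLast? hu2
      have hqy : q ≠ y ∧ q ≠ s := by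
        rw [List.nodup_append] at hnd
        refine ⟨hnd.2.2 q (by simp) y (by simp), hnd.2.2 q (by simp) s (by simp at hs2 ⊢; tauto)⟩
      have hxZ : x ∉ Z := by
        intro hxZ
        have h2 := Z1 x hxZ
        have : ({q, y, s} : Finset V) ⊆ nb F x := by
          intro t ht
          simp only [Finset.mem_insert, Finset.mem_singleton] at ht
          rcases ht with rfl | rfl | rfl
          · exact mem_nb.2 hqx.symm
          · exact mem_nb.2 hxy
          · exact mem_nb.2 hsx.symm
        have h3 := Finset.card_le_card this
        rw [Finset.card_eq_three.2 ⟨q, y, s, hqy.1, hqy.2, hys, rfl⟩] at h3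
        omega
      have hyZ : y ∉ Z := by
        intro hyZ
        have : ({y, s} : Finset V) ⊆ nb F x ∩ Z := by
          intro t ht
          simp only [Finset.mem_insert, Finset.mem_singleton] at ht
          rcases ht with rfl | rfl
          · exact Finset.mem_inter.2 ⟨mem_nb.2 hxy, hyZ⟩
          · exact Finset.mem_inter.2 ⟨mem_nb.2 hsx.symm, hs.2⟩
        have h3 := Finset.card_le_card this
        rw [Finset.card_pair hys] at h3
        have := Z2 x hxZ
        omega
      exact ⟨y, Finset.mem_sdiff.2 ⟨hyS, hyZ⟩, x, hxZ, hxy.symm, hsx.symm⟩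
    obtain ⟨x₁, x₂, hne, hnb⟩ := Finset.card_eq_two.1 (Z1 s hs.2)
    have h1 : F.Adj s x₁ := mem_nb.1 (by rw [hnb]; simp)
    have h2 : F.Adj s x₂ := mem_nb.1 (by rw [hnb]; simp)
    obtain ⟨l₁, y, l₂, e1, u1⟩ := split_at_mem (hin l s x₁ hl hls h1) hls h1.ne'
    obtain ⟨l₁', y', l₂', e2, u2⟩ := split_at_mem (hin l s x₂ hl hls h2) hls h2.ne'
    by_cases hy : y = s
    · by_cases hy' : y' = s
      · exfalso
        subst hy hy'
        have hnd := hpl.1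
        have aux : ∀ (p : List V) z q, l = p ++ z :: y' :: q → (y' :: q).getLast? = some y' →
            l = p ++ [z, y'] := by
          intro p z q he hq
          cases q with
          | nil => exact he
          | cons r q =>
            exfalso
            rw [he, List.nodup_append] at hnd
            have h5 := hnd.2.1
            rw [List.getLast?_cons_cons] at hq
            have := List.mem_of_getLast? hq
            simp only [List.nodup_cons] at h5
            exact h5.2.1 this
        have a1 := aux _ _ _ e1 u1
        have a2 := aux _ _ _ e2 u2
        rw [a1] at a2
        have := List.append_inj_right' a2 rfl
        simp at this
        exact hne this
      · exact main x₂ h2 _ _ _ e2 u2 hy'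
    · exact main x₁ h1 _ _ _ e1 u1 hy
  have hSZ : (S ∩ Z).card ≤ (S \ Z).card * 2 := by
    have : S ∩ Z ⊆ (S \ Z).biUnion
        (fun y => Z.filter (fun s => ∃ x ∉ Z, F.Adj y x ∧ F.Adj x s)) := by
      intro s hs
      obtain ⟨y, hy, hx⟩ := hZ s hs
      exact Finset.mem_biUnion.2 ⟨y, hy, Finset.mem_filter.2 ⟨(Finset.mem_inter.1 hs).2, hx⟩⟩
    exact (Finset.card_le_card this).trans
      (Finset.card_biUnion_le_card_mul _ _ _ (fun y hy => Z3 y (Finset.mem_sdiff.1 hy).2))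
  have hsum : (S ∩ Z).card + (S \ Z).card = S.card := Finset.card_inter_add_card_sdiff S Z
  have hSne : S.Nonempty := ⟨b, (memS b).2 ⟨l₀, Rot.refl, hl0⟩⟩
  have hSpos := hSne.card_pos
  refine ⟨S \ Z, ?_, Finset.sdiff_disjoint, ?_, ?_⟩
  · rw [← Finset.card_pos]; omega
  · intro u hu
    obtain ⟨l, hl, hlu⟩ := (memS u).1 (Finset.mem_sdiff.1 hu).1
    exact hEnd l u hl hlu
  · have : S \ Z ∪ nbS F (S \ Z) ⊆ S ∪ nbS F S := by
      intro t ht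
      simp only [Finset.mem_union, mem_nbS, Finset.mem_sdiff] at ht ⊢
      rcases ht with h | ⟨x, hx, h⟩
      · exact Or.inl h.1
      · exact Or.inr ⟨x, hx.1, h⟩
    have := Finset.card_le_card this
    omega

end Posa

section Hitting

open scoped Classical

/-- A family of dense subsets of a ground set has a small transversal. -/
theorem exists_transversal {α ι : Type*} (Ω : Finset α) (B : ι → Finset α)
    (hΩ : Ω.Nonempty) (c : ℝ) (k : ℕ) :
    ∀ I : Finset ι, (∀ i ∈ I, B i ⊆ Ω) → (∀ i ∈ I, c * Ω.card ≤ (B i).card) →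
    (I.card : ℝ) < Real.exp (c * k) →
    ∃ R ⊆ Ω, R.card ≤ k ∧ ∀ i ∈ I, ∃ x ∈ R, x ∈ B i := by
  induction k with
  | zero =>
    intro I _ _ h
    have : I.card < 1 := by
      have : (I.card : ℝ) < 1 := by simpa using h
      exact_mod_cast this
    have : I = ∅ := by rw [← Finset.card_eq_zero]; omega
    subst this
    exact ⟨∅, by simp, by simp, by simp⟩
  | succ k ih =>
    intro I hB hc h
    have hΩ0 : (0 : ℝ) < Ω.card := by exact_mod_cast hΩ.card_pos
    obtain ⟨x, hx, hxc⟩ : ∃ x ∈ Ω, c * I.card ≤ ((I.filter (fun i => x ∈ B i)).card : ℝ) := by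
      by_contra hcon
      push Not at hcon
      have h1 : ∑ x ∈ Ω, ((I.filter (fun i => x ∈ B i)).card : ℝ) < ∑ x ∈ Ω, c * I.card :=
        Finset.sum_lt_sum_of_nonempty hΩ hcon
      have h2 : ∑ x ∈ Ω, (I.filter (fun i => x ∈ B i)).card = ∑ i ∈ I, (B i).card := by
        simp_rw [Finset.card_filter]
        rw [Finset.sum_comm]
        refine Finset.sum_congr rfl (fun i hi => ?_)
        rw [← Finset.card_filter]
        congr 1
        ext y
        simp only [Finset.mem_filter]
        exact ⟨fun h => h.2, fun h => ⟨hB i hi h, h⟩⟩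
      have h3 : ∑ i ∈ I, c * (Ω.card : ℝ) ≤ ∑ i ∈ I, ((B i).card : ℝ) := Finset.sum_le_sum hc
      have h4 : ∑ x ∈ Ω, ((I.filter (fun i => x ∈ B i)).card : ℝ) = ∑ i ∈ I, ((B i).card : ℝ) := by
        exact_mod_cast h2
      rw [h4] at h1
      simp only [Finset.sum_const, nsmul_eq_mul] at h1 h3
      nlinarith
    have hsplit : (I.filter (fun i => x ∈ B i)).card + (I.filter (fun i => x ∉ B i)).card = I.card :=
      Finset.card_filter_add_card_filter_not _
    obtain ⟨R, hR, hRk, hRI⟩ := ih (I.filter (fun i => x ∉ B i))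
      (fun i hi => hB i (Finset.mem_filter.1 hi).1) (fun i hi => hc i (Finset.mem_filter.1 hi).1) (by
        have h1 : ((I.filter (fun i => x ∉ B i)).card : ℝ) ≤ (1 - c) * I.card := by
          have : ((I.filter (fun i => x ∈ B i)).card : ℝ) + (I.filter (fun i => x ∉ B i)).card
            = I.card := by exact_mod_cast hsplit
          linarith
        have h2 : (1 - c) * I.card ≤ Real.exp (-c) * I.card := by
          gcongr
          linarith [Real.add_one_le_exp (-c)]
        have h3 : Real.exp (-c) * I.card < Real.exp (-c) * Real.exp (c * (k + 1 : ℕ)) := by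
          gcongr
        rw [← Real.exp_add] at h3
        have : -c + c * ((k + 1 : ℕ) : ℝ) = c * k := by push_cast; ring
        rw [this] at h3
        linarith)
    refine ⟨insert x R, Finset.insert_subset hx hR, (Finset.card_insert_le _ _).trans (by omega), ?_⟩
    intro i hi
    by_cases hxi : x ∈ B i
    · exact ⟨x, by simp, hxi⟩
    · obtain ⟨y, hy, hyi⟩ := hRI i (Finset.mem_filter.2 ⟨hi, hxi⟩)
      exact ⟨y, by simp [hy], hyi⟩

end Hitting

section Sparsify

open scoped Classical

/-- Small configurations around a set `T` of exceptional vertices are absent. -/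
structure Spread (G : SimpleGraph V) (T : Finset V) : Prop where
  star : ∀ v a b c, a ∈ T → b ∈ T → c ∈ T → a ≠ b → a ≠ c → b ≠ c →
    G.Adj v a → G.Adj v b → G.Adj v c → False
  path₃ : ∀ a b c, a ∈ T → b ∈ T → c ∈ T → a ≠ c → G.Adj a b → G.Adj b c → False
  path₄ : ∀ a x b c, a ∈ T → x ∉ T → b ∈ T → c ∈ T → a ≠ b → a ≠ c →
    G.Adj a x → G.Adj x b → G.Adj b c → False
  path₅ : ∀ a x b y c, a ∈ T → x ∉ T → b ∈ T → y ∉ T → c ∈ T → a ≠ b → a ≠ c → b ≠ c → x ≠ y →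
    G.Adj a x → G.Adj x b → G.Adj b y → G.Adj y c → False
  spider : ∀ y x₁ x₂ x₃ t₁ t₂ t₃, y ∉ T → x₁ ∉ T → x₂ ∉ T → x₃ ∉ T → t₁ ∈ T → t₂ ∈ T → t₃ ∈ T →
    x₁ ≠ x₂ → x₁ ≠ x₃ → x₂ ≠ x₃ → t₁ ≠ t₂ → t₁ ≠ t₃ → t₂ ≠ t₃ →
    G.Adj y x₁ → G.Adj y x₂ → G.Adj y x₃ → G.Adj x₁ t₁ → G.Adj x₂ t₂ → G.Adj x₃ t₃ → False
  triangle : ∀ a b c, a ∈ T → G.Adj a b → G.Adj b c → G.Adj a c → False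
  square : ∀ a b c e, a ∈ T → a ≠ c → b ≠ e →
    G.Adj a b → G.Adj b c → G.Adj c e → G.Adj e a → False

lemma Spread.mono {G H : SimpleGraph V} {T : Finset V} (h : Spread G T) (hHG : H ≤ G) :
    Spread H T where
  star v a b c := fun h1 h2 h3 h4 h5 h6 h7 h8 h9 =>
    h.star v a b c h1 h2 h3 h4 h5 h6 (hHG h7) (hHG h8) (hHG h9)
  path₃ a b c := fun h1 h2 h3 h4 h5 h6 => h.path₃ a b c h1 h2 h3 h4 (hHG h5) (hHG h6)
  path₄ a x b c := fun h1 h2 h3 h4 h5 h6 h7 h8 h9 =>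
    h.path₄ a x b c h1 h2 h3 h4 h5 h6 (hHG h7) (hHG h8) (hHG h9)
  path₅ a x b y c := fun h1 h2 h3 h4 h5 h6 h7 h8 h9 h10 h11 h12 h13 =>
    h.path₅ a x b y c h1 h2 h3 h4 h5 h6 h7 h8 h9 (hHG h10) (hHG h11) (hHG h12) (hHG h13)
  spider y x₁ x₂ x₃ t₁ t₂ t₃ := fun h1 h2 h3 h4 h5 h6 h7 h8 h9 h10 h11 h12 h13 g1 g2 g3 g4 g5 g6 =>
    h.spider y x₁ x₂ x₃ t₁ t₂ t₃ h1 h2 h3 h4 h5 h6 h7 h8 h9 h10 h11 h12 h13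
      (hHG g1) (hHG g2) (hHG g3) (hHG g4) (hHG g5) (hHG g6)
  triangle a b c := fun h1 h2 h3 h4 => h.triangle a b c h1 (hHG h2) (hHG h3) (hHG h4)
  square a b c e := fun h1 h2 h3 h4 h5 h6 h7 =>
    h.square a b c e h1 h2 h3 (hHG h4) (hHG h5) (hHG h6) (hHG h7)

/-- Thinning the graph so that every vertex of a small set `Z ⊇ T` has degree exactly two. -/
theorem exists_thinning [Fintype V] (Γ : SimpleGraph V) (T : Finset V) (hS : Spread Γ T)
    (hdeg : ∀ t ∈ T, 2 ≤ (nb Γ t).card) :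
    ∃ (Γ' : SimpleGraph V) (Z : Finset V), Γ' ≤ Γ ∧ T ⊆ Z ∧ Z.card ≤ 2 * T.card ∧
      (∀ z ∈ Z, (nb Γ' z).card = 2) ∧
      (∀ x ∉ Z, (nb Γ' x ∩ Z).card ≤ 1) ∧
      (∀ y ∉ Z, (Z.filter (fun s => ∃ x ∉ Z, Γ'.Adj y x ∧ Γ'.Adj x s)).card ≤ 2) ∧
      (∀ v ∉ Z, (nb Γ v ∩ Z).card ≤ 4) ∧
      (∀ u ∉ Z, ∀ v ∉ Z, Γ.Adj u v → Γ'.Adj u v) ∧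
      (∀ C : Finset V, C ⊆ Z → C.Nonempty → ∃ u ∈ C, ∃ v ∉ C, Γ'.Adj u v) := by
  have hchoice : ∀ t, ∃ N : Finset V, t ∈ T → (N ⊆ nb Γ t ∧ N.card = 2 ∧ nb Γ t ∩ T ⊆ N) := by
    intro t
    by_cases ht : t ∈ T
    · have h1 : (nb Γ t ∩ T).card ≤ 2 := by
        by_contra hcon
        push Not at hcon
        obtain ⟨a, ha, b, hb, c, hc, hab, hac, hbc⟩ := Finset.two_lt_card.1 hcon
        simp only [Finset.mem_inter, mem_nb] at ha hb hc
        exact hS.star t a b c ha.2 hb.2 hc.2 hab hac hbc ha.1 hb.1 hc.1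
      obtain ⟨N, hN1, hN2, hN3⟩ := Finset.exists_subsuperset_card_eq
        (Finset.inter_subset_left (s₁ := nb Γ t) (s₂ := T)) h1 (hdeg t ht)
      exact ⟨N, fun _ => ⟨hN2, hN3, hN1⟩⟩
    · exact ⟨∅, fun h => absurd h ht⟩
  choose N hN using hchoice
  have hNadj : ∀ t ∈ T, ∀ x ∈ N t, Γ.Adj t x := fun t ht x hx => mem_nb.1 ((hN t ht).1 hx)
  set X : Finset V := Finset.univ.filter (fun x => x ∉ T ∧ 2 ≤ (T.filter (fun t => x ∈ N t)).card)
    with hX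
  have memX : ∀ x, x ∈ X ↔ x ∉ T ∧ 2 ≤ (T.filter (fun t => x ∈ N t)).card := by simp [hX]
  have hXc : X.card ≤ T.card := by
    have h1 : ∑ x ∈ X, (T.filter (fun t => x ∈ N t)).card ≤ ∑ t ∈ T, (N t).card := by
      simp_rw [Finset.card_filter]
      rw [Finset.sum_comm]
      refine Finset.sum_le_sum (fun t ht => ?_)
      rw [← Finset.card_filter]
      refine Finset.card_le_card (fun x hx => (Finset.mem_filter.1 hx).2)
    have h2 : X.card * 2 ≤ ∑ x ∈ X, (T.filter (fun t => x ∈ N t)).card := by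
      rw [← smul_eq_mul]
      exact Finset.card_nsmul_le_sum _ _ _ (fun x hx => ((memX x).1 hx).2)
    have h3 : ∑ t ∈ T, (N t).card = T.card * 2 := by
      rw [Finset.sum_congr rfl (fun t ht => (hN t ht).2.1)]; simp
    omega
  set Z := T ∪ X with hZ
  have memZ : ∀ x, x ∈ Z ↔ x ∈ T ∨ x ∈ X := by simp [hZ]
  let Γ' : SimpleGraph V :=
    { Adj := fun u v => Γ.Adj u v ∧ ((u ∈ T ∧ v ∈ N u) ∨ (v ∈ T ∧ u ∈ N v) ∨ (u ∉ Z ∧ v ∉ Z))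
      symm := ⟨fun u v h => ⟨h.1.symm, by tauto⟩⟩
      loopless := ⟨fun u h => Γ.loopless.irrefl u h.1⟩ }
  have adj' : ∀ u v, Γ'.Adj u v ↔
      Γ.Adj u v ∧ ((u ∈ T ∧ v ∈ N u) ∨ (v ∈ T ∧ u ∈ N v) ∨ (u ∉ Z ∧ v ∉ Z)) := fun u v => Iff.rfl
  have nbT : ∀ t ∈ T, nb Γ' t = N t := by
    intro t ht
    ext x
    rw [mem_nb, adj']
    constructor
    · rintro ⟨h1, ⟨_, h2⟩ | ⟨h2, h3⟩ | ⟨h2, _⟩⟩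
      · exact h2
      · exact (hN t ht).2.2 (Finset.mem_inter.2 ⟨mem_nb.2 h1, h2⟩)
      · exact absurd ((memZ t).2 (Or.inl ht)) h2
    · intro hx
      exact ⟨hNadj t ht x hx, Or.inl ⟨ht, hx⟩⟩
  have nbX : ∀ x ∈ X, nb Γ' x = T.filter (fun t => x ∈ N t) := by
    intro x hx
    ext t
    rw [mem_nb, adj', Finset.mem_filter]
    constructor
    · rintro ⟨h1, ⟨h2, _⟩ | h2 | ⟨h2, _⟩⟩
      · exact absurd h2 ((memX x).1 hx).1
      · exact h2
      · exact absurd ((memZ x).2 (Or.inr hx)) h2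
    · rintro ⟨h1, h2⟩
      exact ⟨(hNadj t h1 x h2).symm, Or.inr (Or.inl ⟨h1, h2⟩)⟩
  have cT : ∀ v, (nb Γ v ∩ T).card ≤ 2 := by
    intro v
    by_contra hcon
    push Not at hcon
    obtain ⟨a, ha, b, hb, c, hc, hab, hac, hbc⟩ := Finset.two_lt_card.1 hcon
    simp only [Finset.mem_inter, mem_nb] at ha hb hc
    exact hS.star v a b c ha.2 hb.2 hc.2 hab hac hbc ha.1 hb.1 hc.1
  have Z1 : ∀ z ∈ Z, (nb Γ' z).card = 2 := by
    intro z hz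
    rcases (memZ z).1 hz with hz | hz
    · rw [nbT z hz]; exact (hN z hz).2.1
    · rw [nbX z hz]
      refine le_antisymm ?_ ((memX z).1 hz).2
      refine le_trans (Finset.card_le_card ?_) (cT z)
      intro t ht
      rw [Finset.mem_filter] at ht
      exact Finset.mem_inter.2 ⟨mem_nb.2 (hNadj t ht.1 z ht.2).symm, ht.1⟩
  have toZ : ∀ x ∉ Z, ∀ s ∈ Z, Γ'.Adj x s → s ∈ T ∧ x ∈ N s := by
    intro x hx s hs h
    rcases ((adj' _ _).1 h).2 with h | h | h
    · exact absurd ((memZ x).2 (Or.inl h.1)) hx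
    · exact h
    · exact absurd hs h.2
  have nT : ∀ x ∉ Z, x ∉ T := fun x hx h => hx ((memZ x).2 (Or.inl h))
  have Z2 : ∀ x ∉ Z, (nb Γ' x ∩ Z).card ≤ 1 := by
    intro x hx
    have h1 : nb Γ' x ∩ Z ⊆ T.filter (fun t => x ∈ N t) := by
      intro s hs
      rw [Finset.mem_inter, mem_nb] at hs
      exact Finset.mem_filter.2 (toZ x hx s hs.2 hs.1)
    have h2 : x ∉ X := fun h => hx ((memZ x).2 (Or.inr h))
    rw [memX] at h2
    push Not at h2
    have := Finset.card_le_card h1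
    have := h2 (nT x hx)
    omega
  refine ⟨Γ', Z, fun u v h => h.1, Finset.subset_union_left, ?_, Z1, Z2, ?_, ?_, ?_, ?_⟩
  · have h := Finset.card_union_le T X
    rw [← hZ] at h
    omega
  · intro y hy
    by_contra hcon
    push Not at hcon
    obtain ⟨a, ha, b, hb, c, hc, hab, hac, hbc⟩ := Finset.two_lt_card.1 hcon
    simp only [Finset.mem_filter] at ha hb hc
    obtain ⟨haZ, x₁, hx1, hy1, h1⟩ := ha
    obtain ⟨hbZ, x₂, hx2, hy2, h2⟩ := hb
    obtain ⟨hcZ, x₃, hx3, hy3, h3⟩ := hc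
    have dist : ∀ s ∈ Z, ∀ s' ∈ Z, s ≠ s' → ∀ x ∉ Z, ∀ x', Γ'.Adj x s → Γ'.Adj x' s' → x ≠ x' := by
      rintro s hs s' hs' hss x hx _ h1 h2 rfl
      have : ({s, s'} : Finset V) ⊆ nb Γ' x ∩ Z := by
        intro t ht
        simp only [Finset.mem_insert, Finset.mem_singleton] at ht
        rcases ht with rfl | rfl
        · exact Finset.mem_inter.2 ⟨mem_nb.2 h1, hs⟩
        · exact Finset.mem_inter.2 ⟨mem_nb.2 h2, hs'⟩
      have h3 := Finset.card_le_card this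
      rw [Finset.card_pair hss] at h3
      have := Z2 x hx
      omega
    exact hS.spider y x₁ x₂ x₃ a b c (nT y hy) (nT _ hx1) (nT _ hx2) (nT _ hx3)
      (toZ _ hx1 _ haZ h1).1 (toZ _ hx2 _ hbZ h2).1 (toZ _ hx3 _ hcZ h3).1
      (dist a haZ b hbZ hab _ hx1 _ h1 h2) (dist a haZ c hcZ hac _ hx1 _ h1 h3)
      (dist b hbZ c hcZ hbc _ hx2 _ h2 h3) hab hac hbc hy1.1 hy2.1 hy3.1 h1.1 h2.1 h3.1
  · intro v hv
    have hX2 : (nb Γ v ∩ X).card ≤ 2 := by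
      by_contra hcon
      push Not at hcon
      obtain ⟨a, ha, b, hb, c, hc, hab, hac, hbc⟩ := Finset.two_lt_card.1 hcon
      simp only [Finset.mem_inter, mem_nb] at ha hb hc
      have pick : ∀ x ∈ X, ∃ t ∈ T, Γ.Adj x t := by
        intro x hx
        have h2 := ((memX x).1 hx).2
        obtain ⟨t, ht⟩ := Finset.card_pos.1 (by omega : 0 < (T.filter (fun t => x ∈ N t)).card)
        rw [Finset.mem_filter] at ht
        exact ⟨t, ht.1, (hNadj t ht.1 x ht.2).symm⟩
      obtain ⟨t₁, ht1, h1⟩ := pick a ha.2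
      obtain ⟨t₂, ht2, h2⟩ := pick b hb.2
      obtain ⟨t₃, ht3, h3⟩ := pick c hc.2
      have dist : ∀ x x' t t', t ∈ T → x ≠ x' → Γ.Adj v x → Γ.Adj v x' → Γ.Adj x t →
          Γ.Adj x' t' → t ≠ t' := by
        rintro x x' t _ ht hxx hvx hvx' hxt hxt' rfl
        exact hS.square t x v x' ht (fun h => nT v hv (h ▸ ht)) hxx hxt.symm hvx.symm hvx' hxt'
      exact hS.spider v a b c t₁ t₂ t₃ (nT v hv) ((memX a).1 ha.2).1 ((memX b).1 hb.2).1
        ((memX c).1 hc.2).1 ht1 ht2 ht3 hab hac hbc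
        (dist a b _ _ ht1 hab ha.1 hb.1 h1 h2) (dist a c _ _ ht1 hac ha.1 hc.1 h1 h3)
        (dist b c _ _ ht2 hbc hb.1 hc.1 h2 h3) ha.1 hb.1 hc.1 h1 h2 h3
    rw [hZ, Finset.inter_union_distrib_left]
    have := Finset.card_union_le (nb Γ v ∩ T) (nb Γ v ∩ X)
    have := cT v
    omega
  · intro u hu v hv h
    exact ⟨h, Or.inr (Or.inr ⟨hu, hv⟩)⟩
  · intro C hCZ hCne
    by_contra hcon
    push Not at hcon
    have hclosed : ∀ u ∈ C, ∀ v, Γ'.Adj u v → v ∈ C := by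
      intro u hu v h
      by_contra hv
      exact hcon u hu v hv h
    have two : ∀ z ∈ C, ∀ w, ∃ w', w' ≠ w ∧ Γ'.Adj z w' ∧ w' ∈ C := by
      intro z hz w
      have h := Z1 z (hCZ hz)
      obtain ⟨w', hw', hne⟩ := Finset.exists_mem_ne (by omega : 1 < (nb Γ' z).card) w
      rw [mem_nb] at hw'
      exact ⟨w', hne, hw', hclosed z hz w' hw'⟩
    have XtoT : ∀ x ∈ X, ∀ t, Γ'.Adj x t → t ∈ T := by
      intro x hx t h
      have : t ∈ nb Γ' x := mem_nb.2 h
      rw [nbX x hx] at this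
      exact (Finset.mem_filter.1 this).1
    have nXT : ∀ x ∈ X, x ∉ T := fun x hx => ((memX x).1 hx).1
    by_cases hCX : ∃ x ∈ C, x ∈ X
    · obtain ⟨x, hxC, hx⟩ := hCX
      obtain ⟨t₁, _, hxt1, ht1C⟩ := two x hxC x
      obtain ⟨t₂, hne, hxt2, ht2C⟩ := two x hxC t₁
      have ht1 := XtoT x hx _ hxt1
      have ht2 := XtoT x hx _ hxt2
      obtain ⟨y, hyx, h1y, hyC⟩ := two t₁ ht1C x
      by_cases hyT : y ∈ T
      · by_cases hyt : y = t₂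
        · subst hyt
          exact hS.triangle t₁ x y ht1 hxt1.1.symm hxt2.1 h1y.1
        · exact hS.path₄ t₂ x t₁ y ht2 (nXT x hx) ht1 hyT hne (Ne.symm hyt) hxt2.1.symm hxt1.1 h1y.1
      · have hyX : y ∈ X := ((memZ y).1 (hCZ hyC)).resolve_left hyT
        obtain ⟨t₃, h31, hyt3, ht3C⟩ := two y hyC t₁
        have ht3 := XtoT y hyX _ hyt3
        by_cases h32 : t₃ = t₂
        · subst h32
          exact hS.square t₁ x t₃ y ht1 (Ne.symm hne) (Ne.symm hyx) hxt1.1.symm hxt2.1 hyt3.1.symm h1y.1.symm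
        · exact hS.path₅ t₂ x t₁ y t₃ ht2 (nXT x hx) ht1 hyT ht3 hne (Ne.symm h32) (Ne.symm h31)
            (Ne.symm hyx) hxt2.1.symm hxt1.1 h1y.1 hyt3.1
    · push Not at hCX
      have hCT : ∀ x ∈ C, x ∈ T := fun x hx => ((memZ x).1 (hCZ hx)).resolve_right (hCX x hx)
      obtain ⟨t, ht⟩ := hCne
      obtain ⟨a, _, hta, haC⟩ := two t ht t
      obtain ⟨b, hba, htb, hbC⟩ := two t ht a
      exact hS.path₃ a t b (hCT a haC) (hCT t ht) (hCT b hbC) (Ne.symm hba) hta.1.symm htb.1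

end Sparsify

section Counting

open scoped Classical
set_option linter.unusedSectionVars false
variable [Fintype V]

/-- Number of ordered pairs of a set which are adjacent. -/
def cnt (G : SimpleGraph V) (Q : Finset (V × V)) : ℕ := (Q.filter (fun q => G.Adj q.1 q.2)).card

/-- Number of darts. -/
def dc (G : SimpleGraph V) : ℕ := cnt G Finset.univ

/-- The spanning subgraph with edges taken from a set of pairs. -/
def sub (H : SimpleGraph V) (R : Finset (V × V)) : SimpleGraph V where
  Adj u v := H.Adj u v ∧ ((u, v) ∈ R ∨ (v, u) ∈ R)
  symm := ⟨fun _ _ h => ⟨h.1.symm, h.2.symm⟩⟩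
  loopless := ⟨fun u h => H.loopless.irrefl u h.1⟩

lemma sub_le (H : SimpleGraph V) (R : Finset (V × V)) : sub H R ≤ H := fun _ _ h => h.1

lemma dc_sub_le (H : SimpleGraph V) (R : Finset (V × V)) : dc (sub H R) ≤ 2 * R.card := by
  have : Finset.univ.filter (fun q : V × V => (sub H R).Adj q.1 q.2) ⊆ R ∪ R.image Prod.swap := by
    rintro ⟨u, v⟩ h
    rw [Finset.mem_filter] at h
    rcases h.2.2 with h | h
    · exact Finset.mem_union_left _ h
    · exact Finset.mem_union_right _ (Finset.mem_image.2 ⟨(v, u), h, rfl⟩)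
  have h1 := Finset.card_le_card this
  have h2 := Finset.card_union_le R (R.image Prod.swap)
  have h3 := Finset.card_image_le (s := R) (f := Prod.swap)
  unfold dc cnt
  omega

lemma cnt_lower (G H : SimpleGraph V) (hle : H ≤ G) (Q : Finset (V × V)) (P B : Finset V)
    (n d ε γ ρ κ : ℝ) (hn : 0 < n) (hd : 0 < d) (hε1 : ε ≤ 1 / 4) (hε0 : 0 < ε)
    (hQP : ∀ q ∈ Q, q.1 ∈ P)
    (hQ : ∀ b ∈ P, (1 / 2 - ε / 2) * n ≤ ((Q.filter (fun q => q.1 = b)).card : ℝ))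
    (hP : ρ * n ≤ P.card)
    (hcnt : (1 - γ) * (d / n) * Q.card ≤ cnt G Q)
    (hB : ∑ v ∈ B, ((nb G v).card : ℝ) ≤ κ * n * d)
    (hloss : ∀ v ∉ B, ((nb G v).card : ℝ) - (nb H v).card ≤ (1 / 2 - ε) * d)
    (hγ : γ ≤ ε / 2) (hκ : κ ≤ ρ * ε / 8) :
    ρ * ε / 8 * n * d ≤ cnt H Q := by
  have hQcard : (P.card : ℝ) * ((1 / 2 - ε / 2) * n) ≤ Q.card := by
    have h1 : Q.card = ∑ b ∈ P, (Q.filter (fun q => q.1 = b)).card :=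
      Finset.card_eq_sum_card_fiberwise (fun q hq => hQP q hq)
    rw [h1]; push_cast
    rw [← nsmul_eq_mul]
    exact Finset.card_nsmul_le_sum _ _ _ hQ
  have hlossdeg : ∀ v, ((nb G v \ nb H v).card : ℝ) = (nb G v).card - (nb H v).card := by
    intro v
    have hs : nb H v ⊆ nb G v := by
      intro x hx; rw [mem_nb] at hx ⊢; exact hle hx
    have := Finset.card_sdiff_add_card_eq_card hs
    have : (((nb G v \ nb H v).card + (nb H v).card : ℕ) : ℝ) = (nb G v).card := by rw [this]
    push_cast at this
    linarith
  have hdiff : (cnt G Q : ℝ) ≤ cnt H Q + ∑ b ∈ P, ((nb G b \ nb H b).card : ℝ) := by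
    have h1 : Q.filter (fun q => G.Adj q.1 q.2) ⊆ Q.filter (fun q => H.Adj q.1 q.2) ∪
        P.biUnion (fun b => (nb G b \ nb H b).image (fun x => (b, x))) := by
      rintro ⟨u, v⟩ h
      rw [Finset.mem_filter] at h
      by_cases hH : H.Adj u v
      · exact Finset.mem_union_left _ (Finset.mem_filter.2 ⟨h.1, hH⟩)
      · refine Finset.mem_union_right _ (Finset.mem_biUnion.2 ⟨u, hQP _ h.1, ?_⟩)
        exact Finset.mem_image.2
          ⟨v, Finset.mem_sdiff.2 ⟨mem_nb.2 h.2, fun h' => hH (mem_nb.1 h')⟩, rfl⟩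
    have h2 := (Finset.card_le_card h1).trans (Finset.card_union_le _ _)
    have h3 : (P.biUnion (fun b => (nb G b \ nb H b).image (fun x => (b, x)))).card ≤
        ∑ b ∈ P, (nb G b \ nb H b).card :=
      Finset.card_biUnion_le.trans (Finset.sum_le_sum (fun b _ => Finset.card_image_le))
    have h4 := h2.trans (Nat.add_le_add_left h3 _)
    unfold cnt
    exact_mod_cast h4
  have hpos : 0 ≤ (1 / 2 - ε) * d := mul_nonneg (by linarith) hd.le
  have hsum : ∑ b ∈ P, ((nb G b \ nb H b).card : ℝ) ≤ κ * n * d + P.card * ((1 / 2 - ε) * d) := by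
    rw [← Finset.sum_filter_add_sum_filter_not P (· ∈ B)]
    refine add_le_add ?_ ?_
    · refine le_trans ?_ hB
      refine le_trans (Finset.sum_le_sum (g := fun b => ((nb G b).card : ℝ)) ?_) ?_
      · intro b _
        exact_mod_cast Finset.card_le_card Finset.sdiff_subset
      · refine Finset.sum_le_sum_of_subset_of_nonneg ?_ (fun _ _ _ => by positivity)
        intro b hb; exact (Finset.mem_filter.1 hb).2
    · calc ∑ b ∈ P.filter (· ∉ B), ((nb G b \ nb H b).card : ℝ) ≤
          (P.filter (· ∉ B)).card * ((1 / 2 - ε) * d) := by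
            rw [← nsmul_eq_mul]
            refine Finset.sum_le_card_nsmul _ _ _ (fun b hb => ?_)
            rw [hlossdeg]
            exact hloss b (Finset.mem_filter.1 hb).2
        _ ≤ _ := by
            gcongr
            exact Finset.filter_subset _ _
  have hP0 : (0 : ℝ) ≤ P.card := by positivity
  have h1 : (1 - γ) * (d / n) * (P.card * ((1 / 2 - ε / 2) * n)) ≤ (1 - γ) * (d / n) * Q.card := by
    refine mul_le_mul_of_nonneg_left hQcard (mul_nonneg (by linarith) (by positivity))
  have h2 : (1 - γ) * (d / n) * (P.card * ((1 / 2 - ε / 2) * n)) =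
      (1 - γ) * (1 / 2 - ε / 2) * (P.card * d) := by field_simp
  have h3 : (1 / 2 - 3 * ε / 4) * (P.card * d) ≤ (1 - γ) * (1 / 2 - ε / 2) * (P.card * d) := by
    gcongr
    nlinarith
  have h4 : ρ * n * (d * (ε / 4)) ≤ P.card * (d * (ε / 4)) := by gcongr
  have h5 : κ * (n * d) ≤ ρ * ε / 8 * (n * d) := by gcongr
  nlinarith

/-- The endpoints of paths with `ℓ` vertices starting in `a`. -/
def endSet (F : SimpleGraph V) (ℓ : ℕ) (a : V) : Finset V := Finset.univ.filter (EndP F ℓ a)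

lemma mem_endSet {F : SimpleGraph V} {ℓ : ℕ} {a b : V} : b ∈ endSet F ℓ a ↔ EndP F ℓ a b := by
  simp [endSet]

/-- A path realising `EndP`. -/
def pth (F : SimpleGraph V) (ℓ : ℕ) (a b : V) : List V :=
  if h : EndP F ℓ a b then h.choose else []

lemma pth_spec {F : SimpleGraph V} {ℓ : ℕ} {a b : V} (h : EndP F ℓ a b) :
    PathL F (pth F ℓ a b) ∧ (pth F ℓ a b).length = ℓ ∧ (pth F ℓ a b).head? = some a ∧
      (pth F ℓ a b).getLast? = some b := by
  rw [pth, dif_pos h]; exact h.choose_spec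

/-- Pairs whose adjacency would rotate a path from `a` into one ending in `Y`. -/
def rotPairs (F : SimpleGraph V) (i : Fin (Fintype.card V + 1) × V × Finset V) : Finset (V × V) :=
  Finset.univ.filter (fun q => EndP F i.1 i.2.1 q.1 ∧
    (pth F i.1 i.2.1 q.1).formPerm q.2 ∈ i.2.2)

/-- Pairs of endpoints of paths with `ℓ` vertices. -/
def closePairs (F : SimpleGraph V) (i : Fin (Fintype.card V + 1)) : Finset (V × V) :=
  Finset.univ.filter (fun q => Fintype.card V ≤ 2 * (endSet F i q.1).card ∧ EndP F i q.1 q.2)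

lemma card_rotPairs_fiber (F : SimpleGraph V) (ℓ : Fin (Fintype.card V + 1)) (a b : V)
    (Y : Finset V) (h : EndP F ℓ a b) :
    ((rotPairs F (ℓ, a, Y)).filter (fun q => q.1 = b)).card = Y.card := by
  refine Finset.card_bij' (fun q _ => (pth F ℓ a b).formPerm q.2)
    (fun y _ => (b, (pth F ℓ a b).formPerm.symm y)) ?_ ?_ ?_ ?_
  · rintro ⟨b', x⟩ hq
    simp only [rotPairs, Finset.mem_filter, Finset.mem_univ, true_and] at hq
    obtain ⟨⟨_, h2⟩, rfl⟩ := hq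
    exact h2
  · intro y hy
    simp [rotPairs, h, hy]
  · rintro ⟨b', x⟩ hq
    simp only [rotPairs, Finset.mem_filter, Finset.mem_univ, true_and] at hq
    simp [hq.2]
  · intro y hy
    simp

lemma card_closePairs_fiber (F : SimpleGraph V) (ℓ : Fin (Fintype.card V + 1)) (a : V)
    (h : Fintype.card V ≤ 2 * (endSet F ℓ a).card) :
    ((closePairs F ℓ).filter (fun q => q.1 = a)).card = (endSet F ℓ a).card := by
  refine Finset.card_bij' (fun q _ => q.2) (fun y _ => (a, y)) ?_ ?_ ?_ ?_
  · rintro ⟨b', x⟩ hq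
    simp only [closePairs, Finset.mem_filter, Finset.mem_univ, true_and] at hq
    obtain ⟨⟨_, h2⟩, rfl⟩ := hq
    exact mem_endSet.2 h2
  · intro y hy
    simp [closePairs, h, mem_endSet.1 hy]
  · rintro ⟨b', x⟩ hq
    simp only [closePairs, Finset.mem_filter, Finset.mem_univ, true_and] at hq
    simp [hq.2]
  · intro y hy
    simp

lemma exists_hit {ι : Type*} (H : SimpleGraph V) (I : Finset ι) (Q : ι → Finset (V × V))
    (c d n : ℝ) (hn : n = Fintype.card V) (hc : 0 < c) (hnd : 0 < n * d)
    (hI : I.card ≤ 2 ^ Fintype.card V * 2 ^ Fintype.card V)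
    (hQ : ∀ i ∈ I, c * n * d ≤ cnt H (Q i)) (hdc : (dc H : ℝ) ≤ n * d) :
    ∃ R : Finset (V × V), (R.card : ℝ) ≤ 2 * n / c + 2 ∧
      ∀ i ∈ I, ∃ q ∈ R, q ∈ Q i ∧ H.Adj q.1 q.2 := by
  rcases I.eq_empty_or_nonempty with rfl | ⟨i₀, hi₀⟩
  · refine ⟨∅, ?_, by simp⟩
    have : (0 : ℝ) ≤ n := by rw [hn]; positivity
    simp; positivity
  have hn0 : (0 : ℝ) ≤ n := by rw [hn]; positivity
  have hexp : (2 : ℝ) ≤ Real.exp 1 := by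
    have := Real.add_one_le_exp (1 : ℝ); linarith
  obtain ⟨R, hR, hRc, hRI⟩ := exists_transversal
    (Finset.univ.filter (fun q : V × V => H.Adj q.1 q.2))
    (fun i => (Q i).filter (fun q => H.Adj q.1 q.2)) (by
      have h1 := hQ i₀ hi₀
      have h2 : (0 : ℝ) < cnt H (Q i₀) := by
        refine lt_of_lt_of_le ?_ h1
        rw [mul_assoc]; positivity
      have h3 : 0 < ((Q i₀).filter (fun q => H.Adj q.1 q.2)).card := by
        unfold cnt at h2; exact_mod_cast h2
      obtain ⟨q, hq⟩ := Finset.card_pos.1 h3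
      exact ⟨q, Finset.mem_filter.2 ⟨Finset.mem_univ _, (Finset.mem_filter.1 hq).2⟩⟩)
    c (⌈2 * n / c⌉₊ + 1) I
    (fun i _ q hq => Finset.mem_filter.2 ⟨Finset.mem_univ _, (Finset.mem_filter.1 hq).2⟩)
    (fun i hi => by
      have h1 := hQ i hi
      have h2 : c * (dc H : ℝ) ≤ c * (n * d) := by gcongr
      unfold dc at h2
      unfold cnt at h1 h2
      linarith)
    (by
      have h1 : (I.card : ℝ) ≤ 2 ^ Fintype.card V * 2 ^ Fintype.card V := by exact_mod_cast hI
      have h2 : (2 : ℝ) ^ Fintype.card V ≤ Real.exp n := by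
        have : Real.exp n = Real.exp 1 ^ Fintype.card V := by
          rw [← Real.exp_nat_mul, hn]; simp
        rw [this]; gcongr
      have h3 : (I.card : ℝ) ≤ Real.exp (2 * n) := by
        rw [two_mul, Real.exp_add]
        exact h1.trans (by gcongr)
      refine h3.trans_lt (Real.exp_lt_exp.2 ?_)
      have h4 := Nat.le_ceil (2 * n / c)
      rw [div_le_iff₀ hc] at h4
      push_cast
      nlinarith)
  refine ⟨R, ?_, ?_⟩
  · have h4 := (Nat.ceil_lt_add_one (show 0 ≤ 2 * n / c by positivity)).le
    have : (R.card : ℝ) ≤ (⌈2 * n / c⌉₊ + 1 : ℕ) := by exact_mod_cast hRc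
    push_cast at this
    linarith
  · intro i hi
    obtain ⟨q, hq, hqi⟩ := hRI i hi
    exact ⟨q, hq, (Finset.mem_filter.1 hqi).1, (Finset.mem_filter.1 hqi).2⟩

end Counting

section Expansion

open scoped Classical
set_option linter.unusedSectionVars false
variable [Fintype V]

/-- Lower bounds for the number of edges inside prescribed sets of pairs. -/
def Boost {ι : Type*} (G : SimpleGraph V) (d γ c η : ℝ)
    (Q : SimpleGraph V → ι → Finset (V × V)) : Prop :=
  ∀ E ≤ G, (dc E : ℝ) ≤ η * Fintype.card V * d → ∀ i,
    c * (Fintype.card V : ℝ) ^ 2 ≤ (Q E i).card →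
    (1 - γ) * (d / Fintype.card V) * (Q E i).card ≤ cnt G (Q E i)

/-- Hypotheses on a host graph `G` and a subgraph `H` of it under which `H` is Hamiltonian
on `W`. -/
structure Setup (G H : SimpleGraph V) (W Z A : Finset V) (d ε γ κ δ δ₂ η : ℝ) (k₁ K₁ K' : ℕ) :
    Prop where
  le : H ≤ G
  supp : ∀ u v, H.Adj u v → u ∈ W
  ZW : Z ⊆ W
  AW : ∀ v ∉ A, v ∈ W
  Z1 : ∀ z ∈ Z, (nb H z).card = 2
  Z2 : ∀ x ∉ Z, (nb H x ∩ Z).card ≤ 1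
  Z3 : ∀ y ∉ Z, (Z.filter (fun s => ∃ x ∉ Z, H.Adj y x ∧ H.Adj x s)).card ≤ 2
  closed : ∀ C : Finset V, C ⊆ Z → C.Nonempty → ∃ u ∈ C, ∃ v ∉ C, H.Adj u v
  typ : ∀ v ∉ A ∪ Z, ((nb G v).card : ℝ) - (nb H v).card ≤ (1 / 2 - ε) * d
  typdeg : ∀ v ∉ A ∪ Z, k₁ ≤ (nb H v).card
  aty : ∀ v ∈ A, v ∈ W → v ∉ Z → K₁ ≤ (nb H v).card
  nbr : ∀ v, (nb G v ∩ A).card ≤ K'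
  K'pos : 0 < K'
  hK : 20 * K' ≤ K₁
  hk : δ * d ≤ k₁
  small : ∀ S T : Finset V, S.Nonempty → (S.card : ℝ) ≤ δ₂ * Fintype.card V →
    T.card ≤ 20 * S.card → ∑ v ∈ S, ((nb G v ∩ T).card : ℝ) < δ * d * S.card
  rect : ∀ U Y : Finset V, δ₂ * Fintype.card V ≤ U.card →
    (1 / 2 - ε / 2) * Fintype.card V ≤ Y.card →
    (1 - γ) * (d / Fintype.card V) * (U ×ˢ Y).card ≤ cnt G (U ×ˢ Y)
  boost₂ : Boost G d γ (1 / 72) η rotPairs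
  boost₃ : Boost G d γ (1 / 72) η closePairs
  bad : ∑ v ∈ A ∪ Z, ((nb G v).card : ℝ) ≤ κ * Fintype.card V * d
  edges : (dc G : ℝ) ≤ Fintype.card V * d
  npos : 0 < Fintype.card V
  dpos : 0 < d
  εpos : 0 < ε
  εle : ε ≤ 1 / 4
  γle : γ ≤ ε / 2
  κle₁ : κ ≤ δ₂ * ε / 8
  κle₂ : κ ≤ 1 / 18 * ε / 8
  δ₂pos : 0 < δ₂
  δ₂le : δ₂ ≤ 1
  budget : 2 * (Fintype.card V * ((k₁ : ℝ) + K₁ + 4 + 2 / (δ₂ * ε / 8) + 2 / (1 / 18 * ε / 8)) + 4)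
    ≤ η * Fintype.card V * d

variable {G H : SimpleGraph V} {W Z A : Finset V} {d ε γ κ δ δ₂ η : ℝ} {k₁ K₁ K' : ℕ}

lemma nb_mono {G H : SimpleGraph V} (h : G ≤ H) (v : V) : nb G v ⊆ nb H v := by
  intro x hx; rw [mem_nb] at hx ⊢; exact h hx

/-- A sparse subgraph with good expansion. -/
theorem Setup.expander (s : Setup G H W Z A d ε γ κ δ δ₂ η k₁ K₁ K') :
    ∃ R : Finset (V × V),
      (R.card : ℝ) ≤ Fintype.card V * ((k₁ : ℝ) + K₁ + 2 + 2 / (δ₂ * ε / 8)) + 2 ∧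
      ∀ F, sub H R ≤ F → F ≤ H →
        (∀ z ∈ Z, nb F z = nb H z) ∧
        (∀ S : Finset V, S.Nonempty → S ⊆ W \ Z → (S.card : ℝ) ≤ δ₂ * Fintype.card V →
          9 * S.card < (S ∪ nbS F S).card) ∧
        (∀ U : Finset V, δ₂ * Fintype.card V ≤ U.card →
          (1 / 2 + ε / 2) * Fintype.card V < (nbS F U).card) := by
  have hn : (0 : ℝ) < Fintype.card V := by exact_mod_cast s.npos
  obtain ⟨R₂, hR₂, hR₂'⟩ := exists_hit H
    (Finset.univ.filter (fun i : Finset V × Finset V => δ₂ * Fintype.card V ≤ i.1.card ∧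
      (1 / 2 - ε / 2) * Fintype.card V ≤ i.2.card)) (fun i => i.1 ×ˢ i.2) (δ₂ * ε / 8) d
    (Fintype.card V) rfl (by have := s.δ₂pos; have := s.εpos; positivity) (mul_pos hn s.dpos)
    (by
      refine (Finset.card_filter_le _ _).trans ?_
      rw [Finset.card_univ, Fintype.card_prod, Fintype.card_finset])
    (by
      rintro ⟨U, Y⟩ hi
      simp only [Finset.mem_filter, Finset.mem_univ, true_and] at hi
      refine cnt_lower G H s.le (U ×ˢ Y) U (A ∪ Z) _ d ε γ δ₂ κ hn s.dpos s.εle s.εpos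
        (fun q hq => (Finset.mem_product.1 hq).1) ?_ hi.1 (s.rect U Y hi.1 hi.2) s.bad s.typ
        s.γle s.κle₁
      intro b hb
      refine hi.2.trans ?_
      norm_cast
      refine (Finset.card_le_card_of_injOn (fun y => (b, y)) ?_ ?_)
      · intro y hy
        simp at hy ⊢
        exact ⟨hb, hy⟩
      · intro y _ y' _ h
        simpa using h)
    (by
      refine le_trans ?_ s.edges
      have : dc H ≤ dc G := Finset.card_le_card (fun q hq => by
        rw [Finset.mem_filter] at hq ⊢; exact ⟨hq.1, s.le hq.2⟩)
      exact_mod_cast this)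
  have hf : ∀ v, ∃ f : Finset V, f ⊆ nb H v ∧ f.card ≤ k₁ + K₁ ∧
      (v ∉ A ∪ Z → f.card = k₁) ∧ (v ∈ A → v ∈ W → v ∉ Z → f.card = K₁) := by
    intro v
    by_cases hv : v ∉ A ∪ Z
    · obtain ⟨f, hf, hfc⟩ := Finset.exists_subset_card_eq (s.typdeg v hv)
      refine ⟨f, hf, by omega, fun _ => hfc, fun h => absurd (Finset.mem_union_left _ h) hv⟩
    · by_cases hv2 : v ∈ A ∧ v ∈ W ∧ v ∉ Z
      · obtain ⟨f, hf, hfc⟩ := Finset.exists_subset_card_eq (s.aty v hv2.1 hv2.2.1 hv2.2.2)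
        exact ⟨f, hf, by omega, fun h => absurd h hv, fun _ _ _ => hfc⟩
      · exact ⟨∅, by simp, by simp, fun h => absurd h hv, fun h1 h2 h3 => absurd ⟨h1, h2, h3⟩ hv2⟩
  choose f hfH hfc hft hfa using hf
  set R₁ : Finset (V × V) := Finset.univ.biUnion (fun v => (f v).image (fun x => (v, x)))
  set RZ : Finset (V × V) := Z.biUnion (fun v => (nb H v).image (fun x => (v, x)))
  have hR1 : (R₁.card : ℝ) ≤ Fintype.card V * ((k₁ : ℝ) + K₁) := by
    have : R₁.card ≤ Fintype.card V * (k₁ + K₁) := by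
      refine (Finset.card_biUnion_le_card_mul _ _ _
        (fun v _ => Finset.card_image_le.trans (hfc v))).trans ?_
      rw [Finset.card_univ]
    exact_mod_cast this
  have hRZ : (RZ.card : ℝ) ≤ Fintype.card V * 2 := by
    have : RZ.card ≤ Z.card * 2 := Finset.card_biUnion_le_card_mul _ _ _
      (fun v hv => Finset.card_image_le.trans (s.Z1 v hv).le)
    have h2 : Z.card ≤ Fintype.card V := Finset.card_le_univ _
    have : RZ.card ≤ Fintype.card V * 2 := by omega
    exact_mod_cast this
  refine ⟨R₁ ∪ RZ ∪ R₂, ?_, ?_⟩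
  · have h1 : (((R₁ ∪ RZ) ∪ R₂).card : ℝ) ≤ R₁.card + RZ.card + R₂.card := by
      have h1 := Finset.card_union_le (R₁ ∪ RZ) R₂
      have h2 := Finset.card_union_le R₁ RZ
      exact_mod_cast h1.trans (by omega)
    have : 2 * (Fintype.card V : ℝ) / (δ₂ * ε / 8) = Fintype.card V * (2 / (δ₂ * ε / 8)) := by ring
    rw [this] at hR₂
    nlinarith
  · intro F hF hFH
    have hFf : ∀ v, ∀ x ∈ f v, F.Adj v x := by
      intro v x hx
      refine hF ⟨mem_nb.1 (hfH v hx), Or.inl ?_⟩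
      refine Finset.mem_union_left _ (Finset.mem_union_left _ ?_)
      exact Finset.mem_biUnion.2 ⟨v, Finset.mem_univ _, Finset.mem_image.2 ⟨x, hx, rfl⟩⟩
    refine ⟨?_, ?_, ?_⟩
    · intro z hz
      refine Finset.Subset.antisymm (nb_mono hFH z) ?_
      intro x hx
      refine mem_nb.2 (hF ⟨mem_nb.1 hx, Or.inl ?_⟩)
      refine Finset.mem_union_left _ (Finset.mem_union_right _ ?_)
      exact Finset.mem_biUnion.2 ⟨z, hz, Finset.mem_image.2 ⟨x, hx, rfl⟩⟩
    · intro S hS hSW hSc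
      by_contra hcon
      push Not at hcon
      have hsplit : (S ∩ A).card + (S \ A).card = S.card := Finset.card_inter_add_card_sdiff S A
      have hSpos := hS.card_pos
      by_cases hcase : S.card ≤ 2 * (S \ A).card
      · have hne : (S \ A).Nonempty := by rw [← Finset.card_pos]; omega
        have h1 := s.small (S \ A) (nbS F S) hne (by
            refine le_trans ?_ hSc
            exact_mod_cast Finset.card_le_card Finset.sdiff_subset) (by
            have := Finset.card_le_card (Finset.subset_union_right (s₁ := S) (s₂ := nbS F S))
            omega)
        have h2 : ((S \ A).card : ℝ) * k₁ ≤ ∑ v ∈ S \ A, ((nb G v ∩ nbS F S).card : ℝ) := by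
          rw [← nsmul_eq_mul]
          refine Finset.card_nsmul_le_sum _ _ _ (fun v hv => ?_)
          rw [Finset.mem_sdiff] at hv
          have hvZ := (Finset.mem_sdiff.1 (hSW hv.1)).2
          rw [← hft v (by simp [hv.2, hvZ])]
          norm_cast
          refine Finset.card_le_card (fun x hx => ?_)
          have := hFf v x hx
          exact Finset.mem_inter.2 ⟨mem_nb.2 (s.le (hFH this)), mem_nbS.2 ⟨v, hv.1, this⟩⟩
        have h3 : δ * d * (S \ A).card ≤ k₁ * (S \ A).card := by
          gcongr; exact s.hk
        linarith
      · have h1 : (S ∩ A).card * K₁ ≤ (nbS F S).card * K' := by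
          have h2 : ∑ v ∈ S ∩ A, (f v).card = ∑ y ∈ nbS F S, ((S ∩ A).filter (fun v => y ∈ f v)).card := by
            simp_rw [Finset.card_filter]
            rw [Finset.sum_comm]
            refine Finset.sum_congr rfl (fun v hv => ?_)
            rw [← Finset.card_filter]
            congr 1
            ext y
            simp only [Finset.mem_filter, mem_nbS]
            exact ⟨fun h => ⟨⟨v, (Finset.mem_inter.1 hv).1, hFf v y h⟩, h⟩, fun h => h.2⟩
          have h3 : ∑ v ∈ S ∩ A, (f v).card = (S ∩ A).card * K₁ := by
            rw [Finset.sum_congr rfl (fun v hv => ?_), Finset.sum_const, smul_eq_mul]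
            rw [Finset.mem_inter] at hv
            have hvW := Finset.mem_sdiff.1 (hSW hv.1)
            exact hfa v hv.2 hvW.1 hvW.2
          rw [← h3, h2]
          refine Finset.sum_le_card_nsmul _ _ _ (fun y _ => ?_)
          refine le_trans (Finset.card_le_card ?_) (s.nbr y)
          intro v hv
          simp only [Finset.mem_filter, Finset.mem_inter, mem_nb] at hv ⊢
          exact ⟨(s.le (hFH (hFf v y hv.2))).symm, hv.1.2⟩
        have h2 := Finset.card_le_card (Finset.subset_union_right (s₁ := S) (s₂ := nbS F S))
        have h3 := s.hK
        have h4 := s.K'pos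
        have h5 : (S ∩ A).card * (20 * K') ≤ (9 * S.card) * K' := by
          calc _ ≤ (S ∩ A).card * K₁ := by gcongr
            _ ≤ _ := h1
            _ ≤ _ := by gcongr; omega
        have h6 : (20 * (S ∩ A).card) * K' ≤ (9 * S.card) * K' := by linarith
        have := Nat.le_of_mul_le_mul_right h6 h4
        omega
    · intro U hU
      by_contra hcon
      push Not at hcon
      obtain ⟨q, hq, hqQ, hqH⟩ := hR₂' (U, Finset.univ \ nbS F U) (by
        simp only [Finset.mem_filter, Finset.mem_univ, true_and]
        refine ⟨hU, ?_⟩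
        have h1 := Finset.card_sdiff_add_card_eq_card (Finset.subset_univ (nbS F U))
        have : ((Finset.univ \ nbS F U).card : ℝ) + (nbS F U).card = Fintype.card V := by
          rw [← Finset.card_univ]; exact_mod_cast h1
        linarith)
      simp only [Finset.mem_product, Finset.mem_sdiff, Finset.mem_univ, true_and] at hqQ
      refine hqQ.2 (mem_nbS.2 ⟨q.1, hqQ.1, hF ⟨hqH, Or.inl ?_⟩⟩)
      exact Finset.mem_union_right _ hq

lemma EndP.symm {F : SimpleGraph V} {ℓ : ℕ} {a b : V} (h : EndP F ℓ a b) : EndP F ℓ b a := by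
  obtain ⟨l, h1, h2, h3, h4⟩ := h
  refine ⟨l.reverse, ⟨List.nodup_reverse.2 h1.1, ?_⟩, by simp [h2], by simp [h4], by simp [h3]⟩
  rw [List.isChain_reverse]
  exact h1.2.imp (fun _ _ h => h.symm)

lemma EndP.mono {F F' : SimpleGraph V} (hle : F ≤ F') {ℓ : ℕ} {a b : V} (h : EndP F ℓ a b) :
    EndP F' ℓ a b := by
  obtain ⟨l, h1, h2, h3, h4⟩ := h
  exact ⟨l, ⟨h1.1, h1.2.imp (fun _ _ h => hle h)⟩, h2, h3, h4⟩

lemma PathL.exists_adj {F : SimpleGraph V} {l : List V} (h : PathL F l) (hlen : 2 ≤ l.length)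
    {u : V} (hu : u ∈ l) : ∃ w, F.Adj u w := by
  obtain ⟨l₁, l₂, rfl⟩ := List.append_of_mem hu
  have hc := h.2
  rw [List.isChain_append, List.isChain_cons] at hc
  cases l₂ with
  | cons w l₂ => exact ⟨w, hc.2.1.1 w (by simp)⟩
  | nil =>
    rcases List.eq_nil_or_concat l₁ with rfl | ⟨l₃, w, rfl⟩
    · simp at hlen
    · exact ⟨w, (hc.2.2 w (by simp) u (by simp)).symm⟩

lemma formPerm_apply_of_split {l₁ l₂ : List V} {x y : V} (h : (l₁ ++ x :: y :: l₂).Nodup) :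
    (l₁ ++ x :: y :: l₂).formPerm x = y := by
  have h1 := List.formPerm_apply_lt_getElem (l₁ ++ x :: y :: l₂) h l₁.length (by simp)
  simpa using h1

end Expansion

section Rotation

open scoped Classical
set_option linter.unusedSectionVars false
variable [Fintype V]
variable {G H : SimpleGraph V} {W Z A : Finset V} {d ε γ κ δ δ₂ η : ℝ} {k₁ K₁ K' : ℕ}

lemma sub_mono_right (H : SimpleGraph V) {R R' : Finset (V × V)} (h : R ⊆ R') :
    sub H R ≤ sub H R' := fun _ _ ⟨h1, h2⟩ => ⟨h1, h2.imp (fun h' => h h') (fun h' => h h')⟩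

lemma Setup.posa (s : Setup G H W Z A d ε γ κ δ δ₂ η k₁ K₁ K') {R : Finset (V × V)}
    (hR : ∀ F, sub H R ≤ F → F ≤ H →
        (∀ z ∈ Z, nb F z = nb H z) ∧
        (∀ S : Finset V, S.Nonempty → S ⊆ W \ Z → (S.card : ℝ) ≤ δ₂ * Fintype.card V →
          9 * S.card < (S ∪ nbS F S).card) ∧
        (∀ U : Finset V, δ₂ * Fintype.card V ≤ U.card →
          (1 / 2 + ε / 2) * Fintype.card V < (nbS F U).card))
    {F : SimpleGraph V} (h1 : sub H R ≤ F) (h2 : F ≤ H) {ℓ : ℕ} (hℓ : 2 ≤ ℓ)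
    (hmax : ∀ l, PathL H l → l.length ≤ ℓ) (hcyc : ∀ a b, EndP H ℓ a b → ¬ H.Adj b a)
    {a b : V} (hab : EndP F ℓ a b) : (1 / 18 : ℝ) * Fintype.card V ≤ (endSet F ℓ a).card := by
  obtain ⟨hZ, hE1, hE2⟩ := hR F h1 h2
  obtain ⟨S, hS, hSZ, hSE, hSc⟩ := posa_rotation F Z ℓ a b hab
    (fun l hl => hmax l ⟨hl.1, hl.2.imp (fun _ _ h => h2 h)⟩)
    (fun a b h h' => hcyc a b (h.mono h2) (h2 h'))
    (fun z hz => by rw [hZ z hz]; exact s.Z1 z hz)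
    (fun x hx => (Finset.card_le_card (Finset.inter_subset_inter (nb_mono h2 x) subset_rfl)).trans
      (s.Z2 x hx))
    (fun y hy => by
      refine (Finset.card_le_card ?_).trans (s.Z3 y hy)
      intro t ht
      simp only [Finset.mem_filter] at ht ⊢
      obtain ⟨h, x, hx, h3, h4⟩ := ht
      exact ⟨h, x, hx, h2 h3, h2 h4⟩)
  have hSW : S ⊆ W \ Z := by
    intro u hu
    refine Finset.mem_sdiff.2 ⟨?_, Finset.disjoint_left.1 hSZ hu⟩
    obtain ⟨l, hl, hlen, -, hlast⟩ := hSE u hu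
    obtain ⟨w, hw⟩ := hl.exists_adj (by omega) (List.mem_of_getLast? hlast)
    exact s.supp u w (h2 hw)
  have hbig : δ₂ * Fintype.card V ≤ S.card := by
    by_contra hcon
    have := hE1 S hS hSW (le_of_not_ge hcon)
    omega
  have h3 := hE2 S hbig
  have h4 : ((nbS F S).card : ℝ) ≤ 9 * S.card := by
    exact_mod_cast (Finset.card_le_card Finset.subset_union_right).trans hSc
  have h5 : (S.card : ℝ) ≤ (endSet F ℓ a).card := by
    exact_mod_cast Finset.card_le_card (fun u hu => mem_endSet.2 (hSE u hu))
  have hn : (0 : ℝ) < Fintype.card V := by exact_mod_cast s.npos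
  have := s.εpos
  nlinarith [mul_pos this hn]

/-- A longest path closes up to a cycle. -/
theorem Setup.cycle (s : Setup G H W Z A d ε γ κ δ δ₂ η k₁ K₁ K') {R : Finset (V × V)}
    (hRc : (R.card : ℝ) ≤ Fintype.card V * ((k₁ : ℝ) + K₁ + 2 + 2 / (δ₂ * ε / 8)) + 2)
    (hR : ∀ F, sub H R ≤ F → F ≤ H →
        (∀ z ∈ Z, nb F z = nb H z) ∧
        (∀ S : Finset V, S.Nonempty → S ⊆ W \ Z → (S.card : ℝ) ≤ δ₂ * Fintype.card V →
          9 * S.card < (S ∪ nbS F S).card) ∧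
        (∀ U : Finset V, δ₂ * Fintype.card V ≤ U.card →
          (1 / 2 + ε / 2) * Fintype.card V < (nbS F U).card))
    (P : List V) (hP : PathL H P) (hlen : 2 ≤ P.length)
    (hmax : ∀ l, PathL H l → l.length ≤ P.length) : ∃ a b, EndP H P.length a b ∧ H.Adj b a := by
  by_contra hcon
  push Not at hcon
  have hn : (0 : ℝ) < Fintype.card V := by exact_mod_cast s.npos
  have hd := s.dpos
  have hε := s.εpos
  have hδ₂ := s.δ₂pos
  set n : ℝ := ((Fintype.card V : ℕ) : ℝ) with hn_def
  have hPcard : P.length ≤ Fintype.card V := hP.1.length_le_card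
  set ℓ : Fin (Fintype.card V + 1) := ⟨P.length, by omega⟩ with hℓ
  have hℓ' : (ℓ : ℕ) = P.length := rfl
  set RP : Finset (V × V) := Finset.univ.biUnion
    (fun w => (Finset.univ.filter (fun x => Con P x w)).image (fun x => (x, w))) with hRPdef
  have hRP : (RP.card : ℝ) ≤ n * 2 := by
    have : RP.card ≤ Fintype.card V * 2 := by
      refine (Finset.card_biUnion_le_card_mul _ _ 2
        (fun w _ => Finset.card_image_le.trans (card_con_le hP.1 w))).trans ?_
      rw [Finset.card_univ]
    rw [hn_def]
    exact_mod_cast this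
  set F := sub H (R ∪ RP) with hF
  have hRF : sub H R ≤ F := sub_mono_right H Finset.subset_union_left
  have hPF : PathL F P := by
    refine ⟨hP.1, ?_⟩
    have h1 := hP.2
    have h2 := isChain_con P
    rw [List.isChain_iff_getElem] at h1 h2 ⊢
    intro i hi
    refine ⟨h1 i hi, Or.inl (Finset.mem_union_right _ ?_)⟩
    simp only [hRPdef, Finset.mem_biUnion, Finset.mem_image, Finset.mem_filter, Finset.mem_univ,
      true_and]
    exact ⟨_, _, h2 i hi, rfl⟩
  have hposa : ∀ F', sub H R ≤ F' → F' ≤ H → ∀ a b, EndP F' P.length a b →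
      (1 / 18 : ℝ) * n ≤ (endSet F' P.length a).card := fun F' h1 h2 a b hab =>
    s.posa hR h1 h2 hlen hmax hcon hab
  have hPne : P ≠ [] := by rintro rfl; simp at hlen
  have hab : EndP F P.length (P.head hPne) (P.getLast hPne) :=
    ⟨P, hPF, rfl, List.head?_eq_some_head hPne, List.getLast?_eq_some_getLast hPne⟩
  set AF : Finset V := Finset.univ.filter (fun a => ∃ b, EndP F P.length a b) with hAF
  have memAF : ∀ a, a ∈ AF ↔ ∃ b, EndP F P.length a b := by simp [hAF]
  have hAFc : (1 / 18 : ℝ) * n ≤ AF.card := by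
    refine (hposa F hRF (sub_le _ _) _ _ hab).trans ?_
    norm_cast
    refine Finset.card_le_card (fun u hu => (memAF u).2 ⟨_, (mem_endSet.1 hu).symm⟩)
  have hdcH : (dc H : ℝ) ≤ n * d := by
    refine le_trans ?_ s.edges
    have : dc H ≤ dc G := Finset.card_le_card (fun q hq => by
      rw [Finset.mem_filter] at hq ⊢; exact ⟨hq.1, s.le hq.2⟩)
    exact_mod_cast this
  have hbud := s.budget
  rw [← hn_def] at hbud
  have e1 : 0 ≤ 2 / (1 / 18 * ε / 8) := by positivity
  have e2 : n * ((k₁ : ℝ) + K₁ + 4 + 2 / (δ₂ * ε / 8) + 2 / (1 / 18 * ε / 8)) =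
    n * ((k₁ : ℝ) + K₁ + 2 + 2 / (δ₂ * ε / 8)) + n * 2 + n * (2 / (1 / 18 * ε / 8)) := by ring
  have hFdc : (dc F : ℝ) ≤ η * n * d := by
    have h1 : (dc F : ℝ) ≤ 2 * (R ∪ RP).card := by exact_mod_cast dc_sub_le H (R ∪ RP)
    have h2 : ((R ∪ RP).card : ℝ) ≤ R.card + RP.card := by
      exact_mod_cast Finset.card_union_le R RP
    have : 0 ≤ n * (2 / (1 / 18 * ε / 8)) := by positivity
    linarith
  have hFG : F ≤ G := (sub_le _ _).trans s.le
  -- rotation pairs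
  obtain ⟨R', hR'c, hR'⟩ := exists_hit H
    (Finset.univ.filter (fun i : V × Finset V => i.1 ∈ AF ∧ (1 / 2 - ε / 2) * n ≤ i.2.card))
    (fun i => rotPairs F (ℓ, i)) (1 / 18 * ε / 8) d n hn_def (by positivity) (mul_pos hn hd)
    (by
      refine (Finset.card_filter_le _ _).trans ?_
      rw [Finset.card_univ, Fintype.card_prod, Fintype.card_finset]
      gcongr
      exact Nat.lt_two_pow_self.le)
    (by
      rintro ⟨a, Y⟩ hi
      simp only [Finset.mem_filter, Finset.mem_univ, true_and] at hi
      obtain ⟨ha, hY⟩ := hi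
      obtain ⟨b, hb⟩ := (memAF a).1 ha
      have hE := hposa F hRF (sub_le _ _) a b hb
      have hfib : ∀ b ∈ endSet F P.length a,
          ((rotPairs F (ℓ, a, Y)).filter (fun q => q.1 = b)).card = Y.card := fun b hb =>
        card_rotPairs_fiber F ℓ a b Y (mem_endSet.1 hb)
      have hmem : ∀ q ∈ rotPairs F (ℓ, a, Y), q.1 ∈ endSet F P.length a := by
        intro q hq
        simp only [rotPairs, Finset.mem_filter, Finset.mem_univ, true_and] at hq
        exact mem_endSet.2 hq.1
      refine cnt_lower G H s.le _ (endSet F P.length a) (A ∪ Z) _ d ε γ (1 / 18) κ hn s.dpos s.εle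
        s.εpos hmem ?_ hE ?_ s.bad s.typ s.γle s.κle₂
      · intro b hb
        rw [hfib b hb]; exact hY
      · refine s.boost₂ F hFG hFdc (ℓ, a, Y) ?_
        have h1 : (rotPairs F (ℓ, a, Y)).card = (endSet F P.length a).card * Y.card := by
          rw [Finset.card_eq_sum_card_fiberwise (fun q hq => hmem q hq),
            Finset.sum_congr rfl hfib, Finset.sum_const, smul_eq_mul]
        rw [h1]; push_cast
        have h2 := s.εle
        have h3 : 1 / 4 * n ≤ Y.card := le_trans (by nlinarith) hY
        calc 1 / 72 * n ^ 2 = (1 / 18 * n) * (1 / 4 * n) := by ring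
          _ ≤ _ := by gcongr)
    hdcH
  set D := sub H (R ∪ RP ∪ R') with hD
  have hFD : F ≤ D := sub_mono_right H Finset.subset_union_left
  have hDH : D ≤ H := sub_le _ _
  have hDbig : ∀ a ∈ AF, n ≤ 2 * (endSet D P.length a).card := by
    intro a ha
    by_contra hlt
    push Not at hlt
    obtain ⟨⟨b, x⟩, hq, hqQ, hbx⟩ := hR' (a, Finset.univ \ endSet D P.length a) (by
      simp only [Finset.mem_filter, Finset.mem_univ, true_and]
      refine ⟨ha, ?_⟩
      have h1 := Finset.card_sdiff_add_card_eq_card (Finset.subset_univ (endSet D P.length a))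
      have : ((Finset.univ \ endSet D P.length a).card : ℝ) + (endSet D P.length a).card = n := by
        rw [hn_def, ← Finset.card_univ]; exact_mod_cast h1
      have := mul_pos hε hn
      linarith)
    simp only [rotPairs, Finset.mem_filter, Finset.mem_univ, true_and, Finset.mem_sdiff,
      hℓ'] at hqQ hbx
    obtain ⟨hE, hy⟩ := hqQ
    obtain ⟨hl, hllen, hlh, hll⟩ := pth_spec hE
    set l := pth F P.length a b
    have hbxD : D.Adj b x := ⟨hbx, Or.inl (Finset.mem_union_right _ hq)⟩
    have hlD : PathL D l := ⟨hl.1, hl.2.imp (fun _ _ h => hFD h)⟩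
    have hxl : x ∈ l := by
      by_contra hx
      have := hmax (l ++ [x]) ⟨?_, ?_⟩
      · simp [hllen] at this
      · rw [List.nodup_append]
        refine ⟨hl.1, by simp, ?_⟩
        rintro p hp q hq rfl
        simp at hq; subst hq; exact hx hp
      · rw [List.isChain_append]
        refine ⟨hlD.2.imp (fun _ _ h => hDH h), by simp, ?_⟩
        intro p hp q hq
        rw [hll] at hp
        cases hp
        simp at hq; subst hq; exact hbx
    obtain ⟨l₁, y, l₂, hsplit, hu⟩ := split_at_mem hxl hll hbx.ne'
    rw [hsplit] at hy hlD hlh hllen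
    rw [formPerm_apply_of_split hlD.1] at hy
    refine hy (mem_endSet.2 ⟨l₁ ++ x :: (y :: l₂).reverse, hlD.rotate hu hbxD, ?_, ?_,
      getLast?_rotate ..⟩)
    · rw [← hllen]; simp
    · rw [← hlh]; cases l₁ <;> simp
  -- closing pairs
  have hDdc : (dc D : ℝ) ≤ η * n * d := by
    have h1 : (dc D : ℝ) ≤ 2 * (R ∪ RP ∪ R').card := by exact_mod_cast dc_sub_le H (R ∪ RP ∪ R')
    have h2 : ((R ∪ RP ∪ R').card : ℝ) ≤ R.card + RP.card + R'.card := by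
      have h3 := Finset.card_union_le (R ∪ RP) R'
      have h4 := Finset.card_union_le R RP
      exact_mod_cast h3.trans (by omega)
    have : 2 * n / (1 / 18 * ε / 8) = n * (2 / (1 / 18 * ε / 8)) := by ring
    linarith
  set P₃ : Finset V := Finset.univ.filter
    (fun a => Fintype.card V ≤ 2 * (endSet D P.length a).card) with hP₃
  have hP₃c : (1 / 18 : ℝ) * n ≤ P₃.card := by
    refine hAFc.trans ?_
    norm_cast
    refine Finset.card_le_card (fun a ha => Finset.mem_filter.2 ⟨Finset.mem_univ _, ?_⟩)
    have := hDbig a ha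
    rw [hn_def] at this
    exact_mod_cast this
  have hmem : ∀ q ∈ closePairs D ℓ, q.1 ∈ P₃ := by
    intro q hq
    simp only [closePairs, Finset.mem_filter, Finset.mem_univ, true_and] at hq
    exact Finset.mem_filter.2 ⟨Finset.mem_univ _, hq.1⟩
  have hfib : ∀ a ∈ P₃, n / 2 ≤ (((closePairs D ℓ).filter (fun q => q.1 = a)).card : ℝ) := by
    intro a ha
    have ha' := (Finset.mem_filter.1 ha).2
    rw [card_closePairs_fiber D ℓ a ha']
    have : n ≤ 2 * (endSet D P.length a).card := by rw [hn_def]; exact_mod_cast ha'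
    rw [hℓ']
    linarith
  have hfinal := cnt_lower G H s.le (closePairs D ℓ) P₃ (A ∪ Z) n d ε γ (1 / 18) κ hn s.dpos s.εle
    s.εpos hmem (fun a ha => le_trans (by nlinarith) (hfib a ha)) hP₃c
    (s.boost₃ D (hDH.trans s.le) hDdc ℓ (by
      have h1 : (P₃.card : ℝ) * (n / 2) ≤ (closePairs D ℓ).card := by
        rw [Finset.card_eq_sum_card_fiberwise (fun q hq => hmem q hq)]
        push_cast
        rw [← nsmul_eq_mul]
        exact Finset.card_nsmul_le_sum _ _ _ hfib
      refine le_trans ?_ h1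
      rw [← hn_def]
      nlinarith)) s.bad s.typ s.γle s.κle₂
  have hpos : (0 : ℝ) < cnt H (closePairs D ℓ) := lt_of_lt_of_le (by positivity) hfinal
  have hpos' : 0 < cnt H (closePairs D ℓ) := by exact_mod_cast hpos
  obtain ⟨⟨a, y⟩, hq⟩ := Finset.card_pos.1 hpos'
  simp only [closePairs, Finset.mem_filter, Finset.mem_univ, true_and, hℓ'] at hq
  exact hcon a y (hq.1.2.mono hDH) hq.2.symm

/-- The subgraph is Hamiltonian on `W`. -/
theorem Setup.hamilton (s : Setup G H W Z A d ε γ κ δ δ₂ η k₁ K₁ K') :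
    ∃ l a b, PathL H l ∧ l.head? = some a ∧ l.getLast? = some b ∧ H.Adj b a ∧
      ∀ v, v ∈ l ↔ v ∈ W := by
  obtain ⟨R, hRc, hR⟩ := s.expander
  have hn : (0 : ℝ) < Fintype.card V := by exact_mod_cast s.npos
  have hε := s.εpos
  obtain ⟨hZ, hE1, hE2⟩ := hR H (sub_le _ _) le_rfl
  obtain ⟨P, hP, hPmax⟩ : ∃ P, PathL H P ∧ ∀ l, PathL H l → l.length ≤ P.length := by
    have hex : ∃ l : List V, PathL H l ∧ l.length = Nat.findGreatest
        (fun k => ∃ l, PathL H l ∧ l.length = k) (Fintype.card V) :=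
      Nat.findGreatest_spec (P := fun k => ∃ l, PathL H l ∧ l.length = k) (m := 0) (Nat.zero_le _)
        ⟨[], ⟨by simp, by simp⟩, rfl⟩
    obtain ⟨P, hP, hPl⟩ := hex
    refine ⟨P, hP, fun l hl => ?_⟩
    rw [hPl]
    exact Nat.le_findGreatest hl.1.length_le_card ⟨l, hl, rfl⟩
  have hlen : 2 ≤ P.length := by
    have h1 := hE2 Finset.univ (by
      have := s.δ₂le
      rw [Finset.card_univ]; nlinarith)
    have h2 : (0 : ℝ) < (nbS H Finset.univ).card := lt_of_le_of_lt (by positivity) h1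
    obtain ⟨y, hy⟩ := Finset.card_pos.1 (by exact_mod_cast h2 : 0 < (nbS H Finset.univ).card)
    obtain ⟨x, -, hxy⟩ := mem_nbS.1 hy
    exact hPmax [x, y] ⟨by simp [hxy.ne], by simp [hxy]⟩
  obtain ⟨a, b, ⟨l, hl, hll, hla, hlb⟩, hba⟩ := s.cycle hRc hR P hP hlen hPmax
  refine ⟨l, a, b, hl, hla, hlb, hba, ?_⟩
  have hlW : ∀ v ∈ l, v ∈ W := by
    intro v hv
    obtain ⟨w, hw⟩ := hl.exists_adj (by omega) hv
    exact s.supp v w hw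
  have hclosed : ∀ v ∈ l, ∀ w, H.Adj v w → w ∈ l := by
    intro v hv w hvw
    by_contra hw
    obtain ⟨l₁, l₂, rfl⟩ := List.append_of_mem hv
    have hnd := hl.1
    have hch := hl.2
    have := hPmax (l₂ ++ (l₁ ++ [v]) ++ [w]) ⟨?_, ?_⟩
    · simp at this hll; omega
    · have hperm : (l₂ ++ (l₁ ++ [v]) ++ [w]).Perm (w :: (l₁ ++ v :: l₂)) := by
        have h1 : (l₂ ++ (l₁ ++ [v]) ++ [w]).Perm ([w] ++ (l₂ ++ (l₁ ++ [v]))) :=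
          List.perm_append_comm
        have h2 : (l₂ ++ (l₁ ++ [v])).Perm (l₁ ++ v :: l₂) := by
          have : (l₂ ++ (l₁ ++ [v])).Perm ((l₁ ++ [v]) ++ l₂) := List.perm_append_comm
          simpa using this
        exact h1.trans (h2.cons w)
      rw [hperm.nodup_iff, List.nodup_cons]
      exact ⟨hw, hnd⟩
    · rw [List.isChain_append, List.isChain_cons] at hch
      rw [List.isChain_append, List.isChain_append, List.isChain_append]
      refine ⟨⟨hch.2.1.2, ⟨hch.1, by simp, ?_⟩, ?_⟩, by simp, ?_⟩
      · intro p hp q hq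
        simp at hq; subst hq
        exact hch.2.2 p hp v (by simp)
      · intro p hp q hq
        have hpb : p = b := by
          have hp' : l₂.getLast? = some p := hp
          rw [List.getLast?_append, List.getLast?_cons, hp'] at hlb
          simpa using hlb
        have hqa : q = a := by
          cases l₁ with
          | nil => simp at hq hla; rw [← hla, ← hq]
          | cons r l₁ => simp at hq hla; rw [← hla, ← hq]
        rw [hpb, hqa]; exact hba
      · intro p hp q hq
        simp at hq; subst hq
        have : p = v := by
          have h1 : l₂ ++ (l₁ ++ [v]) = (l₂ ++ l₁) ++ [v] := by simp
          rw [h1] at hp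
          simp at hp; exact hp.symm
        rw [this]; exact hvw
  have hbig : ∀ C : Finset V, C.Nonempty → C ⊆ W → (∀ v ∈ C, ∀ w, H.Adj v w → w ∈ C) →
      (1 / 2 : ℝ) * Fintype.card V < C.card := by
    intro C hC hCW hCc
    have hne : (C \ Z).Nonempty := by
      by_contra hcon
      rw [Finset.not_nonempty_iff_eq_empty, Finset.sdiff_eq_empty_iff_subset] at hcon
      obtain ⟨u, hu, v, hv, huv⟩ := s.closed C hcon hC
      exact hv (hCc u hu v huv)
    have hsub : nbS H (C \ Z) ⊆ C := by
      intro w hw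
      obtain ⟨v, hv, hvw⟩ := mem_nbS.1 hw
      exact hCc v (Finset.mem_sdiff.1 hv).1 w hvw
    by_cases hc : ((C \ Z).card : ℝ) ≤ δ₂ * Fintype.card V
    · exfalso
      have h1 := hE1 (C \ Z) hne (Finset.sdiff_subset_sdiff hCW subset_rfl) hc
      have h2 : C \ Z ∪ nbS H (C \ Z) ⊆ (C \ Z) ∪ (C \ Z).biUnion (fun x => nb H x ∩ Z) := by
        intro w hw
        rw [Finset.mem_union] at hw ⊢
        rcases hw with hw | hw
        · exact Or.inl hw
        · by_cases hwZ : w ∈ Z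
          · right
            obtain ⟨v, hv, hvw⟩ := mem_nbS.1 hw
            exact Finset.mem_biUnion.2 ⟨v, hv, Finset.mem_inter.2 ⟨mem_nb.2 hvw, hwZ⟩⟩
          · exact Or.inl (Finset.mem_sdiff.2 ⟨hsub hw, hwZ⟩)
      have h3 := Finset.card_le_card h2
      have h4 := Finset.card_union_le (C \ Z) ((C \ Z).biUnion (fun x => nb H x ∩ Z))
      have h5 : ((C \ Z).biUnion (fun x => nb H x ∩ Z)).card ≤ (C \ Z).card * 1 :=
        Finset.card_biUnion_le_card_mul _ _ _ (fun x hx => s.Z2 x (Finset.mem_sdiff.1 hx).2)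
      omega
    · have h1 := hE2 (C \ Z) (le_of_not_ge hc)
      have h2 : ((nbS H (C \ Z)).card : ℝ) ≤ C.card := by
        exact_mod_cast Finset.card_le_card hsub
      nlinarith [mul_pos hε hn]
  intro v
  refine ⟨hlW v, fun hv => ?_⟩
  by_contra hvl
  have h1 := hbig l.toFinset ⟨a, by simpa using List.mem_of_head? hla⟩
    (fun x hx => hlW x (by simpa using hx))
    (fun x hx w hxw => by simpa using hclosed x (by simpa using hx) w hxw)
  have h2 := hbig (W \ l.toFinset) ⟨v, by simp [hv, hvl]⟩ Finset.sdiff_subset (by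
    intro x hx w hxw
    simp only [Finset.mem_sdiff, List.mem_toFinset] at hx ⊢
    exact ⟨s.supp w x hxw.symm, fun h => hx.2 (hclosed w h x hxw.symm)⟩)
  have h3 : l.toFinset.card + (W \ l.toFinset).card ≤ Fintype.card V := by
    rw [← Finset.card_union_of_disjoint Finset.disjoint_sdiff]
    exact Finset.card_le_univ _
  have h4 : (l.toFinset.card : ℝ) + (W \ l.toFinset).card ≤ Fintype.card V := by exact_mod_cast h3
  linarith

end Rotation

section Assembly

open scoped Classical
set_option linter.unusedSectionVars false

/-- A spanning cycle given as a list. -/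
lemma isHam_of_list [Finite V] (F : SimpleGraph V) (l : List V) (a b : V) (hl : PathL F l)
    (ha : l.head? = some a) (hb : l.getLast? = some b) (hba : F.Adj b a) (h3 : 3 ≤ l.length)
    (hall : ∀ v, v ∈ l) : IsHam F := by
  unfold IsHam
  let _ := Classical.decEq V
  let _ := Fintype.ofFinite V
  intro _
  have hne : l ≠ [] := by rintro rfl; simp at h3
  have ha' : l.head hne = a := by
    rw [List.head?_eq_some_head hne] at ha; exact Option.some.inj ha
  have hb' : l.getLast hne = b := by
    rw [List.getLast?_eq_some_getLast hne] at hb; exact Option.some.inj hb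
  have hadj : F.Adj (l.getLast hne) (l.head hne) := by rw [ha', hb']; exact hba
  let p := SimpleGraph.Walk.ofSupport l hne hl.2
  refine ⟨_, .cons hadj p, ?_⟩
  have hp : p.support = l := SimpleGraph.Walk.support_ofSupport hne hl.2
  have hpl : p.length = l.length - 1 := SimpleGraph.Walk.length_ofSupport hne hl.2
  rw [SimpleGraph.Walk.isHamiltonianCycle_iff_isCycle_and_length_eq]
  have hcard : l.length = Fintype.card V := by
    rw [← List.toFinset_card_of_nodup hl.1, ← Finset.card_univ]
    congr 1
    ext v; simp [hall v]
  constructor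
  · rw [SimpleGraph.Walk.isCycle_iff_isPath_tail_and_le_length]
    refine ⟨?_, ?_⟩
    · rw [SimpleGraph.Walk.isPath_def]
      simp [hp, hl.1]
    · simp [hpl]; omega
  · simp [hpl]; omega

/-- Compatibility of the constants. -/
structure Consts (ε γ κ δ δ₂ η β ξ δ₀ : ℝ) (K' K : ℕ) (d : ℝ) : Prop where
  εpos : 0 < ε
  εle : ε ≤ 1 / 10
  γle : γ ≤ ε / 4
  κle₁ : κ ≤ δ₂ * (ε / 2) / 8
  κle₂ : κ ≤ 1 / 18 * (ε / 2) / 8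
  δpos : 0 < δ
  δle : δ ≤ 1 / 8
  δη : δ ≤ η / 4
  δ₂pos : 0 < δ₂
  δ₂le : δ₂ ≤ 1
  βpos : 0 < β
  βle : β ≤ ε / 4
  βκ : 2 * β ≤ κ
  ξpos : 0 < ξ
  ξle : ξ ≤ β / 8
  δ₀pos : 0 < δ₀
  δ₀le : δ₀ ≤ 1 / 2
  K'pos : 0 < K'
  hK : 20 * K' + 4 ≤ K
  d₁ : 2 * K + 8 ≤ δ₀ * d
  d₂ : 24 ≤ β * d
  d₃ : 2 * (20 * K' + 9 + (2 / (δ₂ * (ε / 2) / 8) + 2 / (1 / 18 * (ε / 2) / 8))) ≤ η / 2 * d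

/-- Typical properties of the random graph. -/
structure Good [Fintype V] (G : SimpleGraph V) (A T : Finset V) (γ δ δ₂ η β ξ δ₀ ε : ℝ) (K' : ℕ)
    (d : ℝ) : Prop where
  edges : (dc G : ℝ) = Fintype.card V * d
  typ : ∀ v ∉ A, (1 - β) * d ≤ (nb G v).card ∧ ((nb G v).card : ℝ) ≤ (1 + β) * d
  Acard : (A.card : ℝ) ≤ ξ * Fintype.card V
  nbr : ∀ v, (nb G v ∩ A).card ≤ K'
  small : ∀ S T : Finset V, S.Nonempty → (S.card : ℝ) ≤ δ₂ * Fintype.card V →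
    T.card ≤ 20 * S.card → ∑ v ∈ S, ((nb G v ∩ T).card : ℝ) < δ * d * S.card
  rect : ∀ U Y : Finset V, δ₂ * Fintype.card V ≤ U.card →
    (1 / 2 - ε / 2 / 2) * Fintype.card V ≤ Y.card →
    (1 - γ) * (d / Fintype.card V) * (U ×ˢ Y).card ≤ cnt G (U ×ˢ Y)
  boost₂ : Boost G d γ (1 / 72) η rotPairs
  boost₃ : Boost G d γ (1 / 72) η closePairs
  high : ∀ v ∉ T, δ₀ * d ≤ (nb G v).card
  low : ∀ v ∈ T, ((nb G v).card : ℝ) < δ₀ * d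
  spread : ∀ T' ⊆ T, Spread G T'
  npos : 10 ≤ Fintype.card V
  nξ : 1 ≤ ξ * Fintype.card V

variable {G Γ : SimpleGraph V} {A T W : Finset V} {γ κ δ δ₂ η β ξ δ₀ ε : ℝ} {K' K : ℕ} {d : ℝ}

lemma dc_eq_sum [Fintype V] (G : SimpleGraph V) : dc G = ∑ v, (nb G v).card := by
  rw [dc, cnt, Finset.card_eq_sum_card_fiberwise (f := Prod.fst) (t := Finset.univ) (by simp)]
  refine Finset.sum_congr rfl fun v _ => ?_
  refine Finset.card_bij' (fun q _ => q.2) (fun y _ => (v, y)) ?_ ?_ ?_ ?_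
  · rintro ⟨x, y⟩ h
    simp at h ⊢
    rw [← h.2]; exact h.1
  · intro y h
    simpa using h
  · rintro ⟨x, y⟩ h
    simp at h ⊢
    exact h.2.symm
  · intros; rfl

lemma Consts.dpos (c : Consts ε γ κ δ δ₂ η β ξ δ₀ K' K d) : 0 < d := by
  have := c.d₂; have := c.βpos
  by_contra h
  nlinarith

lemma Good.hamilton [Fintype V] (g : Good G A T γ δ δ₂ η β ξ δ₀ ε K' d)
    (c : Consts ε γ κ δ δ₂ η β ξ δ₀ K' K d) (hΓ : Γ ≤ G) (hsupp : ∀ u v, Γ.Adj u v → u ∈ W)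
    (hTW : ∀ v ∉ T, v ∈ W) (h2 : ∀ v ∈ T, v ∈ W → 2 ≤ (nb Γ v).card)
    (hKd : ∀ v ∈ W, v ∉ T → K ≤ (nb Γ v).card)
    (htyp : ∀ v ∉ A, ((nb G v).card : ℝ) - (nb Γ v).card ≤ (1 / 2 - ε + β) * d + 2) :
    ∃ l a b, PathL Γ l ∧ l.head? = some a ∧ l.getLast? = some b ∧ Γ.Adj b a ∧
      ∀ v, v ∈ l ↔ v ∈ W := by
  have hd := c.dpos
  have hn : (0 : ℝ) < Fintype.card V := by
    have := g.npos
    exact_mod_cast (by omega : 0 < Fintype.card V)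
  have hβ := c.βpos
  have hε := c.εpos
  have e1 := c.εle
  have e2 := c.βle
  have e3 := c.δ₀le
  have e4 := c.d₂
  have hTA : T ⊆ A := by
    intro v hv
    by_contra hvA
    have h1 := (g.typ v hvA).1
    have h2 := g.low v hv
    nlinarith
  obtain ⟨H, Z, hHΓ, hTZ, hZc, Z1, Z2, Z3, hZ4, hout, hclosed⟩ := exists_thinning Γ (T ∩ W)
    ((g.spread _ Finset.inter_subset_left).mono hΓ)
    (fun t ht => h2 t (Finset.mem_inter.1 ht).1 (Finset.mem_inter.1 ht).2)
  have hloss : ∀ v ∉ Z, (nb Γ v).card ≤ (nb H v).card + 4 := by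
    intro v hv
    have h1 : nb Γ v ⊆ nb H v ∪ (nb Γ v ∩ Z) := by
      intro w hw
      by_cases hwZ : w ∈ Z
      · exact Finset.mem_union_right _ (Finset.mem_inter.2 ⟨hw, hwZ⟩)
      · exact Finset.mem_union_left _ (mem_nb.2 (hout v hv w hwZ (mem_nb.1 hw)))
    have h2 := (Finset.card_le_card h1).trans (Finset.card_union_le _ _)
    have := hZ4 v hv
    omega
  have hZcard : (Z.card : ℝ) ≤ 2 * (ξ * Fintype.card V) := by
    have h1 : Z.card ≤ 2 * A.card := hZc.trans
      (Nat.mul_le_mul_left 2 (Finset.card_le_card (Finset.inter_subset_left.trans hTA)))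
    have h2 : (Z.card : ℝ) ≤ 2 * A.card := by exact_mod_cast h1
    linarith [g.Acard]
  have hceil : (⌈δ * d⌉₊ : ℝ) ≤ δ * d + 1 :=
    (Nat.ceil_lt_add_one (mul_nonneg c.δpos.le hd.le)).le
  have hHd : ∀ v ∉ A ∪ Z, ((nb G v).card : ℝ) - (nb H v).card ≤ (1 / 2 - ε / 2) * d := by
    intro v hv
    rw [Finset.mem_union, not_or] at hv
    have h1 := htyp v hv.1
    have h2 : ((nb Γ v).card : ℝ) ≤ (nb H v).card + 4 := by exact_mod_cast hloss v hv.2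
    nlinarith
  have hsumA : ∑ v ∈ A, ((nb G v).card : ℝ) ≤ (ξ + β) * Fintype.card V * d := by
    have h1 : (dc G : ℝ) = ∑ v ∈ A, ((nb G v).card : ℝ) + ∑ v ∈ Aᶜ, ((nb G v).card : ℝ) := by
      rw [dc_eq_sum, Finset.sum_add_sum_compl]; push_cast; rfl
    have h2 : ((Aᶜ).card : ℝ) * ((1 - β) * d) ≤ ∑ v ∈ Aᶜ, ((nb G v).card : ℝ) := by
      rw [← nsmul_eq_mul]
      exact Finset.card_nsmul_le_sum _ _ _ (fun v hv => (g.typ v (Finset.mem_compl.1 hv)).1)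
    have h3 : ((Aᶜ).card : ℝ) = Fintype.card V - A.card := by
      rw [Finset.card_compl, Nat.cast_sub (Finset.card_le_univ A)]
    have h4 := g.edges
    have h5 := g.Acard
    have h6 : (1 - β) * d ≤ d := by nlinarith
    have h7 : (A.card : ℝ) * ((1 - β) * d) ≤ A.card * d := by gcongr
    have h8 : (A.card : ℝ) * d ≤ ξ * Fintype.card V * d := by gcongr
    rw [h3] at h2
    nlinarith
  have hbad : ∑ v ∈ A ∪ Z, ((nb G v).card : ℝ) ≤ κ * Fintype.card V * d := by
    have h1 : ∑ v ∈ A ∪ Z, ((nb G v).card : ℝ) =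
        ∑ v ∈ A, ((nb G v).card : ℝ) + ∑ v ∈ Z \ A, ((nb G v).card : ℝ) := by
      rw [← Finset.sum_union Finset.disjoint_sdiff, Finset.union_sdiff_self_eq_union]
    have h2 : ∑ v ∈ Z \ A, ((nb G v).card : ℝ) ≤ (Z \ A).card * ((1 + β) * d) := by
      rw [← nsmul_eq_mul]
      exact Finset.sum_le_card_nsmul _ _ _ (fun v hv => (g.typ v (Finset.mem_sdiff.1 hv).2).2)
    have h3 : ((Z \ A).card : ℝ) ≤ 2 * (ξ * Fintype.card V) :=
      le_trans (by exact_mod_cast Finset.card_le_card Finset.sdiff_subset) hZcard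
    have h4 : ((Z \ A).card : ℝ) * ((1 + β) * d) ≤ 2 * (ξ * Fintype.card V) * (2 * d) := by
      have h5 := c.ξpos
      exact mul_le_mul h3 (by nlinarith) (by positivity) (by positivity)
    have h5 : (5 * ξ + β) * (Fintype.card V * d) ≤ κ * (Fintype.card V * d) := by
      gcongr
      linarith [c.βκ, c.ξle]
    nlinarith
  have hZW : Z ⊆ W := by
    intro z hz
    have := Z1 z hz
    obtain ⟨w, hw⟩ := Finset.card_pos.1 (by omega : 0 < (nb H z).card)
    exact hsupp z w (hHΓ (mem_nb.1 hw))
  have s : Setup G H W Z A d (ε / 2) γ κ δ δ₂ η ⌈δ * d⌉₊ (20 * K') K' :=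
    { le := hHΓ.trans hΓ
      supp := fun u v h => hsupp u v (hHΓ h)
      ZW := hZW
      AW := fun v hv => hTW v (fun h => hv (hTA h))
      Z1 := Z1
      Z2 := Z2
      Z3 := Z3
      closed := hclosed
      typ := hHd
      typdeg := by
        intro v hv
        have h1 := hHd v hv
        rw [Finset.mem_union, not_or] at hv
        have h2 := (g.typ v hv.1).1
        have h3 := c.δle
        have : (⌈δ * d⌉₊ : ℝ) ≤ (nb H v).card := by nlinarith
        exact_mod_cast this
      aty := by
        intro v hvA hvW hvZ
        have h1 := hKd v hvW (fun h => hvZ (hTZ (Finset.mem_inter.2 ⟨h, hvW⟩)))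
        have h2 := hloss v hvZ
        have h3 := c.hK
        omega
      nbr := g.nbr
      K'pos := c.K'pos
      hK := le_rfl
      hk := Nat.le_ceil _
      small := g.small
      rect := g.rect
      boost₂ := g.boost₂
      boost₃ := g.boost₃
      bad := hbad
      edges := g.edges.le
      npos := by have := g.npos; omega
      dpos := hd
      εpos := by linarith
      εle := by linarith
      γle := by linarith [c.γle]
      κle₁ := c.κle₁
      κle₂ := c.κle₂
      δ₂pos := c.δ₂pos
      δ₂le := c.δ₂le
      budget := by
        have h1 := c.d₃
        have h2 := c.δη
        have h3 : (1 : ℝ) ≤ Fintype.card V := by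
          have := g.npos
          exact_mod_cast (by omega : 1 ≤ Fintype.card V)
        push_cast
        generalize 2 / (δ₂ * (ε / 2) / 8) = x at *
        generalize 2 / (1 / 18 * (ε / 2) / 8) = y at *
        have h4 : 2 * ((⌈δ * d⌉₊ : ℝ) + 20 * K' + 4 + x + y + 4) ≤ η * d := by
          nlinarith
        have h5 := mul_le_mul_of_nonneg_left h4 hn.le
        nlinarith }
  obtain ⟨l, a, b, hl, hla, hlb, hba, hall⟩ := s.hamilton
  exact ⟨l, a, b, ⟨hl.1, hl.2.imp (fun _ _ h => hHΓ h)⟩, hla, hlb, hHΓ hba, hall⟩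

end Assembly

section Core

open scoped Classical
set_option linter.unusedSectionVars false
variable [Fintype V]
variable {G Γ : SimpleGraph V} {A T W : Finset V} {γ κ δ δ₂ η β ξ δ₀ ε : ℝ} {K' K : ℕ} {d : ℝ}

lemma deg_eq_card_nb (G : SimpleGraph V) (v : V) : deg G v = (nb G v).card := by
  rw [deg, ← Set.ncard_coe_finset]
  congr 1
  ext w; simp

lemma deg_eq_card_nb_map {s : Set V} (F : SimpleGraph s) (w : s) :
    deg F w = (nb (F.map (Function.Embedding.subtype _)) (w : V)).card := by
  rw [deg_eq_card_nb]
  rw [← Finset.card_map (Function.Embedding.subtype _)]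
  congr 1
  ext x
  simp only [Finset.mem_map, mem_nb, SimpleGraph.map_adj, Function.Embedding.subtype_apply]
  constructor
  · rintro ⟨y, hy, rfl⟩
    exact ⟨w, y, hy, rfl, rfl⟩
  · rintro ⟨u, y, hy, hu, rfl⟩
    have : u = w := Subtype.ext hu
    subst this
    exact ⟨y, hy, rfl⟩

lemma deg_twoCore (G : SimpleGraph V) (w : coreSet G) :
    deg (twoCore G) w = (nb G (w : V) ∩ Finset.univ.filter (· ∈ coreSet G)).card := by
  rw [deg_eq_card_nb, ← Finset.card_map (Function.Embedding.subtype _)]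
  congr 1
  ext x
  simp only [Finset.mem_map, mem_nb, twoCore, SimpleGraph.comap_adj,
    Function.Embedding.subtype_apply, Finset.mem_inter, Finset.mem_filter, Finset.mem_univ,
    true_and]
  constructor
  · rintro ⟨y, hy, rfl⟩
    exact ⟨hy, y.2⟩
  · rintro ⟨h1, h2⟩
    exact ⟨⟨x, h2⟩, h1, rfl⟩

lemma deg_sdiff {F H : SimpleGraph V} (h : H ≤ F) (v : V) :
    deg (F \ H) v + deg H v = deg F v := by
  simp only [deg_eq_card_nb]
  rw [← Finset.card_union_of_disjoint]
  · congr 1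
    ext x
    simp only [Finset.mem_union, mem_nb, SimpleGraph.sdiff_adj]
    constructor
    · rintro (h1 | h1)
      · exact h1.1
      · exact h h1
    · intro h1
      by_cases h2 : H.Adj v x
      · exact Or.inr h2
      · exact Or.inl ⟨h1, h2⟩
  · rw [Finset.disjoint_left]
    intro x
    simp only [mem_nb, SimpleGraph.sdiff_adj]
    tauto

lemma card_mul_density {α : Type*} [Fintype α] (F : SimpleGraph α) (h : 2 ≤ Fintype.card α) :
    (Nat.card α : ℝ) * density F = dc F / ((Fintype.card α : ℝ) - 1) := by
  have h1 : 2 * F.edgeSet.ncard = dc F := by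
    rw [dc_eq_sum, ← SimpleGraph.coe_edgeFinset, Set.ncard_coe_finset,
      ← SimpleGraph.sum_degrees_eq_twice_card_edges]
    refine Finset.sum_congr rfl fun v _ => ?_
    rw [← SimpleGraph.card_neighborFinset_eq_degree]
    congr 1
    ext w; simp
  have h2 : (2 * F.edgeSet.ncard : ℝ) = dc F := by exact_mod_cast h1
  rw [density, Nat.card_eq_fintype_card, Nat.cast_choose_two, ← h2]
  have h3 : (2 : ℝ) ≤ Fintype.card α := by exact_mod_cast h
  have h4 : (Fintype.card α : ℝ) - 1 ≠ 0 := by linarith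
  have h5 : (Fintype.card α : ℝ) ≠ 0 := by linarith
  field_simp

lemma Good.T_sub_A (g : Good G A T γ δ δ₂ η β ξ δ₀ ε K' d)
    (c : Consts ε γ κ δ δ₂ η β ξ δ₀ K' K d) : T ⊆ A := by
  intro v hv
  by_contra hvA
  have h1 := (g.typ v hvA).1
  have h2 := g.low v hv
  have := c.dpos
  have := c.δ₀le
  have := c.βle
  have := c.εle
  nlinarith

lemma Good.nb_T (g : Good G A T γ δ δ₂ η β ξ δ₀ ε K' d) (v : V) : (nb G v ∩ T).card ≤ 2 := by
  by_contra hcon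
  push Not at hcon
  obtain ⟨a, ha, b, hb, e, he, hab, hae, hbe⟩ := Finset.two_lt_card.1 hcon
  simp only [Finset.mem_inter, mem_nb] at ha hb he
  exact (g.spread T subset_rfl).star v a b e ha.2 hb.2 he.2 hab hae hbe ha.1 hb.1 he.1

lemma Good.mem_core (g : Good G A T γ δ δ₂ η β ξ δ₀ ε K' d)
    (c : Consts ε γ κ δ δ₂ η β ξ δ₀ K' K d) {v : V} (hv : v ∉ T) : v ∈ coreSet G := by
  refine Set.mem_sUnion.2 ⟨{v | v ∉ T}, ?_, hv⟩
  intro v hv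
  have h1 := g.nb_T v
  have h2 := g.high v hv
  have h3 := c.d₁
  have h4 : (8 : ℝ) ≤ (nb G v).card := by
    have : (0 : ℝ) ≤ K := Nat.cast_nonneg _
    linarith
  have h5 : 8 ≤ (nb G v).card := by exact_mod_cast h4
  have h6 : (nb G v \ T).card + (nb G v ∩ T).card = (nb G v).card :=
    Finset.card_sdiff_add_card_inter _ _
  have h7 : (G.neighborSet v ∩ {v | v ∉ T}).ncard = (nb G v \ T).card := by
    rw [← Set.ncard_coe_finset]
    congr 1
    ext w; simp
  omega

set_option maxHeartbeats 1000000 in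
/-- The two-core of a typical random graph is resilient. -/
theorem Good.resilient (g : Good G A T γ δ δ₂ η β ξ δ₀ ε K' d)
    (c : Consts ε γ κ δ δ₂ η β ξ δ₀ K' K d) :
    StrongResilient (twoCore G) (1 / 2 - ε) (δ₀ / 4) 2 (4 * β) K IsHam := by
  intro H hH htiny hatyp htypical
  have hd := c.dpos
  have hβ := c.βpos
  have hβε := c.βle
  have hε := c.εle
  have hε0 := c.εpos
  have hξ := c.ξle
  have hξ0 := c.ξpos
  have hδ₀ := c.δ₀pos
  have hδ₀' := c.δ₀le
  have hd1 := c.d₁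
  have hd2 := c.d₂
  have hn : (10 : ℝ) ≤ Fintype.card V := by exact_mod_cast g.npos
  have hK0 : (0 : ℝ) ≤ K := Nat.cast_nonneg _
  have hTA := g.T_sub_A c
  obtain ⟨W, hW⟩ : ∃ W, W = Finset.univ.filter (· ∈ coreSet G) := ⟨_, rfl⟩
  have hmemW : ∀ v, v ∈ W ↔ v ∈ coreSet G := by simp [hW]
  have hWT : ∀ v ∉ T, v ∈ W := fun v hv => (hmemW v).2 (g.mem_core c hv)
  have hTc : (T.card : ℝ) ≤ ξ * Fintype.card V :=
    le_trans (by exact_mod_cast Finset.card_le_card hTA) g.Acard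
  -- degrees in the core
  have hdegle : ∀ w : coreSet G, deg (twoCore G) w ≤ (nb G (w : V)).card := by
    intro w
    rw [deg_twoCore]
    exact Finset.card_le_card Finset.inter_subset_left
  have hdegge : ∀ w : coreSet G, (nb G (w : V)).card ≤ deg (twoCore G) w + 2 := by
    intro w
    rw [deg_twoCore, ← hW]
    have h1 : nb G (w : V) ⊆ (nb G (w : V) ∩ W) ∪ (nb G (w : V) ∩ T) := by
      intro x hx
      by_cases hxT : x ∈ T
      · exact Finset.mem_union_right _ (Finset.mem_inter.2 ⟨hx, hxT⟩)
      · exact Finset.mem_union_left _ (Finset.mem_inter.2 ⟨hx, hWT x hxT⟩)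
    have h2 := (Finset.card_le_card h1).trans (Finset.card_union_le _ _)
    have := g.nb_T (w : V)
    omega
  have hNW : Fintype.card (coreSet G) = W.card := by
    rw [hW, Fintype.card_subtype]
  have hWn : W.card ≤ Fintype.card V := Finset.card_le_univ _
  have hWge : (1 - ξ) * Fintype.card V ≤ W.card := by
    have h1 : Fintype.card V ≤ W.card + T.card := by
      rw [← Finset.card_univ]
      refine (Finset.card_le_card (fun v _ => ?_)).trans (Finset.card_union_le W T)
      by_cases hv : v ∈ T
      · exact Finset.mem_union_right _ hv
      · exact Finset.mem_union_left _ (hWT v hv)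
    have h2 : (Fintype.card V : ℝ) ≤ W.card + T.card := by exact_mod_cast h1
    linarith
  have hW3 : (3 : ℝ) ≤ W.card := by nlinarith
  obtain ⟨q, hq⟩ : ∃ q, q = (Nat.card (coreSet G) : ℝ) * density (twoCore G) := ⟨_, rfl⟩
  have hqeq : q = dc (twoCore G) / ((W.card : ℝ) - 1) := by
    rw [hq, card_mul_density, hNW]
    rw [hNW]
    have : (2 : ℝ) ≤ W.card := by linarith
    exact_mod_cast this
  have hsum : dc (twoCore G) = ∑ v ∈ W, (nb G v ∩ W).card := by
    have hs : ∑ v ∈ W, (nb G v ∩ W).card = ∑ w : coreSet G, (nb G (w : V) ∩ W).card :=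
      Finset.sum_subtype W (fun v => hmemW v) (fun v => (nb G v ∩ W).card)
    rw [hs, dc_eq_sum]
    refine Finset.sum_congr rfl fun w _ => ?_
    rw [← deg_eq_card_nb, deg_twoCore, hW]
  have hdcG : dc G = ∑ v, (nb G v).card := dc_eq_sum G
  have hdcle : (dc (twoCore G) : ℝ) ≤ Fintype.card V * d := by
    rw [← g.edges]
    norm_cast
    rw [hsum, hdcG]
    exact (Finset.sum_le_sum (fun v _ => Finset.card_le_card Finset.inter_subset_left)).trans
      (Finset.sum_le_sum_of_subset (Finset.subset_univ _))
  have hdcge : (1 - β / 4) * (Fintype.card V * d) ≤ dc (twoCore G) := by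
    have h1 : (dc G : ℝ) ≤ dc (twoCore G) + 2 * Fintype.card V +
        T.card * (δ₀ * d) := by
      rw [hdcG, hsum]
      push_cast
      rw [← Finset.sum_add_sum_compl T]
      have h2 : ∑ v ∈ T, ((nb G v).card : ℝ) ≤ T.card * (δ₀ * d) := by
        rw [← nsmul_eq_mul]
        exact Finset.sum_le_card_nsmul _ _ _ (fun v hv => (g.low v hv).le)
      have h3 : ∑ v ∈ Tᶜ, ((nb G v).card : ℝ) ≤ ∑ v ∈ Tᶜ, (((nb G v ∩ W).card : ℝ) + 2) := by
        refine Finset.sum_le_sum fun v hv => ?_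
        have h4 := hWT v (Finset.mem_compl.1 hv)
        have h5 := hdegge ⟨v, (hmemW v).1 h4⟩
        rw [deg_twoCore, ← hW] at h5
        exact_mod_cast h5
      rw [Finset.sum_add_distrib, Finset.sum_const, nsmul_eq_mul] at h3
      have h4 : ∑ v ∈ Tᶜ, ((nb G v ∩ W).card : ℝ) ≤ ∑ v ∈ W, ((nb G v ∩ W).card : ℝ) :=
        Finset.sum_le_sum_of_subset_of_nonneg (fun v hv => hWT v (Finset.mem_compl.1 hv))
          (fun _ _ _ => by positivity)
      have h5 : ((Tᶜ).card : ℝ) ≤ Fintype.card V := by exact_mod_cast Finset.card_le_univ _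
      linarith
    have h2 := g.edges
    have h3 : (T.card : ℝ) * (δ₀ * d) ≤ ξ * Fintype.card V * (1 * d) := by
      gcongr; linarith
    have h4 : 2 * (Fintype.card V : ℝ) ≤ β * d / 12 * Fintype.card V := by
      gcongr; linarith
    have h5 : ξ * (Fintype.card V * d) ≤ β / 8 * (Fintype.card V * d) := by gcongr
    have h6 : 0 ≤ β * (Fintype.card V * d) := by positivity
    linarith
  have hqge : (1 - β / 4) * d ≤ q := by
    rw [hqeq, le_div_iff₀ (by linarith)]
    refine le_trans ?_ hdcge
    have h1 : (W.card : ℝ) ≤ Fintype.card V := by exact_mod_cast hWn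
    have h2 : (1 - β / 4) * d * ((W.card : ℝ) - 1) ≤ (1 - β / 4) * d * Fintype.card V := by
      have : 0 ≤ (1 - β / 4) * d := mul_nonneg (by linarith) hd.le
      gcongr
      linarith
    linarith
  have hqle : q ≤ (1 + β / 2) * d := by
    rw [hqeq, div_le_iff₀ (by linarith)]
    refine hdcle.trans ?_
    have h1 := g.nξ
    have h2 : (1 - 2 * ξ) * Fintype.card V ≤ (W.card : ℝ) - 1 := by linarith
    have h3 : (1 + β / 2) * d * ((1 - 2 * ξ) * Fintype.card V) ≤
        (1 + β / 2) * d * ((W.card : ℝ) - 1) := by gcongr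
    refine le_trans ?_ h3
    have h4 : 1 ≤ (1 + β / 2) * (1 - 2 * ξ) := by nlinarith
    have h5 : 0 ≤ (Fintype.card V : ℝ) * d := by positivity
    nlinarith
  have hdT : ∀ w : coreSet G, (w : V) ∉ T → δ₀ * d - 2 ≤ deg (twoCore G) w := by
    intro w hw
    have h1 := g.high w hw
    have h2 : ((nb G (w : V)).card : ℝ) ≤ deg (twoCore G) w + 2 := by exact_mod_cast hdegge w
    linarith
  have hntiny : ∀ w : coreSet G, (w : V) ∉ T → w ∉ TINY (twoCore G) (density (twoCore G)) (δ₀ / 4) := by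
    intro w hw h
    have h1 := hdT w hw
    simp only [TINY, Set.mem_ofPred_eq, mul_assoc, ← hq] at h
    nlinarith
  have hdegH : ∀ w, (deg (twoCore G \ H) w : ℝ) = deg (twoCore G) w - deg H w := by
    intro w
    have : (deg (twoCore G \ H) w : ℝ) + deg H w = deg (twoCore G) w := by
      exact_mod_cast deg_sdiff hH w
    linarith
  have hK2 : 2 ≤ K := by have := c.hK; omega
  -- transport to the vertex set `V`
  have hsupp : ∀ u v, ((twoCore G \ H).map (Function.Embedding.subtype _)).Adj u v → u ∈ W := by
    rintro u v ⟨-, x, y, -, rfl, -⟩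
    exact (hmemW _).2 x.2
  obtain ⟨l, a, b, hl, hla, hlb, hba, hall⟩ := g.hamilton c
    (Γ := (twoCore G \ H).map (Function.Embedding.subtype _)) (W := W)
    (by
      rintro u v ⟨-, x, y, hxy, rfl, rfl⟩
      exact hxy.1)
    hsupp hWT
    (by
      intro v hvT hvW
      rw [← deg_eq_card_nb_map (twoCore G \ H) ⟨v, (hmemW v).1 hvW⟩]
      set w : coreSet G := ⟨v, (hmemW v).1 hvW⟩
      have h1 := hdegH w
      by_cases hw : w ∈ TINY (twoCore G) (density (twoCore G)) (δ₀ / 4)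
      · have h2 := htiny w hw
        have : (2 : ℝ) ≤ deg (twoCore G \ H) w := by push_cast at h2; linarith
        exact_mod_cast this
      · have h2 := hatyp w ?_ hw
        · have : (K : ℝ) ≤ deg (twoCore G \ H) w := by linarith
          exact hK2.trans (by exact_mod_cast this)
        · left
          rw [mul_assoc, ← hq]
          have h3 : (deg (twoCore G) w : ℝ) ≤ (nb G v).card := by exact_mod_cast hdegle w
          have h4 := g.low v hvT
          nlinarith)
    (by
      intro v hvW hvT
      rw [← deg_eq_card_nb_map (twoCore G \ H) ⟨v, (hmemW v).1 hvW⟩]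
      set w : coreSet G := ⟨v, (hmemW v).1 hvW⟩
      have h1 := hdegH w
      have h3 := hntiny w hvT
      have h4 := hdT w hvT
      have : (K : ℝ) ≤ deg (twoCore G \ H) w := by
        by_cases hw : w ∈ ATYP (twoCore G) (density (twoCore G)) (4 * β)
        · have := hatyp w hw h3
          linarith
        · have := htypical w h3 hw
          nlinarith
      exact_mod_cast this)
    (by
      intro v hvA
      have hvT : v ∉ T := fun h => hvA (hTA h)
      have hvW := hWT v hvT
      rw [← deg_eq_card_nb_map (twoCore G \ H) ⟨v, (hmemW v).1 hvW⟩]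
      set w : coreSet G := ⟨v, (hmemW v).1 hvW⟩
      have h1 := hdegH w
      have h3 := hntiny w hvT
      have h4 : ((nb G v).card : ℝ) ≤ deg (twoCore G) w + 2 := by exact_mod_cast hdegge w
      have h5 : (deg (twoCore G) w : ℝ) ≤ (nb G v).card := by exact_mod_cast hdegle w
      obtain ⟨h6, h7⟩ := g.typ v hvA
      have h8 := htypical w h3 (by
        simp only [ATYP, Set.mem_ofPred_eq, mul_assoc, ← hq, not_or, not_lt]
        constructor <;> nlinarith)
      have h9 : (1 / 2 - ε) * (deg (twoCore G) w : ℝ) ≤ (1 / 2 - ε) * ((1 + β) * d) := by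
        have : 0 ≤ 1 / 2 - ε := by linarith
        gcongr
        linarith
      nlinarith)
  have hlW : ∀ v ∈ l, v ∈ coreSet G := fun v hv => (hmemW v).1 ((hall v).1 hv)
  have hmapval : (l.attachWith _ hlW).map Subtype.val = l :=
    List.attachWith_map_subtype_val _
  have hadj : ∀ x y : coreSet G, ((twoCore G \ H).map (Function.Embedding.subtype _)).Adj x y →
      (twoCore G \ H).Adj x y := by
    rintro x y ⟨-, x', y', h, h1, h2⟩
    rwa [Subtype.ext h1, Subtype.ext h2] at h
  have ha := hlW a (List.mem_of_head? hla)
  have hb := hlW b (List.mem_of_getLast? hlb)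
  refine isHam_of_list _ (l.attachWith _ hlW) ⟨a, ha⟩ ⟨b, hb⟩ ⟨?_, ?_⟩ ?_ ?_
    (hadj ⟨b, hb⟩ ⟨a, ha⟩ hba) ?_ ?_
  · refine List.Nodup.of_map Subtype.val ?_
    rw [hmapval]; exact hl.1
  · have h1 := hl.2
    rw [← hmapval, List.isChain_map] at h1
    exact h1.imp (fun x y h => hadj x y h)
  · have : ((l.attachWith _ hlW).map Subtype.val).head? = some a := by rw [hmapval]; exact hla
    rw [List.head?_map, Option.map_eq_some_iff] at this
    obtain ⟨x, hx, hxa⟩ := this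
    rw [hx]; congr 1; exact Subtype.ext hxa
  · have : ((l.attachWith _ hlW).map Subtype.val).getLast? = some b := by rw [hmapval]; exact hlb
    rw [List.getLast?_map, Option.map_eq_some_iff] at this
    obtain ⟨x, hx, hxa⟩ := this
    rw [hx]; congr 1; exact Subtype.ext hxa
  · rw [List.length_attachWith]
    have h1 : W.card ≤ l.length := by
      refine (Finset.card_le_card (t := l.toFinset) (fun v hv => ?_)).trans (List.toFinset_card_le l)
      rw [List.mem_toFinset, hall]; exact hv
    have h2 : 3 ≤ W.card := by exact_mod_cast hW3
    omega
  · intro v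
    rw [List.mem_attachWith, hall, hmemW]
    exact v.2

/-- Resilience is monotone in the proportion of deleted edges. -/
lemma StrongResilient.mono {G : SimpleGraph V} {α α' δt δa : ℝ} {Kt Ka : ℕ}
    {P : SimpleGraph V → Prop} (h : StrongResilient G α δt Kt δa Ka P) (hα : α' ≤ α) :
    StrongResilient G α' δt Kt δa Ka P := fun H h1 h2 h3 h4 =>
  h H h1 h2 h3 (fun v h5 h6 => (h4 v h5 h6).trans (by gcongr))

end Core

section Subsets

open scoped Classical

lemma one_add_mul_one_sub_pow_le (j : ℕ) (t : ℝ) (ht : t ≤ 1) :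
    ∀ m ≤ j, (1 + j * t) * (1 - t) ^ m ≤ 1 + ((j : ℝ) - m) * t := by
  intro m
  induction m with
  | zero => intro _; simp
  | succ m ih =>
    intro hm
    have h1 := ih (by omega)
    have h2 : (m : ℝ) + 1 ≤ j := by exact_mod_cast hm
    have h3 : 0 ≤ 1 - t := by linarith
    have h4 := mul_le_mul_of_nonneg_right h1 h3
    rw [pow_succ]
    push_cast
    nlinarith [sq_nonneg t, mul_nonneg (by linarith : (0 : ℝ) ≤ (j : ℝ) - m) (sq_nonneg t)]

lemma sum_mul_pow_le {ι : Type*} (s : Finset ι) (y : ι → ℝ) (hy : ∀ i ∈ s, 0 ≤ y i) (j m : ℕ)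
    (hs : s.card = j + 1) (hj : 1 ≤ j) (hm : m ≤ j) :
    ∑ i ∈ s, y i * ((∑ k ∈ s, y k - y i) / j) ^ m ≤
      (j + 1) * ((∑ k ∈ s, y k) / (j + 1)) ^ (m + 1) := by
  set Y := ∑ k ∈ s, y k with hY
  have hY0 : 0 ≤ Y := Finset.sum_nonneg hy
  have hj' : (1 : ℝ) ≤ j := by exact_mod_cast hj
  rcases hY0.eq_or_lt with h0 | hpos
  · have hz : ∀ i ∈ s, y i = 0 := (Finset.sum_eq_zero_iff_of_nonneg hy).1 (by rw [← hY, ← h0])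
    rw [Finset.sum_eq_zero (fun i hi => by rw [hz i hi, zero_mul])]
    positivity
  · set a := Y / (j + 1) with ha
    have hapos : 0 < a := by positivity
    have hYa : Y = (j + 1) * a := by rw [ha]; field_simp
    have key : ∀ i ∈ s, y i * ((Y - y i) / j) ^ m ≤
        a ^ (m + 1) * (1 + ((j : ℝ) - m) * ((y i / a - 1) / j)) := by
      intro i hi
      have hle : y i ≤ Y := Finset.single_le_sum hy hi
      have h1 := one_add_mul_one_sub_pow_le j ((y i / a - 1) / j) (by
        rw [div_le_one (by linarith), sub_le_iff_le_add, div_le_iff₀ hapos, ← hYa]; exact hle) m hm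
      have h2 : 1 + (j : ℝ) * ((y i / a - 1) / j) = y i / a := by field_simp; ring
      have h3 : 1 - (y i / a - 1) / j = ((Y - y i) / j) / a := by rw [hYa]; field_simp; ring
      rw [h2, h3] at h1
      have h4 := mul_le_mul_of_nonneg_left h1 (by positivity : 0 ≤ a ^ (m + 1))
      refine le_trans (le_of_eq ?_) h4
      rw [div_pow ((Y - y i) / j) a, pow_succ]
      have : a ≠ 0 := hapos.ne'
      have : a ^ m ≠ 0 := by positivity
      generalize ((Y - y i) / j) ^ m = B
      field_simp
    refine (Finset.sum_le_sum key).trans (le_of_eq ?_)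
    rw [← Finset.mul_sum, Finset.sum_add_distrib, ← Finset.mul_sum, ← Finset.sum_div,
      Finset.sum_sub_distrib, ← Finset.sum_div, ← hY]
    simp only [Finset.sum_const, hs, nsmul_eq_mul, mul_one]
    have h5 : Y / a = j + 1 := by rw [hYa]; field_simp
    push_cast
    rw [h5]
    ring

lemma esum_succ {ι : Type*} (s : Finset ι) (y : ι → ℝ) (m : ℕ) :
    ((m : ℝ) + 1) * ∑ A ∈ s.powersetCard (m + 1), ∏ e ∈ A, y e =
      ∑ i ∈ s, y i * ∑ A ∈ (s.erase i).powersetCard m, ∏ e ∈ A, y e := by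
  have h1 : ∀ A ∈ s.powersetCard (m + 1), ((m : ℝ) + 1) * ∏ e ∈ A, y e =
      ∑ i ∈ A, ∏ e ∈ A, y e := by
    intro A hA
    rw [Finset.sum_const, (Finset.mem_powersetCard.1 hA).2, nsmul_eq_mul]
    push_cast; ring
  rw [Finset.mul_sum, Finset.sum_congr rfl h1]
  simp_rw [Finset.mul_sum]
  rw [Finset.sum_sigma', Finset.sum_sigma']
  refine Finset.sum_bij' (fun x _ => ⟨x.2, x.1.erase x.2⟩) (fun x _ => ⟨insert x.1 x.2, x.1⟩)
    ?_ ?_ ?_ ?_ ?_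
  · rintro ⟨A, i⟩ h
    simp only [Finset.mem_sigma, Finset.mem_powersetCard] at h ⊢
    obtain ⟨⟨h1, h2⟩, h3⟩ := h
    exact ⟨h1 h3, Finset.erase_subset_erase _ h1, by rw [Finset.card_erase_of_mem h3, h2]; rfl⟩
  · rintro ⟨i, A⟩ h
    simp only [Finset.mem_sigma, Finset.mem_powersetCard] at h ⊢
    obtain ⟨h1, h2, h3⟩ := h
    have h4 : i ∉ A := fun h => Finset.notMem_erase i s (h2 h)
    exact ⟨⟨Finset.insert_subset h1 (h2.trans (Finset.erase_subset _ _)),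
      by rw [Finset.card_insert_of_notMem h4, h3]⟩, Finset.mem_insert_self _ _⟩
  · rintro ⟨A, i⟩ h
    simp only [Finset.mem_sigma] at h
    simp [Finset.insert_erase h.2]
  · rintro ⟨i, A⟩ h
    simp only [Finset.mem_sigma, Finset.mem_powersetCard] at h ⊢
    have h4 : i ∉ A := fun h' => Finset.notMem_erase i s (h.2.1 h')
    simp [Finset.erase_insert h4]
  · rintro ⟨A, i⟩ h
    simp only [Finset.mem_sigma] at h
    exact (Finset.mul_prod_erase A y h.2).symm

/-- Maclaurin's inequality between an elementary symmetric mean and the arithmetic mean. -/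
lemma esum_le {ι : Type*} (y : ι → ℝ) : ∀ (m : ℕ) (s : Finset ι), (∀ i ∈ s, 0 ≤ y i) →
    m ≤ s.card → ∑ A ∈ s.powersetCard m, ∏ e ∈ A, y e ≤
      (s.card.choose m) * ((∑ i ∈ s, y i) / s.card) ^ m := by
  intro m
  induction m with
  | zero => intro s _ _; simp
  | succ m ih =>
    intro s hy hm
    obtain ⟨j, hj⟩ : ∃ j, s.card = j + 1 := ⟨s.card - 1, by omega⟩
    have hm1 : (0 : ℝ) < (m : ℝ) + 1 := by positivity
    rw [← mul_le_mul_iff_right₀ hm1, esum_succ]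
    rcases Nat.eq_zero_or_pos j with rfl | hj1
    · have hm0 : m = 0 := by omega
      subst hm0
      simp [hj]
    have h1 : ∀ i ∈ s, y i * ∑ A ∈ (s.erase i).powersetCard m, ∏ e ∈ A, y e ≤
        (j.choose m) * (y i * ((∑ k ∈ s, y k - y i) / j) ^ m) := by
      intro i hi
      have hc : (s.erase i).card = j := by rw [Finset.card_erase_of_mem hi, hj]; rfl
      have h2 := ih (s.erase i) (fun k hk => hy k (Finset.mem_of_mem_erase hk)) (by omega)
      have h3 : ∑ k ∈ s.erase i, y k = ∑ k ∈ s, y k - y i := by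
        rw [← Finset.add_sum_erase s y hi]; ring
      rw [hc, h3] at h2
      calc _ ≤ y i * ((j.choose m) * ((∑ k ∈ s, y k - y i) / j) ^ m) :=
            mul_le_mul_of_nonneg_left h2 (hy i hi)
        _ = _ := by ring
    refine (Finset.sum_le_sum h1).trans ?_
    rw [← Finset.mul_sum]
    have h2 := sum_mul_pow_le s y hy j m hj hj1 (by omega)
    have h3 : ((j + 1).choose (m + 1) : ℝ) * (m + 1) = (j + 1) * (j.choose m) := by
      exact_mod_cast (Nat.add_one_mul_choose_eq j m).symm
    rw [hj]
    push_cast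
    calc _ ≤ (j.choose m : ℝ) * ((j + 1) * ((∑ k ∈ s, y k) / (j + 1)) ^ (m + 1)) := by gcongr
      _ = ((j + 1) * (j.choose m)) * ((∑ k ∈ s, y k) / (j + 1)) ^ (m + 1) := by ring
      _ = _ := by rw [← h3]; ring

variable {ι : Type*} [Fintype ι]

/-- The probability of an event for a uniformly random `m`-subset. -/
def Pr (m : ℕ) (S : Finset ι → Prop) : ℝ :=
  (((Finset.univ : Finset ι).powersetCard m).filter S).card / ((Fintype.card ι).choose m)

lemma Pr_nonneg (m : ℕ) (S : Finset ι → Prop) : 0 ≤ Pr m S := by unfold Pr; positivity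

lemma Pr_eq_zero {m : ℕ} {S : Finset ι → Prop} (h : ∀ A, A.card = m → ¬ S A) : Pr m S = 0 := by
  unfold Pr
  rw [Finset.filter_false_of_mem fun A hA => h A (Finset.mem_powersetCard.1 hA).2]
  simp

lemma Pr_mono {m : ℕ} {S S' : Finset ι → Prop} (h : ∀ A, A.card = m → S A → S' A) :
    Pr m S ≤ Pr m S' := by
  unfold Pr
  refine div_le_div_of_nonneg_right ?_ (by positivity)
  norm_cast
  refine Finset.card_le_card fun A hA => ?_
  simp only [Finset.mem_filter, Finset.mem_powersetCard] at hA ⊢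
  exact ⟨hA.1, h A hA.1.2 hA.2⟩

lemma Pr_exists_le {κ : Type*} {m : ℕ} (I : Finset κ) (S : κ → Finset ι → Prop) :
    Pr m (fun A => ∃ i ∈ I, S i A) ≤ ∑ i ∈ I, Pr m (S i) := by
  unfold Pr
  rw [← Finset.sum_div]
  gcongr
  norm_cast
  refine (Finset.card_le_card ?_).trans (Finset.card_biUnion_le (s := I)
    (t := fun i => ((Finset.univ : Finset ι).powersetCard m).filter (S i)))
  intro A hA
  simp only [Finset.mem_filter, Finset.mem_biUnion] at hA ⊢
  obtain ⟨h1, i, hi, h2⟩ := hA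
  exact ⟨i, hi, h1, h2⟩

lemma Pr_or_le {m : ℕ} (S S' : Finset ι → Prop) :
    Pr m (fun A => S A ∨ S' A) ≤ Pr m S + Pr m S' := by
  unfold Pr
  rw [← add_div]
  gcongr
  norm_cast
  refine (Finset.card_le_card fun A hA => ?_).trans (Finset.card_union_le _ _)
  simp only [Finset.mem_filter, Finset.mem_union] at hA ⊢
  tauto

/-- Exponential moments of a uniformly random `m`-subset. -/
lemma sum_prod_le_exp (m : ℕ) (hm : m ≤ Fintype.card ι) (y : ι → ℝ) (hy : ∀ i, 0 ≤ y i) :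
    ∑ A ∈ (Finset.univ : Finset ι).powersetCard m, ∏ e ∈ A, y e ≤
      ((Fintype.card ι).choose m) *
        Real.exp ((m : ℝ) / Fintype.card ι * ∑ i, (y i - 1)) := by
  have h1 := esum_le y m Finset.univ (fun i _ => hy i) (by rwa [Finset.card_univ])
  rw [Finset.card_univ] at h1
  refine h1.trans ?_
  gcongr
  rcases Nat.eq_zero_or_pos (Fintype.card ι) with h0 | hpos
  · have : m = 0 := by omega
    subst this; simp
  have hN : (0 : ℝ) < Fintype.card ι := by exact_mod_cast hpos
  have h2 : (∑ i, y i) / Fintype.card ι = (∑ i, (y i - 1)) / Fintype.card ι + 1 := by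
    rw [Finset.sum_sub_distrib]
    simp only [Finset.sum_const, Finset.card_univ, nsmul_eq_mul, mul_one]
    field_simp
    ring
  have h3 : 0 ≤ (∑ i, y i) / Fintype.card ι :=
    div_nonneg (Finset.sum_nonneg fun i _ => hy i) hN.le
  calc ((∑ i, y i) / Fintype.card ι) ^ m
      ≤ (Real.exp ((∑ i, (y i - 1)) / Fintype.card ι)) ^ m := by
        gcongr
        rw [h2]; exact Real.add_one_le_exp _
    _ = _ := by
        rw [← Real.exp_nat_mul]; congr 1; ring

/-- Exponential Markov inequality for a uniformly random `m`-subset. -/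
lemma Pr_le_exp {m : ℕ} (hm : m ≤ Fintype.card ι) (S : Finset ι → Prop) (y : ι → ℝ)
    (hy : ∀ i, 0 ≤ y i) (C : ℝ) (hC : 0 ≤ C)
    (hS : ∀ A, A.card = m → S A → 1 ≤ C * ∏ e ∈ A, y e) :
    Pr m S ≤ C * Real.exp ((m : ℝ) / Fintype.card ι * ∑ i, (y i - 1)) := by
  have hch : (0 : ℝ) < (Fintype.card ι).choose m := by exact_mod_cast Nat.choose_pos hm
  unfold Pr
  rw [div_le_iff₀ hch]
  have h1 : ((((Finset.univ : Finset ι).powersetCard m).filter S).card : ℝ) ≤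
      ∑ A ∈ (Finset.univ : Finset ι).powersetCard m, C * ∏ e ∈ A, y e := by
    rw [Finset.card_eq_sum_ones]
    push_cast
    refine (Finset.sum_le_sum (fun A hA => ?_)).trans
      (Finset.sum_le_sum_of_subset_of_nonneg (Finset.filter_subset S _) (fun A _ _ => ?_))
    · simp only [Finset.mem_filter, Finset.mem_powersetCard] at hA
      exact hS A hA.1.2 hA.2
    · exact mul_nonneg hC (Finset.prod_nonneg fun i _ => hy i)
  refine h1.trans ?_
  rw [← Finset.mul_sum, mul_assoc, mul_comm (Real.exp _)]
  exact mul_le_mul_of_nonneg_left (sum_prod_le_exp m hm y hy) hC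

end Subsets

section RandomGraph

open scoped Classical

section
variable {ι : Type*} [Fintype ι]

/-- Upper tail of a weighted count over a uniformly random `m`-subset. -/
lemma Pr_upper {m : ℕ} (hm : m ≤ Fintype.card ι) (w : ι → ℝ) (t : ℝ) :
    Pr m (fun A => t ≤ ∑ e ∈ A, w e) ≤
      Real.exp (-t + (m : ℝ) / Fintype.card ι * ∑ i, (Real.exp (w i) - 1)) := by
  rw [Real.exp_add]
  refine Pr_le_exp hm _ (fun i => Real.exp (w i)) (fun i => (Real.exp_pos _).le) _
    (Real.exp_pos _).le ?_
  intro A _ hA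
  rw [← Real.exp_sum, ← Real.exp_add]
  exact Real.one_le_exp (by linarith)

/-- Upper tail with planted elements, for bounded weights. -/
lemma Pr_planted {m : ℕ} (hm0 : 0 < m) (hm : m ≤ Fintype.card ι) (F : Finset ι) (w : ι → ℝ)
    (hw : ∀ i, w i ≤ 1) (t : ℝ) :
    Pr m (fun A => F ⊆ A ∧ t ≤ ∑ e ∈ A, w e) ≤
      ((m : ℝ) / Fintype.card ι * Real.exp 3) ^ F.card *
        Real.exp (-t + (m : ℝ) / Fintype.card ι * ∑ i, (Real.exp (w i) - 1)) := by
  have hN : (0 : ℝ) < Fintype.card ι := by exact_mod_cast (by omega : 0 < Fintype.card ι)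
  set p : ℝ := (m : ℝ) / Fintype.card ι with hp
  have hp0 : 0 < p := by positivity
  have hp1 : p ≤ 1 := by
    rw [hp, div_le_one hN]; exact_mod_cast hm
  set y : ι → ℝ := fun i => Real.exp (w i) * (if i ∈ F then p⁻¹ else 1) with hy
  have hy0 : ∀ i, 0 ≤ y i := fun i => by
    rw [hy]; dsimp only; split_ifs <;> positivity
  have h1 := Pr_le_exp hm (fun A => F ⊆ A ∧ t ≤ ∑ e ∈ A, w e) y hy0
    (p ^ F.card * Real.exp (-t)) (by positivity) (by
      rintro A - ⟨hFA, hA⟩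
      rw [hy, Finset.prod_mul_distrib, ← Real.exp_sum, Finset.prod_ite_mem,
        Finset.inter_eq_right.2 hFA, Finset.prod_const]
      have h2 : 1 ≤ Real.exp (-t) * Real.exp (∑ e ∈ A, w e) := by
        rw [← Real.exp_add]; exact Real.one_le_exp (by linarith)
      calc (1 : ℝ) ≤ Real.exp (-t) * Real.exp (∑ e ∈ A, w e) := h2
        _ = _ := by rw [inv_pow]; field_simp)
  refine h1.trans ?_
  rw [← hp, mul_pow, Real.exp_add, ← Real.exp_nat_mul, mul_assoc, mul_assoc,
    mul_left_comm (Real.exp _) (Real.exp (-t))]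
  refine mul_le_mul_of_nonneg_left (mul_le_mul_of_nonneg_left ?_ (Real.exp_pos _).le) (by positivity)
  rw [← Real.exp_add, Real.exp_le_exp]
  have h3 : ∀ i, p * (y i - 1) ≤ (if i ∈ F then 3 else 0) + p * (Real.exp (w i) - 1) := by
    intro i
    have h4 : Real.exp (w i) ≤ 3 := (Real.exp_le_exp.2 (hw i)).trans Real.exp_one_lt_three.le
    have h5 := Real.exp_pos (w i)
    rw [hy]; dsimp only
    split_ifs with h
    · have h6 : p * (Real.exp (w i) * p⁻¹ - 1) = Real.exp (w i) - p := by field_simp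
      rw [h6]; nlinarith
    · simp
  rw [Finset.mul_sum, Finset.mul_sum]
  refine (Finset.sum_le_sum fun i _ => h3 i).trans (le_of_eq ?_)
  rw [Finset.sum_add_distrib, Finset.sum_ite_mem, Finset.univ_inter, Finset.sum_const,
    nsmul_eq_mul]

end

variable {n : ℕ}

/-- The graph with a prescribed set of edges. -/
def gr (A : Finset (EdgeType n)) : SimpleGraph (Fin n) :=
  SimpleGraph.fromEdgeSet {e | ∃ h : ¬ e.IsDiag, ⟨e, h⟩ ∈ A}

lemma gr_adj {A : Finset (EdgeType n)} {u v : Fin n} :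
    (gr A).Adj u v ↔ ∃ h : ¬ (s(u, v)).IsDiag, (⟨s(u, v), h⟩ : EdgeType n) ∈ A := by
  rw [gr, SimpleGraph.fromEdgeSet_adj]
  constructor
  · exact fun h => h.1
  · intro h
    exact ⟨h, by obtain ⟨h1, -⟩ := h; simpa using h1⟩

/-- The edge set of a graph as a finset of edges of the complete graph. -/
def es (E : SimpleGraph (Fin n)) : Finset (EdgeType n) :=
  Finset.univ.filter (fun e => (e : Sym2 (Fin n)) ∈ E.edgeSet)

lemma gr_es (E : SimpleGraph (Fin n)) : gr (es E) = E := by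
  ext u v
  rw [gr_adj]
  simp only [es, Finset.mem_filter, Finset.mem_univ, true_and, SimpleGraph.mem_edgeSet]
  constructor
  · rintro ⟨_, h⟩; exact h
  · intro h; exact ⟨by simpa using h.ne, h⟩

lemma es_subset {E : SimpleGraph (Fin n)} {A : Finset (EdgeType n)} (h : E ≤ gr A) : es E ⊆ A := by
  rintro ⟨e, he⟩ hE
  simp only [es, Finset.mem_filter, Finset.mem_univ, true_and] at hE
  induction e with
  | _ u v =>
    obtain ⟨h1, h2⟩ := gr_adj.1 (h hE)
    exact h2

/-- Multiplicity of an edge in a set of pairs. -/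
def wt (Q : Finset (Fin n × Fin n)) (e : EdgeType n) : ℕ :=
  (Q.filter (fun q => s(q.1, q.2) = (e : Sym2 (Fin n)))).card

lemma wt_le_two (Q : Finset (Fin n × Fin n)) (e : EdgeType n) : wt Q e ≤ 2 := by
  obtain ⟨e, he⟩ := e
  induction e with
  | _ u v =>
    refine (Finset.card_le_card (t := {(u, v), (v, u)}) ?_).trans Finset.card_le_two
    rintro ⟨x, y⟩ hq
    have := (Finset.mem_filter.1 hq).2
    simp only [Sym2.eq_iff] at this
    simpa using this

lemma wt_univ (e : EdgeType n) : wt Finset.univ e = 2 := by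
  obtain ⟨e, he⟩ := e
  induction e with
  | _ u v =>
    have huv : u ≠ v := by simpa using he
    have : (Finset.univ.filter (fun q : Fin n × Fin n => s(q.1, q.2) = s(u, v))) =
        {(u, v), (v, u)} := by
      ext ⟨x, y⟩
      simp
    rw [wt, this, Finset.card_pair]
    simp [huv]

lemma sum_wt (A : Finset (EdgeType n)) (Q : Finset (Fin n × Fin n)) :
    ∑ e ∈ A, wt Q e = cnt (gr A) Q := by
  rw [cnt]
  simp only [wt]
  rw [← Finset.card_biUnion]
  · congr 1
    ext ⟨x, y⟩
    simp only [Finset.mem_biUnion, Finset.mem_filter, gr_adj]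
    constructor
    · rintro ⟨⟨e, he⟩, heA, hq, rfl⟩
      exact ⟨hq, he, heA⟩
    · rintro ⟨hq, h1, h2⟩
      exact ⟨_, h2, hq, rfl⟩
  · intro e _ e' _ hne
    refine Finset.disjoint_left.2 fun q h1 h2 => hne ?_
    exact Subtype.ext ((Finset.mem_filter.1 h1).2.symm.trans (Finset.mem_filter.1 h2).2)

lemma dc_gr (A : Finset (EdgeType n)) : dc (gr A) = 2 * A.card := by
  rw [dc, ← sum_wt, Finset.sum_congr rfl (fun e _ => wt_univ e), Finset.sum_const, smul_eq_mul,
    mul_comm]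

lemma sum_wt_univ (Q : Finset (Fin n × Fin n)) : Q.card ≤ ∑ e : EdgeType n, wt Q e + n := by
  rw [sum_wt, cnt]
  have h1 : Q ⊆ Q.filter (fun q => (gr Finset.univ).Adj q.1 q.2) ∪
      Finset.univ.image (fun v : Fin n => (v, v)) := by
    rintro ⟨x, y⟩ hq
    simp only [Finset.mem_union, Finset.mem_filter, gr_adj, Finset.mem_image, Finset.mem_univ,
      true_and, Prod.mk.injEq]
    by_cases h : x = y
    · right; exact ⟨x, rfl, h⟩
    · left; exact ⟨hq, by simpa using h, trivial⟩
  refine (Finset.card_le_card h1).trans ((Finset.card_union_le _ _).trans ?_)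
  gcongr
  exact Finset.card_image_le.trans (by simp)

lemma card_edgeType (n : ℕ) : Fintype.card (EdgeType n) = n.choose 2 := by
  rw [Sym2.card_subtype_not_diag, Fintype.card_fin]

lemma exp_neg_le {x : ℝ} (hx : 0 ≤ x) : Real.exp (-x) ≤ 1 - x + x ^ 2 / 2 := by
  have h1 : (1 - x + x ^ 2 / 2) * Real.exp x ≥ 1 := by
    have h2 := Real.quadratic_le_exp_of_nonneg hx
    have h3 : 0 < 1 - x + x ^ 2 / 2 := by nlinarith [sq_nonneg (x - 1)]
    nlinarith [sq_nonneg (x ^ 2)]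
  rw [Real.exp_neg, inv_le_iff_one_le_mul₀ (Real.exp_pos x)]
  exact h1

/-- A single set of pairs contains the expected number of darts, with planted edges. -/
lemma Pr_cnt_lower {m : ℕ} (hm0 : 0 < m) (hm : m ≤ Fintype.card (EdgeType n)) {γ c : ℝ}
    (hγ : 0 < γ) (hγ1 : γ ≤ 1) (hc : 0 < c) (hn : 4 / (γ * c) ≤ n) (F : Finset (EdgeType n))
    (Q : Finset (Fin n × Fin n)) (hQ : c * (n : ℝ) ^ 2 ≤ Q.card) :
    Pr m (fun A => F ⊆ A ∧ ¬ ((1 - γ) * (2 * m / n / n) * Q.card ≤ cnt (gr A) Q)) ≤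
      ((m : ℝ) / Fintype.card (EdgeType n) * Real.exp 3) ^ F.card *
        Real.exp (-(γ ^ 2 * c / 8) * (2 * m)) := by
  have hn0 : (0 : ℝ) < n := lt_of_lt_of_le (by positivity) hn
  have hNn : (Fintype.card (EdgeType n) : ℝ) = n * (n - 1) / 2 := by
    rw [card_edgeType, Nat.cast_choose_two]
  have hN : (0 : ℝ) < Fintype.card (EdgeType n) := by
    exact_mod_cast (by omega : 0 < Fintype.card (EdgeType n))
  set p : ℝ := (m : ℝ) / Fintype.card (EdgeType n) with hp
  have hm' : (0 : ℝ) < m := by exact_mod_cast hm0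
  have hp0 : 0 < p := by positivity
  have hdp : 2 * (m : ℝ) / n / n ≤ p := by
    rw [hp, div_div, div_le_div_iff₀ (by positivity) hN, hNn]
    nlinarith
  have hpn : 2 * (m : ℝ) ≤ p * n ^ 2 := by
    rw [div_div, div_le_iff₀ (by positivity)] at hdp
    nlinarith
  have h1 := Pr_planted hm0 hm F (fun e => -(γ / 2 * wt Q e))
    (fun e => by linarith [(by positivity : 0 ≤ γ / 2 * (wt Q e : ℝ))])
    (-(γ / 2 * ((1 - γ) * (2 * m / n / n) * Q.card)))
  refine (Pr_mono ?_).trans (h1.trans ?_)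
  · rintro A - ⟨h2, h3⟩
    refine ⟨h2, ?_⟩
    rw [Finset.sum_neg_distrib, ← Finset.mul_sum, neg_le_neg_iff]
    push Not at h3
    rw [← sum_wt] at h3
    push_cast at h3
    gcongr
  · rw [← hp]
    refine mul_le_mul_of_nonneg_left (Real.exp_le_exp.2 ?_) (by positivity)
    have hS : ((Q.card : ℝ) - n) ≤ ∑ e : EdgeType n, (wt Q e : ℝ) := by
      have : (Q.card : ℝ) ≤ ∑ e : EdgeType n, (wt Q e : ℝ) + n := by exact_mod_cast sum_wt_univ Q
      linarith
    have h2 : ∑ e : EdgeType n, (Real.exp (-(γ / 2 * wt Q e)) - 1) ≤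
        ∑ e : EdgeType n, (-(γ / 2 - γ ^ 2 / 4)) * (wt Q e : ℝ) := by
      refine Finset.sum_le_sum fun e _ => ?_
      have h3 := exp_neg_le (by positivity : 0 ≤ γ / 2 * (wt Q e : ℝ))
      have h4 : (wt Q e : ℝ) ≤ 2 := by exact_mod_cast wt_le_two Q e
      have h5 : (0 : ℝ) ≤ wt Q e := by positivity
      have h6 : γ ^ 2 * (wt Q e : ℝ) * (2 - wt Q e) ≥ 0 := by
        have : 0 ≤ 2 - (wt Q e : ℝ) := by linarith
        positivity
      nlinarith
    rw [← Finset.mul_sum] at h2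
    have h3 : ∑ e : EdgeType n, (Real.exp (-(γ / 2 * wt Q e)) - 1) ≤
        -(γ / 2 - γ ^ 2 / 4) * ((Q.card : ℝ) - n) := by
      refine h2.trans ?_
      have : 0 ≤ γ / 2 - γ ^ 2 / 4 := by nlinarith
      nlinarith
    have h4 := mul_le_mul_of_nonneg_left h3 hp0.le
    have hQ0 : (0 : ℝ) ≤ Q.card := by positivity
    have h5 : γ / 2 * ((1 - γ) * (2 * m / n / n) * Q.card) ≤ γ / 2 * ((1 - γ) * p * Q.card) := by
      have : 0 ≤ 1 - γ := by linarith
      gcongr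
    have h6 : 4 ≤ γ * c * n := by
      rw [div_le_iff₀ (by positivity)] at hn; linarith
    have h7 : γ * (n : ℝ) ≤ γ ^ 2 * c / 4 * n ^ 2 := by nlinarith [mul_pos hγ hn0]
    have h8 : γ ^ 2 * (c * (n : ℝ) ^ 2) ≤ γ ^ 2 * Q.card := by gcongr
    have h9 : p * ((γ / 2 - γ ^ 2 / 4) * n) ≤ p * (γ ^ 2 * c / 8 * n ^ 2) := by
      refine mul_le_mul_of_nonneg_left ?_ hp0.le
      nlinarith [mul_nonneg (sq_nonneg γ) hn0.le]
    have h10 : p * (γ ^ 2 * (c * (n : ℝ) ^ 2)) ≤ p * (γ ^ 2 * Q.card) := by gcongr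
    have h11 : γ ^ 2 * c / 8 * (2 * m) ≤ γ ^ 2 * c / 8 * (p * n ^ 2) := by gcongr
    nlinarith

lemma exp_three_le : Real.exp 3 ≤ 21 := by
  have h1 := Real.exp_one_lt_d9
  have h2 : Real.exp 3 = Real.exp 1 ^ 3 := by rw [← Real.exp_nat_mul]; norm_num
  rw [h2]
  calc Real.exp 1 ^ 3 ≤ 2.7182818286 ^ 3 := by gcongr
    _ ≤ 21 := by norm_num

lemma exists_eta {a : ℝ} (ha : 0 < a) : ∃ η : ℝ, 0 < η ∧ η ≤ 1 ∧
    Real.negMulLog η + 21 * η ≤ a := by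
  have h1 : Tendsto (fun x : ℝ => Real.negMulLog x + 21 * x) (nhdsWithin 0 (Set.Ioi 0)) (nhds 0) := by
    have : Continuous (fun x : ℝ => Real.negMulLog x + 21 * x) := by fun_prop
    have h2 := this.tendsto 0
    simp only [Real.negMulLog_zero, mul_zero, add_zero] at h2
    exact h2.mono_left nhdsWithin_le_nhds
  have h2 := (h1.eventually (ge_mem_nhds ha)).and (Ioo_mem_nhdsGT (zero_lt_one' ℝ))
  obtain ⟨η, h3, h4⟩ := h2.exists
  exact ⟨η, h4.1, h4.2.le, h3⟩

lemma sum_small_subsets {ι : Type*} [Fintype ι] (f : ℝ) {η x : ℝ} (hη : 0 < η) (hη1 : η ≤ 1)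
    (hx : 0 ≤ x) :
    ∑ F ∈ (Finset.univ : Finset (Finset ι)).filter (fun F => (F.card : ℝ) ≤ f), x ^ F.card ≤
      Real.exp (-(f * Real.log η) + η * x * Fintype.card ι) := by
  have h1 : ∀ F ∈ (Finset.univ : Finset (Finset ι)).filter (fun F => (F.card : ℝ) ≤ f),
      x ^ F.card ≤ Real.exp (-(f * Real.log η)) * (η * x) ^ F.card := by
    intro F hF
    have h2 := (Finset.mem_filter.1 hF).2
    have h3 : η ^ F.card = Real.exp (F.card * Real.log η) := by
      rw [Real.exp_nat_mul, Real.exp_log hη]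
    rw [mul_pow, ← mul_assoc, h3, ← Real.exp_add]
    refine le_mul_of_one_le_left (by positivity) (Real.one_le_exp ?_)
    have := Real.log_nonpos hη.le hη1
    nlinarith
  refine (Finset.sum_le_sum h1).trans ?_
  rw [← Finset.mul_sum, Real.exp_add]
  refine mul_le_mul_of_nonneg_left ?_ (Real.exp_pos _).le
  refine (Finset.sum_le_sum_of_subset_of_nonneg (Finset.filter_subset _ _)
    (fun _ _ _ => by positivity)).trans ?_
  have h2 := Fintype.sum_pow_mul_eq_add_pow ι (η * x) 1
  simp only [one_pow, mul_one] at h2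
  rw [h2, mul_comm (η * x), Real.exp_nat_mul]
  gcongr
  exact Real.add_one_le_exp _

/-- The `Boost` property fails with exponentially small probability. -/
theorem Pr_not_boost {γ c : ℝ} (hγ : 0 < γ) (hγ1 : γ ≤ 1) (hc : 0 < c) :
    ∃ η D n₀ : ℝ, 0 < η ∧ η ≤ 1 ∧ 0 < D ∧ 0 < n₀ ∧ ∀ n m : ℕ, n₀ ≤ n → 
      m ≤ Fintype.card (EdgeType n) → D ≤ 2 * (m : ℝ) / n →
      ∀ (ι : Type) [Fintype ι], (Fintype.card ι : ℝ) ≤ Real.exp (4 * n) →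
      ∀ Q : SimpleGraph (Fin n) → ι → Finset (Fin n × Fin n),
      Pr m (fun A : Finset (EdgeType n) => ¬ Boost (gr A) (2 * m / n) γ c η Q) ≤
        Real.exp (-(n : ℝ)) := by
  set a := γ ^ 2 * c / 8 with ha
  have ha0 : 0 < a := by positivity
  obtain ⟨η, hη, hη1, hηa⟩ := exists_eta (by positivity : 0 < a / 2)
  refine ⟨η, 8 / a, 4 / (γ * c), hη, hη1, by positivity, by positivity, ?_⟩
  intro n m hn hm hD ι _ hι Q
  have hn0 : (0 : ℝ) < n := lt_of_lt_of_le (by positivity) hn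
  have hm' : (0 : ℝ) < m := by
    by_contra h
    have : (m : ℝ) = 0 := le_antisymm (not_lt.1 h) (Nat.cast_nonneg _)
    rw [this] at hD
    simp at hD
    have : 0 < 8 / a := by positivity
    linarith
  have hm0 : 0 < m := by exact_mod_cast hm'
  have hN : (0 : ℝ) < Fintype.card (EdgeType n) := by
    exact_mod_cast (by omega : 0 < Fintype.card (EdgeType n))
  have h1 : Pr m (fun A : Finset (EdgeType n) => ¬ Boost (gr A) (2 * m / n) γ c η Q) ≤
      Pr m (fun A => ∃ z ∈ ((Finset.univ : Finset (Finset (EdgeType n))).filter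
        (fun F => (F.card : ℝ) ≤ η * m)) ×ˢ (Finset.univ : Finset ι),
        c * (n : ℝ) ^ 2 ≤ (Q (gr z.1) z.2).card ∧ z.1 ⊆ A ∧
        ¬ ((1 - γ) * (2 * m / n / n) * (Q (gr z.1) z.2).card ≤ cnt (gr A) (Q (gr z.1) z.2))) := by
    refine Pr_mono fun A hA h => ?_
    unfold Boost at h
    push Not at h
    obtain ⟨E, hE, hEc, i, hi, hcnt⟩ := h
    refine ⟨(es E, i), ?_, ?_⟩
    · simp only [Finset.mem_product, Finset.mem_filter, Finset.mem_univ, true_and, and_true]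
      have h2 : dc E = 2 * (es E).card := by rw [← dc_gr, gr_es]
      rw [h2, Fintype.card_fin] at hEc
      push_cast at hEc
      have h3 : η * n * (2 * m / n) = 2 * (η * m) := by field_simp
      linarith
    · simp only [gr_es, Fintype.card_fin, not_le] at *
      exact ⟨hi, es_subset hE, hcnt⟩
  refine h1.trans ((Pr_exists_le _ _).trans ?_)
  have h2 : ∀ z ∈ ((Finset.univ : Finset (Finset (EdgeType n))).filter
      (fun F => (F.card : ℝ) ≤ η * m)) ×ˢ (Finset.univ : Finset ι),
      Pr m (fun A => c * (n : ℝ) ^ 2 ≤ (Q (gr z.1) z.2).card ∧ z.1 ⊆ A ∧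
        ¬ ((1 - γ) * (2 * m / n / n) * (Q (gr z.1) z.2).card ≤ cnt (gr A) (Q (gr z.1) z.2))) ≤
      ((m : ℝ) / Fintype.card (EdgeType n) * Real.exp 3) ^ z.1.card * Real.exp (-a * (2 * m)) := by
    intro z _
    by_cases hz : c * (n : ℝ) ^ 2 ≤ (Q (gr z.1) z.2).card
    · refine (Pr_mono fun A _ h => h.2).trans (Pr_cnt_lower hm0 hm hγ hγ1 hc hn z.1 _ hz)
    · have : Pr m (fun A => c * (n : ℝ) ^ 2 ≤ (Q (gr z.1) z.2).card ∧ z.1 ⊆ A ∧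
        ¬ ((1 - γ) * (2 * m / n / n) * (Q (gr z.1) z.2).card ≤ cnt (gr A) (Q (gr z.1) z.2))) = 0 :=
        Pr_eq_zero fun A _ h => hz h.1
      rw [this]; positivity
  refine (Finset.sum_le_sum h2).trans ?_
  rw [Finset.sum_product]
  simp only [Finset.sum_const, Finset.card_univ, nsmul_eq_mul]
  rw [← Finset.mul_sum, ← Finset.sum_mul]
  have h3 := sum_small_subsets (ι := EdgeType n) (η * m) hη hη1
    (by positivity : 0 ≤ (m : ℝ) / Fintype.card (EdgeType n) * Real.exp 3)
  have h4 : η * ((m : ℝ) / Fintype.card (EdgeType n) * Real.exp 3) * Fintype.card (EdgeType n) =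
      η * m * Real.exp 3 := by field_simp
  rw [h4] at h3
  have he := exp_three_le
  calc _ ≤ Real.exp (4 * n) * (Real.exp (-(η * m * Real.log η) + η * m * Real.exp 3) *
        Real.exp (-a * (2 * m))) := by gcongr
    _ ≤ _ := by
        rw [← Real.exp_add, ← Real.exp_add, Real.exp_le_exp]
        have h5 : m * (Real.negMulLog η + 21 * η) ≤ m * (a / 2) := by gcongr
        rw [Real.negMulLog] at h5
        have h6 : η * m * Real.exp 3 ≤ η * m * 21 := by gcongr
        have h7 : 8 * (n : ℝ) ≤ a * (2 * m) := by
          rw [div_le_div_iff₀ ha0 hn0] at hD; linarith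
        nlinarith

end RandomGraph

section Neighbours

open scoped Classical

lemma cnt_product [Fintype V] [DecidableEq V] (G : SimpleGraph V) (S T : Finset V) :
    cnt G (S ×ˢ T) = ∑ v ∈ S, (nb G v ∩ T).card := by
  rw [cnt, Finset.card_filter, Finset.sum_product]
  refine Finset.sum_congr rfl fun v _ => ?_
  rw [← Finset.card_filter]
  congr 1
  ext u
  simp [nb, and_comm]

variable {n : ℕ}

lemma sum_wt_row (X : Finset (Fin n)) :
    ∑ e : EdgeType n, wt (X ×ˢ Finset.univ) e = X.card * (n - 1) := by
  rw [sum_wt, cnt_product, Finset.sum_const_nat]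
  intro v _
  have : nb (gr (Finset.univ : Finset (EdgeType n))) v = Finset.univ.erase v := by
    ext u
    simp [nb, gr_adj, eq_comm]
  rw [Finset.inter_univ, this, Finset.card_erase_of_mem (Finset.mem_univ _)]
  simp

/-- The edges joining a vertex to a set. -/
def star (v : Fin n) (X : Finset (Fin n)) : Finset (EdgeType n) :=
  Finset.univ.filter (fun e => ∃ x ∈ X, s(v, x) = (e : Sym2 (Fin n)))

lemma card_star {v : Fin n} {X : Finset (Fin n)} (h : v ∉ X) : (star v X).card = X.card := by
  symm
  refine Finset.card_bij (fun x hx => ⟨s(v, x), by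
    simp only [Sym2.mk_isDiag_iff]; rintro rfl; exact h hx⟩) ?_ ?_ ?_
  · intro x hx
    simp only [star, Finset.mem_filter, Finset.mem_univ, true_and]
    exact ⟨x, hx, rfl⟩
  · intro x hx y hy hxy
    exact Sym2.congr_right.1 (congrArg Subtype.val hxy)
  · intro e he
    obtain ⟨x, hx, h2⟩ := (Finset.mem_filter.1 he).2
    exact ⟨x, hx, Subtype.ext h2⟩

lemma edge_prob (hn : 2 ≤ n) (m : ℕ) :
    (m : ℝ) / Fintype.card (EdgeType n) * (n - 1) = 2 * m / n := by
  have hn0 : (2 : ℝ) ≤ n := by exact_mod_cast hn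
  have h1 : (n : ℝ) - 1 ≠ 0 := by linarith
  rw [card_edgeType, Nat.cast_choose_two]
  field_simp

lemma edge_prob_mul_le (hn : 2 ≤ n) (m : ℕ) :
    (m : ℝ) / Fintype.card (EdgeType n) * n ≤ 2 * (2 * m / n) := by
  have hn0 : (2 : ℝ) ≤ n := by exact_mod_cast hn
  rw [← edge_prob hn]
  have : 0 ≤ (m : ℝ) / Fintype.card (EdgeType n) := by positivity
  nlinarith

/-- Neighbourhoods consisting of vertices of too small or too large degree. -/
lemma Pr_star {m : ℕ} (hn : 2 ≤ n) (hm0 : 0 < m) (hm : m ≤ Fintype.card (EdgeType n)) {β θ : ℝ}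
    (hβ : 0 < β) (hβ1 : β ≤ 1) (hθ : θ = 1 ∨ θ = -1) {v : Fin n} {X : Finset (Fin n)} (hv : v ∉ X) :
    Pr m (fun A => star v X ⊆ A ∧ θ * ((1 + θ * β) * (2 * m / n) * X.card) ≤
        θ * cnt (gr A) (X ×ˢ Finset.univ)) ≤
      ((m : ℝ) / Fintype.card (EdgeType n) * Real.exp 3) ^ X.card *
        Real.exp (-(β ^ 2 / 8) * (2 * m / n) * X.card) := by
  set Q : Finset (Fin n × Fin n) := X ×ˢ Finset.univ with hQ
  have hp0 : 0 ≤ (m : ℝ) / Fintype.card (EdgeType n) := by positivity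
  have hw2 : ∀ e : EdgeType n, (wt Q e : ℝ) ≤ 2 := fun e => by exact_mod_cast wt_le_two Q e
  have hw0 : ∀ e : EdgeType n, (0 : ℝ) ≤ wt Q e := fun e => by positivity
  have h1 := Pr_planted hm0 hm (star v X) (fun e => θ * (β / 4) * wt Q e)
    (fun e => by rcases hθ with rfl | rfl <;> nlinarith [hw0 e, hw2 e, mul_nonneg hβ.le (hw0 e)])
    (θ * (β / 4) * ((1 + θ * β) * (2 * m / n) * X.card))
  rw [card_star hv] at h1
  refine (Pr_mono ?_).trans (h1.trans ?_)
  · rintro A - ⟨h2, h3⟩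
    refine ⟨h2, ?_⟩
    rw [← sum_wt] at h3
    push_cast at h3
    rw [← Finset.mul_sum]
    have := mul_le_mul_of_nonneg_left h3 (by positivity : 0 ≤ β / 4)
    linarith
  · refine mul_le_mul_of_nonneg_left (Real.exp_le_exp.2 ?_) (by positivity)
    have hS : ∑ e : EdgeType n, (wt Q e : ℝ) = X.card * (n - 1) := by
      have := sum_wt_row X
      rw [← Nat.cast_sum, hQ, this]
      push_cast [Nat.cast_sub (by omega : 1 ≤ n)]
      ring
    have h2 : ∑ e : EdgeType n, (Real.exp (θ * (β / 4) * wt Q e) - 1) ≤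
        ∑ e : EdgeType n, (θ * (β / 4) + β ^ 2 / 8) * (wt Q e : ℝ) := by
      refine Finset.sum_le_sum fun e _ => ?_
      have hsq : θ ^ 2 = 1 := by rcases hθ with rfl | rfl <;> norm_num
      have h3 := abs_le.1 (Real.abs_exp_sub_one_sub_id_le (x := θ * (β / 4) * wt Q e) (by
        rw [abs_le]
        rcases hθ with rfl | rfl <;> constructor <;>
          nlinarith [hw0 e, hw2 e, mul_nonneg hβ.le (hw0 e)]))
      have h4 : (θ * (β / 4) * wt Q e) ^ 2 = β ^ 2 / 16 * (wt Q e : ℝ) ^ 2 := by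
        calc _ = θ ^ 2 * (β ^ 2 / 16 * (wt Q e : ℝ) ^ 2) := by ring
          _ = _ := by rw [hsq, one_mul]
      have h5 : β ^ 2 * ((wt Q e : ℝ) * (2 - wt Q e)) ≥ 0 :=
        mul_nonneg (sq_nonneg _) (mul_nonneg (hw0 e) (by linarith [hw2 e]))
      nlinarith [h3.2]
    rw [← Finset.mul_sum, hS] at h2
    have h3 := mul_le_mul_of_nonneg_left h2 hp0
    have h4 : (m : ℝ) / Fintype.card (EdgeType n) *
        ((θ * (β / 4) + β ^ 2 / 8) * (X.card * (n - 1))) =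
        (θ * (β / 4) + β ^ 2 / 8) * X.card * (2 * m / n) := by
      rw [← edge_prob hn]; ring
    rw [h4] at h3
    have hsq : θ * (β / 4) * (θ * β * (2 * m / n) * X.card) = β ^ 2 / 4 * (2 * m / n * X.card) := by
      have hsq : θ ^ 2 = 1 := by rcases hθ with rfl | rfl <;> norm_num
      calc _ = θ ^ 2 * (β ^ 2 / 4 * (2 * m / n * X.card)) := by ring
        _ = _ := by rw [hsq, one_mul]
    nlinarith

/-- No vertex has many neighbours of atypical degree. -/
lemma Pr_nbr {m : ℕ} (hn : 2 ≤ n) (hm : m ≤ Fintype.card (EdgeType n)) {β : ℝ}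
    (hβ : 0 < β) (hβ1 : β ≤ 1) {k : ℕ} (hk : 480 ≤ β ^ 2 * k)
    (hD : 21504 / β ^ 4 ≤ 2 * (m : ℝ) / n) (hlog : Real.log n / 3 ≤ 2 * (m : ℝ) / n) :
    Pr m (fun A : Finset (EdgeType n) => ¬ ∀ v, (nb (gr A) v ∩ Finset.univ.filter (fun u =>
      ¬ ((1 - β) * (2 * m / n) ≤ (nb (gr A) u).card ∧
        ((nb (gr A) u).card : ℝ) ≤ (1 + β) * (2 * m / n)))).card ≤ 2 * k) ≤
      2 * n * Real.exp (-10 * Real.log n) := by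
  have hn0 : (0 : ℝ) < n := by exact_mod_cast (by omega : 0 < n)
  set d := 2 * (m : ℝ) / n with hd
  have hd0 : 0 < d := lt_of_lt_of_le (by positivity) hD
  have hm0 : 0 < m := by
    rcases Nat.eq_zero_or_pos m with h | h
    · rw [hd, h] at hd0; simp at hd0
    · exact h
  set p := (m : ℝ) / Fintype.card (EdgeType n) with hp
  have hp0 : 0 ≤ p := by positivity
  have h1 : Pr m (fun A : Finset (EdgeType n) => ¬ ∀ v, (nb (gr A) v ∩ Finset.univ.filter (fun u =>
      ¬ ((1 - β) * d ≤ (nb (gr A) u).card ∧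
        ((nb (gr A) u).card : ℝ) ≤ (1 + β) * d))).card ≤ 2 * k) ≤
      Pr m (fun A => ∃ z ∈ (Finset.univ : Finset (Fin n)) ×ˢ
        ((Finset.univ : Finset (Fin n)).powersetCard k) ×ˢ ({1, -1} : Finset ℝ),
        z.1 ∉ z.2.1 ∧ star z.1 z.2.1 ⊆ A ∧ z.2.2 * ((1 + z.2.2 * β) * d * z.2.1.card) ≤
          z.2.2 * cnt (gr A) (z.2.1 ×ˢ Finset.univ)) := by
    refine Pr_mono fun A _ h => ?_
    push Not at h
    obtain ⟨v, hv⟩ := h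
    set L := (nb (gr A) v).filter (fun u => ((nb (gr A) u).card : ℝ) < (1 - β) * d) with hL
    set H := (nb (gr A) v).filter (fun u => (1 + β) * d < ((nb (gr A) u).card : ℝ)) with hH
    have h2 : 2 * k < L.card + H.card := by
      refine hv.trans_le ((Finset.card_le_card ?_).trans (Finset.card_union_le _ _))
      intro u hu
      simp only [Finset.mem_inter, Finset.mem_filter, Finset.mem_univ, true_and] at hu
      simp only [hL, hH, Finset.mem_union, Finset.mem_filter]
      by_cases h3 : ((nb (gr A) u).card : ℝ) < (1 - β) * d
      · exact Or.inl ⟨hu.1, h3⟩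
      · exact Or.inr ⟨hu.1, hu.2 (not_lt.1 h3)⟩
    have hkey : ∀ X ⊆ nb (gr A) v, v ∉ X ∧ star v X ⊆ A := by
      intro X hX
      refine ⟨fun hvX => by simpa [nb] using hX hvX, ?_⟩
      rintro ⟨e, he⟩ hmem
      obtain ⟨x, hx, h4⟩ := (Finset.mem_filter.1 hmem).2
      subst h4
      have := hX hx
      simp only [nb, Finset.mem_filter, Finset.mem_univ, true_and] at this
      exact (gr_adj.1 this).2
    have hcnt : ∀ X : Finset (Fin n), (cnt (gr A) (X ×ˢ Finset.univ) : ℝ) =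
        ∑ x ∈ X, ((nb (gr A) x).card : ℝ) := by
      intro X
      rw [cnt_product]
      push_cast
      simp
    rcases (by omega : k ≤ L.card ∨ k ≤ H.card) with h3 | h3
    · obtain ⟨X, hX, hXk⟩ := Finset.exists_subset_card_eq h3
      obtain ⟨h4, h5⟩ := hkey X (hX.trans (Finset.filter_subset _ _))
      refine ⟨(v, X, -1), by simp [Finset.mem_powersetCard, hXk], h4, h5, ?_⟩
      dsimp only
      rw [hcnt]
      have : ∑ x ∈ X, ((nb (gr A) x).card : ℝ) ≤ X.card • ((1 - β) * d) :=
        Finset.sum_le_card_nsmul _ _ _ fun x hx => (Finset.mem_filter.1 (hX hx)).2.le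
      rw [nsmul_eq_mul] at this
      linarith
    · obtain ⟨X, hX, hXk⟩ := Finset.exists_subset_card_eq h3
      obtain ⟨h4, h5⟩ := hkey X (hX.trans (Finset.filter_subset _ _))
      refine ⟨(v, X, 1), by simp [Finset.mem_powersetCard, hXk], h4, h5, ?_⟩
      dsimp only
      rw [hcnt]
      have : X.card • ((1 + β) * d) ≤ ∑ x ∈ X, ((nb (gr A) x).card : ℝ) :=
        Finset.card_nsmul_le_sum _ _ _ fun x hx => (Finset.mem_filter.1 (hX hx)).2.le
      rw [nsmul_eq_mul] at this
      linarith
  refine h1.trans ((Pr_exists_le _ _).trans ?_)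
  have h2 : ∀ z ∈ (Finset.univ : Finset (Fin n)) ×ˢ
        ((Finset.univ : Finset (Fin n)).powersetCard k) ×ˢ ({1, -1} : Finset ℝ),
      Pr m (fun A => z.1 ∉ z.2.1 ∧ star z.1 z.2.1 ⊆ A ∧
        z.2.2 * ((1 + z.2.2 * β) * d * z.2.1.card) ≤
          z.2.2 * cnt (gr A) (z.2.1 ×ˢ Finset.univ)) ≤
      (p * Real.exp 3) ^ k * Real.exp (-(β ^ 2 / 8) * d * k) := by
    rintro ⟨v, X, θ⟩ hz
    simp only [Finset.mem_product, Finset.mem_univ, true_and, Finset.mem_powersetCard,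
      Finset.subset_univ, Finset.mem_insert, Finset.mem_singleton] at hz
    dsimp only
    by_cases hv : v ∈ X
    · rw [Pr_eq_zero (fun A _ h => h.1 hv)]
      positivity
    · have := Pr_star hn hm0 hm hβ hβ1 hz.2 hv
      rw [hz.1] at this ⊢
      exact (Pr_mono fun A _ h => h.2).trans this
  refine (Finset.sum_le_card_nsmul _ _ _ h2).trans ?_
  rw [nsmul_eq_mul, Finset.card_product, Finset.card_product, Finset.card_powersetCard,
    Finset.card_univ, Fintype.card_fin]
  have hc2 : ((({1, -1} : Finset ℝ).card : ℕ) : ℝ) = 2 := by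
    rw [Finset.card_pair (by norm_num)]; norm_num
  push_cast
  rw [hc2]
  have hch : ((n.choose k : ℕ) : ℝ) ≤ (n : ℝ) ^ k := by exact_mod_cast Nat.choose_le_pow n k
  have hpn : p * n * Real.exp 3 ≤ Real.exp (β ^ 2 * d / 16) := by
    have h3 := edge_prob_mul_le hn m
    rw [← hp, ← hd] at h3
    have h4 := Real.quadratic_le_exp_of_nonneg (by positivity : 0 ≤ β ^ 2 * d / 16)
    have h5 := exp_three_le
    rw [div_le_iff₀ (by positivity)] at hD
    have h6 : p * n * Real.exp 3 ≤ 2 * d * 21 := by gcongr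
    have h7 : 21504 * d ≤ d * β ^ 4 * d := by nlinarith
    have h8 : 0 ≤ β ^ 2 * d / 16 := by positivity
    nlinarith
  calc _ ≤ n * ((n : ℝ) ^ k * 2) * ((p * Real.exp 3) ^ k * Real.exp (-(β ^ 2 / 8) * d * k)) := by
        gcongr
    _ = 2 * n * ((p * n * Real.exp 3) ^ k * Real.exp (-(β ^ 2 / 8) * d * k)) := by
        rw [mul_pow, mul_pow, mul_pow]; ring
    _ ≤ 2 * n * ((Real.exp (β ^ 2 * d / 16)) ^ k * Real.exp (-(β ^ 2 / 8) * d * k)) := by gcongr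
    _ ≤ _ := by
        refine mul_le_mul_of_nonneg_left ?_ (by positivity)
        rw [← Real.exp_nat_mul, ← Real.exp_add, Real.exp_le_exp]
        nlinarith

end Neighbours

section Typical

open scoped Classical

variable {n : ℕ}

lemma card_small_subsets {ι : Type*} [Fintype ι] {s : ℝ} (hs : 0 < s) (hsn : s ≤ Fintype.card ι)
    (k : ℝ) :
    ((((Finset.univ : Finset (Finset ι)).filter (fun F => (F.card : ℝ) ≤ k)).card : ℕ) : ℝ) ≤
      Real.exp (k * Real.log (Fintype.card ι / s) + s) := by
  have hN : (0 : ℝ) < Fintype.card ι := hs.trans_le hsn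
  have h1 := sum_small_subsets (ι := ι) k (div_pos hs hN) ((div_le_one hN).2 hsn) zero_le_one
  simp only [one_pow, Finset.sum_const, nsmul_eq_mul, mul_one] at h1
  refine h1.trans (le_of_eq ?_)
  rw [div_mul_cancel₀ _ hN.ne', Real.log_div hs.ne' hN.ne', Real.log_div hN.ne' hs.ne']
  congr 1; ring

lemma log_le_mul_log_div {s x : ℝ} (hs : 1 ≤ s) (hx : s * Real.exp 1 ≤ x) :
    Real.log x ≤ s * Real.log (x / s) := by
  have hs0 : 0 < s := by linarith
  have hx0 : 0 < x := lt_of_lt_of_le (by positivity) hx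
  rw [Real.log_div hx0.ne' hs0.ne']
  have h1 : Real.log s + 1 ≤ Real.log x := by
    have := Real.log_le_log (by positivity) hx
    rwa [Real.log_mul hs0.ne' (Real.exp_pos 1).ne', Real.log_exp] at this
  have h2 := Real.log_le_sub_one_of_pos hs0
  nlinarith

lemma Pr_small_pair {m : ℕ} (hn : 2 ≤ n) (hm : m ≤ Fintype.card (EdgeType n)) {δ : ℝ}
    (hδ : 0 < δ) {S T : Finset (Fin n)} (hS : S.Nonempty)
    (hSn : 80 / δ ≤ Real.log (n / S.card)) (hT : T.card ≤ 20 * S.card) :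
    Pr m (fun A : Finset (EdgeType n) => δ * (2 * m / n) * S.card ≤ cnt (gr A) (S ×ˢ T)) ≤
      Real.exp (-(δ / 4 * (2 * m / n) * (S.card * Real.log (n / S.card)))) := by
  have hn0 : (0 : ℝ) < n := by exact_mod_cast (by omega : 0 < n)
  set d := 2 * (m : ℝ) / n with hd
  have hd0 : 0 ≤ d := by positivity
  set s : ℝ := ((S.card : ℕ) : ℝ) with hs
  have hs0 : 0 < s := by rw [hs]; exact_mod_cast hS.card_pos
  set ℓ := Real.log (n / s) with hℓ
  have hℓ0 : 0 < ℓ := lt_of_lt_of_le (by positivity) hSn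
  set Q := S ×ˢ T with hQ
  have h1 := Pr_upper hm (fun e : EdgeType n => ℓ / 2 * wt Q e) (ℓ / 2 * (δ * d * s))
  refine (Pr_mono ?_).trans (h1.trans (Real.exp_le_exp.2 ?_))
  · intro A _ h
    rw [← sum_wt] at h
    push_cast at h
    rw [← Finset.mul_sum]
    gcongr
  · have h2 : ∑ e : EdgeType n, (Real.exp (ℓ / 2 * wt Q e) - 1) ≤
        ∑ e : EdgeType n, (n / s / 2) * (wt Q e : ℝ) := by
      refine Finset.sum_le_sum fun e _ => ?_
      have h3 : Real.exp (ℓ / 2) ^ 2 = n / s := by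
        rw [← Real.exp_nat_mul]
        push_cast
        rw [mul_div_cancel₀ _ (two_ne_zero), hℓ, Real.exp_log (by positivity)]
      rw [← h3]
      have h4 := wt_le_two Q e
      rw [mul_comm (ℓ / 2), Real.exp_nat_mul]
      interval_cases wt Q e
      · simp
      · push_cast
        nlinarith [sq_nonneg (Real.exp (ℓ / 2) - 1)]
      · push_cast
        nlinarith
    have h3 : ∑ e : EdgeType n, (wt Q e : ℝ) ≤ 20 * s * s := by
      have : ∑ e : EdgeType n, wt Q e ≤ S.card * (20 * S.card) := by
        rw [sum_wt]
        refine (Finset.card_filter_le _ _).trans ?_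
        rw [hQ, Finset.card_product]
        exact Nat.mul_le_mul_left _ hT
      have h5 : ((∑ e : EdgeType n, wt Q e : ℕ) : ℝ) ≤ s * (20 * s) := by
        rw [hs]; exact_mod_cast this
      push_cast at h5
      linarith
    rw [← Finset.mul_sum] at h2
    have h4 : ∑ e : EdgeType n, (Real.exp (ℓ / 2 * wt Q e) - 1) ≤ n * (10 * s) := by
      refine h2.trans ((mul_le_mul_of_nonneg_left h3 (by positivity)).trans (le_of_eq ?_))
      field_simp
      ring
    have h5 := mul_le_mul_of_nonneg_left h4
      (by positivity : 0 ≤ (m : ℝ) / Fintype.card (EdgeType n))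
    have h6 := mul_le_mul_of_nonneg_right (edge_prob_mul_le hn m) (by positivity : 0 ≤ 10 * s)
    rw [← hd] at h6
    have h7 : 80 ≤ δ * ℓ := by rw [div_le_iff₀ hδ] at hSn; linarith
    have h8 : 80 * (d * s) ≤ δ * ℓ * (d * s) := by gcongr
    nlinarith

/-- Small vertex sets do not span too many edges. -/
lemma Pr_small {m : ℕ} (hn : 2 ≤ n) (hm : m ≤ Fintype.card (EdgeType n)) {δ : ℝ}
    (hδ : 0 < δ) (hδ1 : δ ≤ 1) (hD : 184 / δ ≤ 2 * (m : ℝ) / n) :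
    Pr m (fun A : Finset (EdgeType n) => ¬ ∀ S T : Finset (Fin n), S.Nonempty →
      (S.card : ℝ) ≤ Real.exp (-(80 / δ)) * n → T.card ≤ 20 * S.card →
      ∑ v ∈ S, ((nb (gr A) v ∩ T).card : ℝ) < δ * (2 * m / n) * S.card) ≤
      n * Real.exp (-10 * Real.log n) := by
  have hn0 : (0 : ℝ) < n := by exact_mod_cast (by omega : 0 < n)
  set d := 2 * (m : ℝ) / n with hd
  set I : ℕ → Finset (Finset (Fin n) × Finset (Fin n)) := fun s =>
    ((Finset.univ : Finset (Finset (Fin n))).filter (fun F => (F.card : ℝ) ≤ s)) ×ˢ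
    ((Finset.univ : Finset (Finset (Fin n))).filter (fun F => (F.card : ℝ) ≤ (20 * s : ℝ))) with hI
  have h1 : Pr m (fun A : Finset (EdgeType n) => ¬ ∀ S T : Finset (Fin n), S.Nonempty →
      (S.card : ℝ) ≤ Real.exp (-(80 / δ)) * n → T.card ≤ 20 * S.card →
      ∑ v ∈ S, ((nb (gr A) v ∩ T).card : ℝ) < δ * d * S.card) ≤
      Pr m (fun A => ∃ s ∈ Finset.Icc 1 n, ∃ z ∈ I s, z.1.card = s ∧
        (s : ℝ) ≤ Real.exp (-(80 / δ)) * n ∧ z.2.card ≤ 20 * s ∧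
        δ * d * s ≤ cnt (gr A) (z.1 ×ˢ z.2)) := by
    refine Pr_mono fun A _ h => ?_
    push Not at h
    obtain ⟨S, T, hS, hS1, hT, h2⟩ := h
    refine ⟨S.card, ?_, (S, T), ?_, rfl, hS1, hT, ?_⟩
    · rw [Finset.mem_Icc]
      exact ⟨hS.card_pos, by simpa using S.card_le_univ⟩
    · simp only [hI, Finset.mem_product, Finset.mem_filter, Finset.mem_univ, true_and, le_refl]
      exact_mod_cast hT
    · rw [cnt_product]
      push_cast
      exact h2
  refine h1.trans ((Pr_exists_le _ _).trans ?_)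
  have h2 : ∀ s ∈ Finset.Icc 1 n, Pr m (fun A => ∃ z ∈ I s, z.1.card = s ∧
        (s : ℝ) ≤ Real.exp (-(80 / δ)) * n ∧ z.2.card ≤ 20 * s ∧
        δ * d * s ≤ cnt (gr A) (z.1 ×ˢ z.2)) ≤ Real.exp (-10 * Real.log n) := by
    intro s hs
    rw [Finset.mem_Icc] at hs
    by_cases hsn : (s : ℝ) ≤ Real.exp (-(80 / δ)) * n
    swap
    · rw [Pr_eq_zero fun A _ h => by
        obtain ⟨z, -, -, h3, -⟩ := h
        exact hsn h3]
      positivity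
    have hs1 : (1 : ℝ) ≤ s := by exact_mod_cast hs.1
    have hs0 : (0 : ℝ) < s := by linarith
    set ℓ := Real.log (n / s) with hℓ
    have hℓδ : 80 / δ ≤ ℓ := by
      rw [hℓ, Real.le_log_iff_exp_le (by positivity), le_div_iff₀ hs0]
      rw [Real.exp_neg] at hsn
      have := Real.exp_pos (80 / δ)
      calc Real.exp (80 / δ) * s ≤ Real.exp (80 / δ) * ((Real.exp (80 / δ))⁻¹ * n) := by gcongr
        _ = n := by field_simp
    have hℓ80 : 80 ≤ ℓ := by
      refine le_trans ?_ hℓδ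
      rw [le_div_iff₀ hδ]; linarith
    have hlog : Real.log n ≤ s * ℓ := by
      refine log_le_mul_log_div hs1 ?_
      have h3 : Real.exp 1 ≤ n / s := by
        rw [← Real.le_log_iff_exp_le (by positivity)]; linarith
      rw [le_div_iff₀ hs0] at h3
      linarith
    refine (Pr_exists_le _ _).trans ?_
    have h3 : ∀ z ∈ I s, Pr m (fun A : Finset (EdgeType n) => z.1.card = s ∧
        (s : ℝ) ≤ Real.exp (-(80 / δ)) * n ∧ z.2.card ≤ 20 * s ∧
        δ * d * s ≤ cnt (gr A) (z.1 ×ˢ z.2)) ≤ Real.exp (-(δ / 4 * d * (s * ℓ))) := by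
      rintro ⟨S, T⟩ -
      dsimp only
      by_cases hST : S.card = s ∧ T.card ≤ 20 * s
      · obtain ⟨rfl, hT⟩ := hST
        refine (Pr_mono fun A _ h => h.2.2.2).trans
          (Pr_small_pair hn hm hδ (Finset.card_pos.1 hs.1) hℓδ hT)
      · rw [Pr_eq_zero fun A _ h => hST ⟨h.1, h.2.2.1⟩]
        positivity
    refine (Finset.sum_le_card_nsmul _ _ _ h3).trans ?_
    rw [nsmul_eq_mul, hI, Finset.card_product]
    push_cast
    have hsn' : (s : ℝ) ≤ (Fintype.card (Fin n) : ℝ) := by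
      rw [Fintype.card_fin]; exact_mod_cast hs.2
    have h4 := card_small_subsets (ι := Fin n) hs0 hsn' s
    have h5 := card_small_subsets (ι := Fin n) hs0 hsn' (20 * s)
    rw [Fintype.card_fin, ← hℓ] at h4 h5
    calc _ ≤ Real.exp (s * ℓ + s) * Real.exp (20 * s * ℓ + s) *
          Real.exp (-(δ / 4 * d * (s * ℓ))) := by gcongr
      _ ≤ _ := by
          rw [← Real.exp_add, ← Real.exp_add, Real.exp_le_exp]
          have h6 : 184 ≤ δ * d := by rw [div_le_iff₀ hδ] at hD; linarith
          have h7 : 0 ≤ s * ℓ := by positivity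
          have h8 : 184 * (s * ℓ) ≤ δ * d * (s * ℓ) := by gcongr
          have h9 : s * 80 ≤ s * ℓ := by gcongr
          nlinarith
  refine (Finset.sum_le_card_nsmul _ _ _ h2).trans ?_
  simp

lemma sum_nb_univ [Fintype V] (G : SimpleGraph V) (U : Finset V) :
    (cnt G (U ×ˢ Finset.univ) : ℝ) = ∑ v ∈ U, ((nb G v).card : ℝ) := by
  rw [cnt_product]; push_cast; simp

lemma not_many_above_mean {d γ β ξ N a : ℝ} (hd : 0 < d) (hγ : γ ≤ β * ξ / 4) (hβ : 0 < β)
    (hξ : 0 < ξ) (hN : 0 < N) (ha : 0 ≤ a) (h : ξ / 2 * N < a) (ha' : a ≤ N)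
    (h1 : d * ((1 + β) * a + (1 - γ) * (N - a)) ≤ d * N) : False := by
  have h5 := le_of_mul_le_mul_left h1 hd
  have h6 : γ * (N - a) ≤ β * ξ / 4 * (N - a) := mul_le_mul_of_nonneg_right hγ (by linarith)
  have h7 : β * (ξ / 2 * N) < β * a := mul_lt_mul_of_pos_left h hβ
  have h8 : 0 ≤ β * ξ / 4 * a := by positivity
  have h9 : 0 < β * ξ * N := by positivity
  nlinarith

lemma not_nearly_all_above_mean {d β c N a : ℝ} (hd : 0 < d) (hβ : 0 < β) (hβ1 : β ≤ 1) (hcβ : c ≤ β / 4)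
    (hc : 0 < c) (hN : 0 < N) (h : (1 - c) * N < a) (h1 : d * ((1 + β) * a) ≤ d * N) : False := by
  have h7 := le_of_mul_le_mul_left h1 hd
  have h8 : (1 + β) * ((1 - c) * N) < (1 + β) * a := mul_lt_mul_of_pos_left h (by linarith)
  have h9 : 1 ≤ (1 + β) * (1 - c) := by nlinarith
  nlinarith

/-- Few vertices have atypical degree in a graph without sparse rectangles. -/
lemma card_atypical_le [Fintype V] {G : SimpleGraph V} {d γ c β ξ : ℝ}
    (hd : 0 < d) (hn : 0 < Fintype.card V) (hG : (dc G : ℝ) = Fintype.card V * d)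
    (hγ : γ ≤ β * ξ / 4) (hβ : 0 < β) (hβ1 : β ≤ 1) (hξ : 0 < ξ) (hξ1 : ξ ≤ 1)
    (hcξ : c ≤ ξ / 2) (hcβ : c ≤ β / 4) (hc : 0 < c)
    (h : ∀ U Y : Finset V, c * (Fintype.card V : ℝ) ^ 2 ≤ (U ×ˢ Y).card →
      (1 - γ) * (d / Fintype.card V) * (U ×ˢ Y).card ≤ cnt G (U ×ˢ Y)) :
    ((Finset.univ.filter (fun u => ¬ ((1 - β) * d ≤ (nb G u).card ∧
        ((nb G u).card : ℝ) ≤ (1 + β) * d))).card : ℝ) ≤ ξ * Fintype.card V := by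
  set N : ℝ := ((Fintype.card V : ℕ) : ℝ) with hN
  have hN0 : 0 < N := by rw [hN]; exact_mod_cast hn
  have hrow : ∀ U : Finset V, c * N ≤ U.card →
      (1 - γ) * d * U.card ≤ ∑ v ∈ U, ((nb G v).card : ℝ) := by
    intro U hU
    have h1 := h U Finset.univ (by
      rw [Finset.card_product, Finset.card_univ]
      push_cast
      rw [← hN]
      nlinarith)
    rw [sum_nb_univ, Finset.card_product, Finset.card_univ] at h1
    push_cast at h1
    rw [← hN] at h1
    calc _ = (1 - γ) * (d / N) * (U.card * N) := by field_simp
      _ ≤ _ := h1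
  set L := (Finset.univ : Finset V).filter (fun u => ((nb G u).card : ℝ) < (1 - β) * d) with hL
  set H := (Finset.univ : Finset V).filter (fun u => (1 + β) * d < ((nb G u).card : ℝ)) with hH
  have hLc : (L.card : ℝ) ≤ ξ / 2 * N := by
    by_contra hlt
    push Not at hlt
    have h1 := hrow L (le_trans (by gcongr) hlt.le)
    have h2 : L.Nonempty := by
      rw [← Finset.card_pos]
      have : 0 < ξ / 2 * N := by positivity
      exact_mod_cast this.trans hlt
    have h3 : ∑ v ∈ L, ((nb G v).card : ℝ) < ∑ v ∈ L, (1 - β) * d :=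
      Finset.sum_lt_sum_of_nonempty h2 fun v hv => (Finset.mem_filter.1 hv).2
    rw [Finset.sum_const, nsmul_eq_mul] at h3
    have h4 : γ ≤ β := by nlinarith
    have h5 : (1 - β) * d * L.card ≤ (1 - γ) * d * L.card := by gcongr
    linarith
  have hHc : (H.card : ℝ) ≤ ξ / 2 * N := by
    by_contra hlt
    push Not at hlt
    have htot : ∑ v ∈ H, ((nb G v).card : ℝ) + ∑ v ∈ Hᶜ, ((nb G v).card : ℝ) = N * d := by
      rw [Finset.sum_add_sum_compl, ← hG, dc_eq_sum]; push_cast; rfl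
    have h3 : H.card • ((1 + β) * d) ≤ ∑ v ∈ H, ((nb G v).card : ℝ) :=
      Finset.card_nsmul_le_sum _ _ _ fun v hv => (Finset.mem_filter.1 hv).2.le
    rw [nsmul_eq_mul] at h3
    have hcard : (H.card : ℝ) + (Hᶜ : Finset V).card = N := by
      rw [hN]; exact_mod_cast Finset.card_add_card_compl H
    by_cases hc' : c * N ≤ (Hᶜ : Finset V).card
    · have h1 := hrow Hᶜ hc'
      have hb : ((Hᶜ : Finset V).card : ℝ) = N - H.card := by linarith
      rw [hb] at h1 hc'
      exact not_many_above_mean hd hγ hβ hξ hN0 (Nat.cast_nonneg _) hlt (by nlinarith) (by nlinarith)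
    · push Not at hc'
      have h4 : 0 ≤ ∑ v ∈ Hᶜ, ((nb G v).card : ℝ) :=
        Finset.sum_nonneg fun _ _ => Nat.cast_nonneg _
      exact not_nearly_all_above_mean hd hβ hβ1 hcβ hc hN0 (by linarith : (1 - c) * N < H.card) (by linarith)
  have hsub : (Finset.univ.filter (fun u => ¬ ((1 - β) * d ≤ (nb G u).card ∧
        ((nb G u).card : ℝ) ≤ (1 + β) * d))) ⊆ L ∪ H := by
    intro u hu
    simp only [hL, hH, Finset.mem_union, Finset.mem_filter, Finset.mem_univ, true_and] at hu ⊢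
    by_cases h1 : (1 - β) * d ≤ (nb G u).card
    · right
      by_contra h2
      exact hu ⟨h1, not_lt.1 h2⟩
    · left; exact not_le.1 h1
  have h1 : ((Finset.univ.filter (fun u => ¬ ((1 - β) * d ≤ (nb G u).card ∧
        ((nb G u).card : ℝ) ≤ (1 + β) * d))).card : ℝ) ≤ L.card + H.card := by
    exact_mod_cast (Finset.card_le_card hsub).trans (Finset.card_union_le _ _)
  linarith

end Typical

section Fixed

open scoped Classical

/-- Vertices whose degree is less than `δ₀` times the average degree. -/
def low {n : ℕ} (G : SimpleGraph (Fin n)) (δ₀ d : ℝ) : Finset (Fin n) :=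
  Finset.univ.filter (fun v => ((nb G v).card : ℝ) < δ₀ * d)

lemma add_one_le_exp_nat (n : ℕ) : (n : ℝ) + 1 ≤ Real.exp n := Real.add_one_le_exp _

lemma two_pow_le_exp (n : ℕ) : (2 : ℝ) ^ n ≤ Real.exp n := by
  have h := Real.add_one_le_exp 1
  calc (2 : ℝ) ^ n ≤ (Real.exp 1) ^ n := by gcongr; linarith
    _ = _ := by rw [← Real.exp_nat_mul, mul_one]

lemma eventually_small : ∀ᶠ n : ℕ in atTop, (2 * n * Real.exp (-10 * Real.log n) +
    (n * Real.exp (-10 * Real.log n) + (Real.exp (-(n : ℝ)) + (Real.exp (-(n : ℝ)) +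
      Real.exp (-(n : ℝ))))) : ℝ) ≤ ((n : ℝ) ^ 4)⁻¹ := by
  have h1 := (Real.tendsto_pow_mul_exp_neg_atTop_nhds_zero 4).comp tendsto_natCast_atTop_atTop
  have h2 := h1.eventually (ge_mem_nhds (by norm_num : (0 : ℝ) < 1 / 6))
  filter_upwards [h2, eventually_ge_atTop 2] with n h3 hn
  have hn' : (2 : ℝ) ≤ n := by exact_mod_cast hn
  have hn0 : (0 : ℝ) < n := by linarith
  have h4 : Real.exp (-10 * Real.log n) = ((n : ℝ) ^ 10)⁻¹ := by
    rw [show -10 * Real.log n = -((10 : ℕ) * Real.log n) by push_cast; ring, Real.exp_neg,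
      Real.exp_nat_mul, Real.exp_log hn0]
  simp only [Function.comp_apply] at h3
  have h5 : n * Real.exp (-10 * Real.log n) ≤ 1 / 6 * ((n : ℝ) ^ 4)⁻¹ := by
    rw [h4, ← div_eq_mul_inv, ← div_eq_mul_inv, div_le_div_iff₀ (by positivity) (by positivity)]
    have h6 : (2 : ℝ) ^ 5 ≤ (n : ℝ) ^ 5 := by gcongr
    have h7 : 0 < (n : ℝ) ^ 5 := by positivity
    nlinarith [mul_le_mul_of_nonneg_left h6 h7.le]
  have h6 : Real.exp (-(n : ℝ)) ≤ 1 / 6 * ((n : ℝ) ^ 4)⁻¹ := by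
    rw [← div_eq_mul_inv, le_div_iff₀ (by positivity)]
    linarith
  linarith

set_option maxHeartbeats 1000000 in
/-- For a fixed number of edges, resilience of the 2-core fails with small probability unless
some small configuration around vertices of low degree is present. -/
theorem Pr_not_resilient {ε : ℝ} (hε : 0 < ε) (hε1 : ε ≤ 1 / 10) : ∃ β : ℝ, ∃ K : ℕ, 0 < β ∧ 0 < K ∧
    ∀ δ₀ : ℝ, 0 < δ₀ → δ₀ ≤ 1 / 2 → ∀ᶠ n : ℕ in atTop, ∀ m ≤ Fintype.card (EdgeType n),
      Real.log n / 3 ≤ 2 * (m : ℝ) / n →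
      Pr m (fun A : Finset (EdgeType n) =>
        ¬ ((∀ T' ⊆ low (gr A) δ₀ (2 * m / n), Spread (gr A) T') →
          StrongResilient (twoCore (gr A)) (1 / 2 - ε) (δ₀ / 4) 2 (4 * β) K IsHam)) ≤
        ((n : ℝ) ^ 4)⁻¹ := by
  set γ := ε / 4 with hγ
  obtain ⟨η, D₁, n₁, hη, hη1, hD₁, hn₁, hboost⟩ := Pr_not_boost (γ := γ) (c := 1 / 72)
    (by positivity) (by linarith) (by norm_num)
  set δ := η / 8 with hδ
  have hδ0 : 0 < δ := by positivity
  set δ₂ := Real.exp (-(80 / δ)) with hδ₂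
  have hδ₂0 : 0 < δ₂ := Real.exp_pos _
  have hδ₂1 : δ₂ ≤ 1 := Real.exp_le_one_iff.2 (by simp only [Left.neg_nonpos_iff]; positivity)
  set κ := min (δ₂ * (ε / 2) / 8) (1 / 18 * (ε / 2) / 8) with hκ
  have hκ0 : 0 < κ := lt_min (by positivity) (by positivity)
  set β := min (ε / 4) (κ / 2) with hβ
  have hβ0 : 0 < β := lt_min (by positivity) (by positivity)
  have hβε : β ≤ ε / 4 := min_le_left _ _
  have hβκ : β ≤ κ / 2 := min_le_right _ _
  set ξ := β / 8 with hξ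
  have hξ0 : 0 < ξ := by positivity
  obtain ⟨k, hk⟩ := exists_nat_ge (480 / β ^ 2)
  have hk' : 480 ≤ β ^ 2 * k := by rw [div_le_iff₀ (by positivity)] at hk; linarith
  have hk0 : 0 < k := by
    rcases Nat.eq_zero_or_pos k with h | h
    · rw [h] at hk'; norm_num at hk'
    · exact h
  set c := min (δ₂ / 4) (β / 16) with hc
  have hc0 : 0 < c := lt_min (by positivity) (by positivity)
  have hcδ : c ≤ δ₂ / 4 := min_le_left _ _
  have hcβ : c ≤ β / 16 := min_le_right _ _
  set γ' := β * ξ / 4 with hγ'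
  have hγ'0 : 0 < γ' := by positivity
  have hγ'γ : γ' ≤ γ := by rw [hγ', hγ, hξ]; nlinarith
  obtain ⟨η', D₂, n₂, hη', -, hD₂, hn₂, hrects⟩ := Pr_not_boost (γ := γ') (c := c)
    hγ'0 (by linarith) hc0
  refine ⟨β, 20 * (2 * k) + 4, hβ0, by omega, ?_⟩
  intro δ₀ hδ₀ hδ₀1
  set D := D₁ + D₂ + 21504 / β ^ 4 + 184 / δ + (2 * ((20 * (2 * k) + 4 : ℕ) : ℝ) + 8) / δ₀ + 24 / β +
    2 * (20 * ((2 * k : ℕ) : ℝ) + 9 + (2 / (δ₂ * (ε / 2) / 8) + 2 / (1 / 18 * (ε / 2) / 8))) / (η / 2)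
    with hD
  have hlogt : Tendsto (fun n : ℕ => Real.log n / 3) atTop atTop :=
    (Real.tendsto_log_atTop.comp tendsto_natCast_atTop_atTop).atTop_div_const (by norm_num)
  filter_upwards [hlogt.eventually_ge_atTop D, eventually_ge_atTop 10, eventually_small,
    tendsto_natCast_atTop_atTop.eventually_ge_atTop (n₁ + n₂ + 1 / ξ)] with n hnD hn10 hsmall hnn
  intro m hm hlog
  have hn2 : 2 ≤ n := by omega
  have hn0 : (0 : ℝ) < n := by exact_mod_cast (by omega : 0 < n)
  set d := 2 * (m : ℝ) / n with hd
  have hDd : D ≤ d := hnD.trans hlog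
  have p1 : 0 < 21504 / β ^ 4 := by positivity
  have p2 : 0 < 184 / δ := by positivity
  have p3 : 0 < (2 * ((20 * (2 * k) + 4 : ℕ) : ℝ) + 8) / δ₀ := by positivity
  have p4 : 0 < 24 / β := by positivity
  have p5 : 0 < 2 * (20 * ((2 * k : ℕ) : ℝ) + 9 + (2 / (δ₂ * (ε / 2) / 8) +
    2 / (1 / 18 * (ε / 2) / 8))) / (η / 2) := by positivity
  have p6 : 0 < 1 / ξ := by positivity
  have hd0 : 0 < d := by linarith
  have hcon : Consts ε γ κ δ δ₂ η β ξ δ₀ (2 * k) (20 * (2 * k) + 4) d :=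
    { εpos := hε, εle := hε1, γle := le_rfl, κle₁ := min_le_left _ _, κle₂ := min_le_right _ _
      δpos := hδ0, δle := by linarith, δη := by linarith, δ₂pos := hδ₂0, δ₂le := hδ₂1
      βpos := hβ0, βle := hβε, βκ := by linarith, ξpos := hξ0, ξle := le_rfl
      δ₀pos := hδ₀, δ₀le := hδ₀1, K'pos := by omega, hK := le_rfl
      d₁ := by
        have : (2 * ((20 * (2 * k) + 4 : ℕ) : ℝ) + 8) / δ₀ ≤ d := by linarith
        rw [div_le_iff₀ hδ₀] at this; linarith
      d₂ := by
        have : 24 / β ≤ d := by linarith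
        rw [div_le_iff₀ hβ0] at this; linarith
      d₃ := by
        have : 2 * (20 * ((2 * k : ℕ) : ℝ) + 9 + (2 / (δ₂ * (ε / 2) / 8) +
          2 / (1 / 18 * (ε / 2) / 8))) / (η / 2) ≤ d := by linarith
        rw [div_le_iff₀ (by positivity)] at this; linarith }
  have e1 := Pr_nbr hn2 hm hβ0 (by linarith) hk' (by linarith : 21504 / β ^ 4 ≤ d) hlog
  have e2 := Pr_small hn2 hm hδ0 (by linarith) (by linarith : 184 / δ ≤ d)
  have e3 := hboost n m (by linarith) hm (by linarith) (Fin (Fintype.card (Fin n) + 1) × Fin n ×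
    Finset (Fin n)) (by
      simp only [Fintype.card_prod, Fintype.card_fin, Fintype.card_finset]
      push_cast
      have a1 := add_one_le_exp_nat n
      have a2 : (n : ℝ) ≤ Real.exp n := by linarith
      have a3 := two_pow_le_exp n
      calc ((n : ℝ) + 1) * (n * 2 ^ n) ≤ Real.exp n * (Real.exp n * Real.exp n) := by gcongr
        _ = Real.exp (3 * n) := by rw [← Real.exp_add, ← Real.exp_add]; congr 1; ring
        _ ≤ _ := Real.exp_le_exp.2 (by linarith)) rotPairs
  have e4 := hboost n m (by linarith) hm (by linarith) (Fin (Fintype.card (Fin n) + 1)) (by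
      simp only [Fintype.card_fin]
      push_cast
      exact (add_one_le_exp_nat n).trans (Real.exp_le_exp.2 (by linarith))) closePairs
  have e5 := hrects n m (by linarith) hm (by linarith) (Finset (Fin n) × Finset (Fin n)) (by
      simp only [Fintype.card_prod, Fintype.card_fin, Fintype.card_finset]
      push_cast
      have a3 := two_pow_le_exp n
      calc (2 : ℝ) ^ n * 2 ^ n ≤ Real.exp n * Real.exp n := by gcongr
        _ = Real.exp (2 * n) := by rw [← Real.exp_add]; congr 1; ring
        _ ≤ _ := Real.exp_le_exp.2 (by linarith)) (fun _ i => i.1 ×ˢ i.2)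
  rw [← hd] at e1 e2 e3 e4 e5
  refine le_trans ?_ (le_trans (add_le_add e1 (add_le_add e2 (add_le_add e3 (add_le_add e4 e5)))) hsmall)
  refine le_trans (Pr_mono ?_) ((Pr_or_le _ _).trans (add_le_add_right ((Pr_or_le _ _).trans
    (add_le_add_right ((Pr_or_le _ _).trans (add_le_add_right (Pr_or_le _ _) _)) _)) _))
  intro A hA hbad
  by_contra hgood
  simp only [not_or, not_not] at hgood
  obtain ⟨g1, g2, g3, g4, g5⟩ := hgood
  refine hbad fun hspread => ?_
  have hedges : (dc (gr A) : ℝ) = Fintype.card (Fin n) * d := by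
    rw [dc_gr, hA, Fintype.card_fin, hd]; push_cast; field_simp
  have hrect : ∀ U Y : Finset (Fin n), c * (Fintype.card (Fin n) : ℝ) ^ 2 ≤ (U ×ˢ Y).card →
      (1 - γ') * (d / Fintype.card (Fin n)) * (U ×ˢ Y).card ≤ cnt (gr A) (U ×ˢ Y) := by
    intro U Y h
    refine g5 ⊥ bot_le ?_ (U, Y) h
    have : dc (⊥ : SimpleGraph (Fin n)) = 0 := by simp [dc, cnt]
    rw [this]; push_cast; positivity
  refine Good.resilient (A := Finset.univ.filter (fun u => ¬ ((1 - β) * d ≤ (nb (gr A) u).card ∧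
        ((nb (gr A) u).card : ℝ) ≤ (1 + β) * d))) (T := low (gr A) δ₀ d) ?_ hcon
  exact
    { edges := hedges
      typ := fun v hv => by simpa using hv
      Acard := card_atypical_le hd0 (by simp; omega) hedges le_rfl hβ0 (by linarith) hξ0
        (by linarith) (by linarith) (by linarith) hc0 hrect
      nbr := fun v => by convert g1 v
      small := fun S T h1 h2 h3 => by
        rw [Fintype.card_fin] at h2
        convert g2 S T h1 h2 h3
      rect := fun U Y h1 h2 => by
        have h3 : c * (Fintype.card (Fin n) : ℝ) ^ 2 ≤ (U ×ˢ Y).card := by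
          rw [Finset.card_product]
          push_cast
          rw [Fintype.card_fin] at *
          calc c * (n : ℝ) ^ 2 ≤ δ₂ / 4 * n ^ 2 := by gcongr
            _ = δ₂ * n * (1 / 4 * n) := by ring
            _ ≤ U.card * ((1 / 2 - ε / 2 / 2) * n) := by gcongr; linarith
            _ ≤ _ := by gcongr
        refine le_trans ?_ (hrect U Y h3)
        gcongr
      boost₂ := by convert g3
      boost₃ := by convert g4
      high := fun v hv => by simpa [low] using hv
      low := fun v hv => by simpa [low] using hv
      spread := hspread
      npos := by simpa using hn10
      nξ := by
        rw [Fintype.card_fin]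
        have : 1 / ξ ≤ n := by linarith
        rw [div_le_iff₀ hξ0] at this; linarith }

end Fixed

section EdgeOrderings

open scoped Classical

variable {n : ℕ}

/-- The first `m` edges of the process. -/
def pre (σ : ProcessSpace n) (m : ℕ) : Finset (EdgeType n) :=
  Finset.univ.filter (fun e => ((σ.symm e : Fin _) : ℕ) < m)

lemma mem_pre {σ : ProcessSpace n} {m : ℕ} {e : EdgeType n} :
    e ∈ pre σ m ↔ ((σ.symm e : Fin _) : ℕ) < m := by simp [pre]

lemma pre_mono (σ : ProcessSpace n) {m m' : ℕ} (h : m ≤ m') : pre σ m ⊆ pre σ m' := by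
  intro e he
  rw [mem_pre] at he ⊢
  omega

lemma card_pre (σ : ProcessSpace n) {m : ℕ} (hm : m ≤ Fintype.card (EdgeType n)) :
    (pre σ m).card = m := by
  have h : (pre σ m).card = ((Finset.univ : Finset (Fin (Fintype.card (EdgeType n)))).filter
      (fun i : Fin (Fintype.card (EdgeType n)) => (i : ℕ) < m)).card := by
    refine Finset.card_bij (fun e _ => σ.symm e) ?_ ?_ ?_
    · intro e he; simpa using mem_pre.1 he
    · intro a _ b _ hab; exact σ.symm.injective hab
    · intro i hi
      exact ⟨σ i, mem_pre.2 (by simpa using hi), by simp⟩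
  rw [h, Fin.card_filter_val_lt, min_eq_right hm]

lemma processGraph_eq (σ : ProcessSpace n) (m : ℕ) : processGraph σ m = gr (pre σ m) := by
  ext u v
  rw [processGraph, gr_adj, SimpleGraph.fromEdgeSet_adj]
  constructor
  · rintro ⟨⟨i, hi, h⟩, huv⟩
    refine ⟨by simpa using huv, mem_pre.2 ?_⟩
    have : (⟨s(u, v), by simpa using huv⟩ : EdgeType n) = σ i := Subtype.ext h.symm
    rw [this, Equiv.symm_apply_apply]
    exact hi
  · rintro ⟨h1, h2⟩
    refine ⟨⟨σ.symm ⟨s(u, v), h1⟩, mem_pre.1 h2, by simp⟩, by simpa using h1⟩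

lemma processGraph_cap (σ : ProcessSpace n) (m : ℕ) :
    processGraph σ m = gr (pre σ (min m (Fintype.card (EdgeType n)))) := by
  rw [processGraph_eq]
  congr 1
  ext e
  rw [mem_pre, mem_pre]
  have := (σ.symm e).2
  omega

/-- The probability of an event for the random graph process. -/
def PP (S : ProcessSpace n → Prop) : ℝ :=
  ((Finset.univ.filter S).card : ℝ) / Fintype.card (ProcessSpace n)

lemma card_processSpace_pos (n : ℕ) : 0 < Fintype.card (ProcessSpace n) :=
  Fintype.card_pos_iff.2 ⟨(Fintype.equivFin (EdgeType n)).symm⟩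

lemma PP_def (S : ProcessSpace n → Prop) [DecidablePred S] :
    PP S = ((Finset.univ.filter S).card : ℝ) / Fintype.card (ProcessSpace n) := by
  unfold PP
  congr!

lemma PP_nonneg (S : ProcessSpace n → Prop) : 0 ≤ PP S := by unfold PP; positivity

lemma PP_mono {S S' : ProcessSpace n → Prop} (h : ∀ σ, S σ → S' σ) : PP S ≤ PP S' := by
  refine div_le_div_of_nonneg_right ?_ (Nat.cast_nonneg _)
  norm_cast
  refine Finset.card_le_card fun σ hσ => ?_
  simp only [Finset.mem_filter, Finset.mem_univ, true_and] at hσ ⊢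
  exact h σ hσ

lemma PP_exists_le {κ : Type*} (I : Finset κ) (S : κ → ProcessSpace n → Prop) :
    PP (fun σ => ∃ i ∈ I, S i σ) ≤ ∑ i ∈ I, PP (S i) := by
  unfold PP
  rw [← Finset.sum_div]
  gcongr
  norm_cast
  refine (Finset.card_le_card ?_).trans (Finset.card_biUnion_le (s := I)
    (t := fun i => Finset.univ.filter (S i)))
  intro σ hσ
  simp only [Finset.mem_filter, Finset.mem_biUnion, Finset.mem_univ, true_and] at hσ ⊢
  exact hσ

lemma PP_or_le (S S' : ProcessSpace n → Prop) : PP (fun σ => S σ ∨ S' σ) ≤ PP S + PP S' := by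
  unfold PP
  rw [← add_div]
  gcongr
  norm_cast
  refine (Finset.card_le_card fun A hA => ?_).trans (Finset.card_union_le _ _)
  simp only [Finset.mem_filter, Finset.mem_union] at hA ⊢
  tauto

lemma processMeasure_apply (S : ProcessSpace n → Prop) :
    processMeasure n {σ | S σ} = ENNReal.ofReal (PP S) := by
  have h1 : (Measure.sum (fun σ : ProcessSpace n => Measure.dirac σ)) {σ | S σ} =
      ((Finset.univ.filter S).card : ℝ≥0∞) := by
    rw [Measure.sum_apply _ (MeasurableSpace.measurableSet_top), tsum_fintype, Finset.card_filter]
    push_cast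
    refine Finset.sum_congr rfl fun σ _ => ?_
    rw [Measure.dirac_apply' _ (MeasurableSpace.measurableSet_top)]
    simp [Set.indicator_apply]
  rw [processMeasure, Measure.smul_apply, h1, PP, smul_eq_mul,
    ENNReal.ofReal_div_of_pos (by exact_mod_cast card_processSpace_pos n), mul_comm,
    ENNReal.div_eq_inv_mul, ENNReal.ofReal_natCast, ENNReal.ofReal_natCast, mul_comm]

lemma PP_not (S : ProcessSpace n → Prop) : PP S = 1 - PP (fun σ => ¬ S σ) := by
  have h : (0 : ℝ) < Fintype.card (ProcessSpace n) := by exact_mod_cast card_processSpace_pos n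
  unfold PP
  rw [eq_sub_iff_add_eq, ← add_div, div_eq_one_iff_eq h.ne']
  norm_cast
  rw [Finset.card_filter_add_card_filter_not, Finset.card_univ]

lemma card_fiber_eq {m : ℕ} {A B : Finset (EdgeType n)} (h : A.card = B.card) :
    ((Finset.univ : Finset (ProcessSpace n)).filter (fun σ => pre σ m = A)).card ≤
    ((Finset.univ : Finset (ProcessSpace n)).filter (fun σ => pre σ m = B)).card := by
  let e : {x // x ∈ A} ≃ {x // x ∈ B} := Finset.equivOfCardEq h
  let π : Equiv.Perm (EdgeType n) := e.extendSubtype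
  have hπ : ∀ x, x ∈ A ↔ π x ∈ B := by
    intro x
    constructor
    · intro hx; exact e.extendSubtype_mem x hx
    · intro hx
      by_contra h'
      exact e.extendSubtype_not_mem x h' hx
  refine Finset.card_le_card_of_injOn (fun σ => σ.trans π) ?_ ?_
  · intro σ hσ
    simp only [Finset.coe_filter, Finset.mem_univ, true_and, Set.mem_ofPred_eq] at hσ ⊢
    ext x
    rw [mem_pre, Equiv.symm_trans_apply, ← mem_pre, hσ, hπ, Equiv.apply_symm_apply]
  · intro σ _ τ _ hστ
    ext i
    have := congrArg (fun f : ProcessSpace n => f i) hστ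
    simp only [Equiv.trans_apply, EmbeddingLike.apply_eq_iff_eq] at this
    rw [this]

/-- The first `m` edges of the process form a uniformly random `m`-set. -/
lemma PP_pre {m : ℕ} (hm : m ≤ Fintype.card (EdgeType n)) (S : Finset (EdgeType n) → Prop) :
    PP (fun σ => S (pre σ m)) = Pr m S := by
  obtain ⟨A₀, hA₀⟩ := Finset.powersetCard_nonempty.2
    (by rwa [Finset.card_univ] : m ≤ (Finset.univ : Finset (EdgeType n)).card)
  rw [Finset.mem_powersetCard] at hA₀
  set c := ((Finset.univ : Finset (ProcessSpace n)).filter (fun σ => pre σ m = A₀)).card with hc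
  have hfib : ∀ S : Finset (EdgeType n) → Prop,
      ((Finset.univ : Finset (ProcessSpace n)).filter (fun σ => S (pre σ m))).card =
      (((Finset.univ : Finset (EdgeType n)).powersetCard m).filter S).card * c := by
    intro S
    rw [Finset.card_eq_sum_card_fiberwise (f := fun σ => pre σ m)
      (t := ((Finset.univ : Finset (EdgeType n)).powersetCard m).filter S)]
    · rw [Finset.sum_const_nat]
      intro A hA
      simp only [Finset.mem_filter, Finset.mem_powersetCard] at hA
      have h1 : ((Finset.univ : Finset (ProcessSpace n)).filter (fun σ => S (pre σ m))).filter
          (fun σ => pre σ m = A) = Finset.univ.filter (fun σ => pre σ m = A) := by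
        ext σ
        simp only [Finset.mem_filter, Finset.mem_univ, true_and, and_iff_right_iff_imp]
        intro h; rw [h]; exact hA.2
      rw [h1]
      have h2 := hA.1.2.trans hA₀.2.symm
      exact le_antisymm (card_fiber_eq h2) (card_fiber_eq h2.symm)
    · intro σ hσ
      simp only [Finset.coe_filter, Finset.mem_univ, true_and, Set.mem_ofPred_eq,
        Finset.mem_powersetCard, Finset.subset_univ] at hσ ⊢
      exact ⟨card_pre σ hm, hσ⟩
  have htot := hfib (fun _ => True)
  simp only [Finset.filter_true, Finset.card_univ, Finset.card_powersetCard] at htot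
  have hpos := card_processSpace_pos n
  have hc0 : 0 < c := by
    rcases Nat.eq_zero_or_pos c with h | h
    · rw [h, mul_zero] at htot; omega
    · exact h
  unfold PP Pr
  rw [hfib, htot]
  push_cast
  rw [mul_div_mul_right]
  exact_mod_cast hc0.ne'

/-- Revealing that an edge appears between two times costs at most the density at the later
time. -/
lemma card_between_le {m₀ m₁ : ℕ} (h01 : m₀ ≤ m₁) (hm₁ : m₁ ≤ Fintype.card (EdgeType n))
    (L : Finset (EdgeType n) → Prop) (F : Finset (EdgeType n)) (e₀ : EdgeType n)
    (he₀ : e₀ ∉ F) :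
    ((Finset.univ : Finset (ProcessSpace n)).filter (fun σ => L (pre σ m₀) ∧
      (∀ e ∈ insert e₀ F, m₀ ≤ (σ.symm e : ℕ) ∧ (σ.symm e : ℕ) < m₁))).card *
        Fintype.card (EdgeType n) ≤
    ((Finset.univ : Finset (ProcessSpace n)).filter (fun σ => L (pre σ m₀) ∧
      (∀ e ∈ F, m₀ ≤ (σ.symm e : ℕ) ∧ (σ.symm e : ℕ) < m₁))).card * m₁ := by
  set N := Fintype.card (EdgeType n) with hN
  set X := (Finset.univ : Finset (ProcessSpace n)).filter (fun σ => L (pre σ m₀) ∧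
      (∀ e ∈ insert e₀ F, m₀ ≤ (σ.symm e : ℕ) ∧ (σ.symm e : ℕ) < m₁)) with hX
  set Y := (Finset.univ : Finset (ProcessSpace n)).filter (fun σ => L (pre σ m₀) ∧
      (∀ e ∈ F, m₀ ≤ (σ.symm e : ℕ) ∧ (σ.symm e : ℕ) < m₁)) with hY
  set J := (Finset.univ : Finset (Fin N)).filter (fun j : Fin N => m₀ ≤ (j : ℕ)) with hJ
  set I := (Finset.univ : Finset (Fin N)).filter (fun j : Fin N => m₀ ≤ (j : ℕ) ∧ (j : ℕ) < m₁) with hI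
  have hJc : J.card + m₀ = N := by
    have h1 := Finset.card_filter_add_card_filter_not (s := (Finset.univ : Finset (Fin N)))
      (fun j : Fin N => (j : ℕ) < m₀)
    rw [Fin.card_filter_val_lt, Finset.card_univ, Fintype.card_fin,
      min_eq_right (h01.trans hm₁)] at h1
    simp only [not_lt] at h1
    rw [← hJ] at h1
    omega
  have hIc : I.card + m₀ = m₁ := by
    have h1 := Finset.card_filter_add_card_filter_not
      (s := (Finset.univ : Finset (Fin N)).filter (fun j : Fin N => (j : ℕ) < m₁)) (fun j : Fin N => (j : ℕ) < m₀)
    rw [Finset.filter_filter, Finset.filter_filter, Fin.card_filter_val_lt, min_eq_right hm₁] at h1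
    have h2 : (Finset.univ : Finset (Fin N)).filter (fun j : Fin N => (j : ℕ) < m₁ ∧ (j : ℕ) < m₀) =
        (Finset.univ : Finset (Fin N)).filter (fun j : Fin N => (j : ℕ) < m₀) := by
      ext j; simp; omega
    have h3 : (Finset.univ : Finset (Fin N)).filter (fun j : Fin N => (j : ℕ) < m₁ ∧ ¬ (j : ℕ) < m₀) = I := by
      ext j; simp [hI]; omega
    rw [h2, h3, Fin.card_filter_val_lt, min_eq_right (h01.trans hm₁)] at h1
    omega
  have hXY : X.card ≤ Y.card := by
    refine Finset.card_le_card fun σ hσ => ?_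
    simp only [hX, hY, Finset.mem_filter, Finset.mem_univ, true_and] at hσ ⊢
    exact ⟨hσ.1, fun e he => hσ.2 e (Finset.mem_insert_of_mem he)⟩
  have hswap : (X ×ˢ J).card ≤ (Y ×ˢ I).card := by
    refine Finset.card_le_card_of_injOn
      (fun z => ((Equiv.swap (z.1.symm e₀) z.2).trans z.1, z.1.symm e₀)) ?_ ?_
    · rintro ⟨σ, j⟩ hz
      simp only [Finset.coe_product, Set.mem_prod, Finset.mem_coe, hX, hJ, Finset.mem_filter,
        Finset.mem_univ, true_and] at hz
      obtain ⟨⟨hL, hF⟩, hj⟩ := hz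
      have h0 := hF e₀ (Finset.mem_insert_self _ _)
      have hpos : ∀ e, ((((Equiv.swap (σ.symm e₀) j).trans σ).symm e : Fin N) : ℕ) =
          if σ.symm e = σ.symm e₀ then (j : ℕ) else if σ.symm e = j then (σ.symm e₀ : ℕ)
            else (σ.symm e : ℕ) := by
        intro e
        rw [Equiv.symm_trans_apply, Equiv.symm_swap, Equiv.swap_apply_def]
        split_ifs <;> rfl
      have hpre : pre ((Equiv.swap (σ.symm e₀) j).trans σ) m₀ = pre σ m₀ := by
        ext e
        rw [mem_pre, mem_pre, hpos]
        split_ifs with h1 h2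
        · rw [h1]; omega
        · rw [h2]; omega
        · rfl
      simp only [Finset.coe_product, Set.mem_prod, Finset.mem_coe, hY, hI, Finset.mem_filter,
        Finset.mem_univ, true_and]
      refine ⟨⟨by rw [hpre]; exact hL, fun e he => ?_⟩, h0⟩
      rw [hpos]
      have h1 := hF e (Finset.mem_insert_of_mem he)
      split_ifs with h2 h3
      · exact absurd (σ.symm.injective h2 ▸ he) he₀
      · exact h0
      · exact h1
    · rintro ⟨σ, j⟩ _ ⟨τ, k⟩ _ h
      simp only [Prod.mk.injEq] at h
      obtain ⟨h1, h2⟩ := h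
      have h3 := congrArg (fun f : ProcessSpace n => f.symm e₀) h1
      simp only [Equiv.symm_trans_apply, Equiv.symm_swap, Equiv.swap_apply_left] at h3
      subst h3
      rw [h2] at h1
      have h4 : σ = τ := by
        ext i
        have := congrArg (fun f : ProcessSpace n => f (Equiv.swap (τ.symm e₀) j i)) h1
        simp only [Equiv.trans_apply, Equiv.swap_apply_self] at this
        rw [this]
      rw [h4]
  rw [Finset.card_product, Finset.card_product] at hswap
  calc X.card * N = X.card * J.card + X.card * m₀ := by rw [← mul_add, hJc]
    _ ≤ Y.card * I.card + Y.card * m₀ := by gcongr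
    _ = _ := by rw [← mul_add, hIc]

end EdgeOrderings

section Configurations

open scoped Classical

variable {n : ℕ}

/-- Revealing that a set of edges appears between two times costs at most the density at the
later time for each edge. -/
lemma PP_between {m₀ m₁ : ℕ} (h01 : m₀ ≤ m₁) (hm₁ : m₁ ≤ Fintype.card (EdgeType n))
    (L : Finset (EdgeType n) → Prop) (F : Finset (EdgeType n)) :
    PP (fun σ : ProcessSpace n => L (pre σ m₀) ∧
      (∀ e ∈ F, m₀ ≤ (σ.symm e : ℕ) ∧ (σ.symm e : ℕ) < m₁)) ≤
    ((m₁ : ℝ) / Fintype.card (EdgeType n)) ^ F.card * PP (fun σ : ProcessSpace n => L (pre σ m₀)) := by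
  induction F using Finset.induction_on with
  | empty => simp
  | insert e₀ F he₀ ih =>
    have h := card_between_le h01 hm₁ L F e₀ he₀
    have hN : 0 < Fintype.card (EdgeType n) := Fintype.card_pos_iff.2 ⟨e₀⟩
    have hN' : (0 : ℝ) < Fintype.card (EdgeType n) := by exact_mod_cast hN
    have hP : (0 : ℝ) < Fintype.card (ProcessSpace n) := by exact_mod_cast card_processSpace_pos n
    rw [Finset.card_insert_of_notMem he₀, pow_succ, mul_right_comm]
    refine le_trans ?_ (mul_le_mul_of_nonneg_right ih (by positivity))
    rw [PP_def, PP_def (fun σ : ProcessSpace n => L (pre σ m₀) ∧ _), div_mul_div_comm, div_le_div_iff₀ hP (by positivity)]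
    have h' := (Nat.cast_le (α := ℝ)).2 h
    rw [Nat.cast_mul, Nat.cast_mul] at h'
    rw [mul_comm (Fintype.card (ProcessSpace n) : ℝ) (Fintype.card (EdgeType n) : ℝ), ← mul_assoc]
    exact mul_le_mul_of_nonneg_right h' hP.le

/-- Planting edges at a later time together with an event at an earlier time. -/
lemma PP_planted {m₀ m₁ : ℕ} (h01 : m₀ ≤ m₁) (hm₁ : m₁ ≤ Fintype.card (EdgeType n))
    (L : Finset (EdgeType n) → Prop) {B : ℝ}
    (hB : ∀ F : Finset (EdgeType n), Pr m₀ (fun A => F ⊆ A ∧ L A) ≤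
      ((m₀ : ℝ) / Fintype.card (EdgeType n) * Real.exp 3) ^ F.card * B) (hB0 : 0 ≤ B)
    (F : Finset (EdgeType n)) :
    PP (fun σ : ProcessSpace n => F ⊆ pre σ m₁ ∧ L (pre σ m₀)) ≤
      (42 * ((m₁ : ℝ) / Fintype.card (EdgeType n))) ^ F.card * B := by
  set p₁ : ℝ := (m₁ : ℝ) / Fintype.card (EdgeType n) with hp₁
  have hp0 : 0 ≤ p₁ := by positivity
  have h3 := exp_three_le
  have h4 : (1 : ℝ) ≤ Real.exp 3 := Real.one_le_exp (by norm_num)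
  have h1 : PP (fun σ : ProcessSpace n => F ⊆ pre σ m₁ ∧ L (pre σ m₀)) ≤
      PP (fun σ : ProcessSpace n => ∃ E ∈ F.powerset, (E ⊆ pre σ m₀ ∧ L (pre σ m₀)) ∧
        ∀ e ∈ F \ E, m₀ ≤ (σ.symm e : ℕ) ∧ (σ.symm e : ℕ) < m₁) := by
    refine PP_mono fun σ hσ => ⟨F ∩ pre σ m₀, by simp, ⟨Finset.inter_subset_right, hσ.2⟩, ?_⟩
    intro e he
    simp only [Finset.mem_sdiff, Finset.mem_inter, mem_pre, not_and, not_lt] at he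
    exact ⟨he.2 he.1, mem_pre.1 (hσ.1 he.1)⟩
  refine h1.trans ((PP_exists_le _ _).trans ?_)
  have h2 : ∀ E ∈ F.powerset, PP (fun σ : ProcessSpace n => (E ⊆ pre σ m₀ ∧ L (pre σ m₀)) ∧
        ∀ e ∈ F \ E, m₀ ≤ (σ.symm e : ℕ) ∧ (σ.symm e : ℕ) < m₁) ≤ (p₁ * Real.exp 3) ^ F.card * B := by
    intro E hE
    rw [Finset.mem_powerset] at hE
    refine (PP_between h01 hm₁ (fun A => E ⊆ A ∧ L A) (F \ E)).trans ?_
    rw [PP_pre (h01.trans hm₁) (fun A => E ⊆ A ∧ L A), ← hp₁]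
    have h5 : p₁ ^ (F \ E).card ≤ (p₁ * Real.exp 3) ^ (F \ E).card := by
      gcongr
      nlinarith
    have h6 : ((m₀ : ℝ) / Fintype.card (EdgeType n) * Real.exp 3) ^ E.card ≤
        (p₁ * Real.exp 3) ^ E.card := by
      rw [hp₁]; gcongr
    calc p₁ ^ (F \ E).card * Pr m₀ (fun A => E ⊆ A ∧ L A)
        ≤ (p₁ * Real.exp 3) ^ (F \ E).card * ((p₁ * Real.exp 3) ^ E.card * B) := by
          refine mul_le_mul h5 ((hB E).trans (mul_le_mul_of_nonneg_right h6 hB0))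
            (Pr_nonneg _ _) (by positivity)
      _ = _ := by rw [← mul_assoc, ← pow_add, Finset.card_sdiff_add_card_eq_card hE]
  refine (Finset.sum_le_sum h2).trans ?_
  rw [Finset.sum_const, Finset.card_powerset, nsmul_eq_mul, ← mul_assoc]
  push_cast
  rw [← mul_pow]
  gcongr ?_ ^ _ * _
  nlinarith

/-- A fixed set of vertices all have small degree, with planted edges. -/
lemma Pr_low_degrees {τ : ℝ} (hτ : 0 < τ) (hτ1 : τ < 1) : ∃ δ : ℝ, 0 < δ ∧ ∀ n : ℕ, 2 ≤ n →
    ∀ m : ℕ, 0 < m → m ≤ Fintype.card (EdgeType n) → ∀ (I : Finset (Fin n)) (F : Finset (EdgeType n)),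
    Pr m (fun A => F ⊆ A ∧ ∀ i ∈ I, ((nb (gr A) i).card : ℝ) < δ * (2 * m / n)) ≤
      ((m : ℝ) / Fintype.card (EdgeType n) * Real.exp 3) ^ F.card *
        Real.exp ((I.card : ℝ) ^ 2 - I.card * ((1 - τ) * (2 * m / n))) := by
  set ℓ := Real.log (2 / τ) with hℓ
  have hℓ0 : 0 < ℓ := Real.log_pos (by rw [lt_div_iff₀ hτ]; linarith)
  have hexp : Real.exp (-ℓ) = τ / 2 := by
    rw [hℓ, Real.exp_neg, Real.exp_log (by positivity), inv_div]
  refine ⟨τ / (2 * ℓ), by positivity, ?_⟩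
  intro n hn m hm0 hm I F
  set d : ℝ := 2 * m / n with hd
  set p : ℝ := (m : ℝ) / Fintype.card (EdgeType n) with hp
  have hN : (0 : ℝ) < Fintype.card (EdgeType n) := by exact_mod_cast (by omega : 0 < Fintype.card (EdgeType n))
  have hp0 : 0 ≤ p := by positivity
  have hp1 : p ≤ 1 := by rw [hp, div_le_one hN]; exact_mod_cast hm
  have hd0 : 0 ≤ d := by positivity
  set k : ℝ := ((I.card : ℕ) : ℝ) with hk
  have hk0 : 0 ≤ k := Nat.cast_nonneg _
  set Q : Finset (Fin n × Fin n) := I ×ˢ Iᶜ with hQ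
  have hcnt : ∀ A : Finset (EdgeType n), (∑ e ∈ A, wt Q e : ℕ) = ∑ v ∈ I, (nb (gr A) v ∩ Iᶜ).card := by
    intro A; rw [sum_wt, cnt_product]
  have htot : (∑ e : EdgeType n, wt Q e : ℕ) = I.card * (n - I.card) := by
    rw [hcnt, Finset.sum_const_nat]
    intro v hv
    have : nb (gr (Finset.univ : Finset (EdgeType n))) v ∩ Iᶜ = Iᶜ := by
      ext u
      simp only [Finset.mem_inter, mem_nb, gr_adj, Finset.mem_compl, and_iff_right_iff_imp]
      intro hu
      exact ⟨by simp only [Sym2.mk_isDiag_iff]; rintro rfl; exact hu hv, Finset.mem_univ _⟩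
    rw [this, Finset.card_compl, Fintype.card_fin]
  have hIn : I.card ≤ n := by simpa using I.card_le_univ
  have htot' : (∑ e : EdgeType n, (wt Q e : ℝ)) = k * (n - k) := by
    rw [← Nat.cast_sum, htot]
    push_cast [hIn]
    rfl
  have hwt1 : ∀ e : EdgeType n, wt Q e ≤ 1 := by
    rintro ⟨e, he⟩
    rw [wt, Finset.card_le_one]
    rintro ⟨a, b⟩ h1 ⟨c, f⟩ h2
    simp only [hQ, Finset.mem_filter, Finset.mem_product, Finset.mem_compl] at h1 h2
    have h3 := h1.2.trans h2.2.symm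
    rw [Sym2.eq_iff] at h3
    rcases h3 with ⟨rfl, rfl⟩ | ⟨rfl, rfl⟩
    · rfl
    · exact absurd h1.1.1 h2.1.2
  have hpl := Pr_planted hm0 hm F (fun e => -(ℓ * wt Q e)) (fun e => by
    have : 0 ≤ ℓ * wt Q e := by positivity
    linarith) (-(ℓ * (k * (τ / (2 * ℓ) * d))))
  refine (Pr_mono fun A _ hA => ?_).trans (hpl.trans ?_)
  · refine ⟨hA.1, ?_⟩
    rw [Finset.sum_neg_distrib, ← Finset.mul_sum, neg_le_neg_iff]
    refine mul_le_mul_of_nonneg_left ?_ hℓ0.le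
    rw [← Nat.cast_sum, hcnt]
    push_cast
    rw [hk, ← nsmul_eq_mul, ← Finset.sum_const]
    refine Finset.sum_le_sum fun v hv => ?_
    refine le_trans ?_ (hA.2 v hv).le
    exact_mod_cast Finset.card_le_card Finset.inter_subset_left
  · have hsum : ∑ e : EdgeType n, (Real.exp (-(ℓ * wt Q e)) - 1) = -((1 - τ / 2) * (k * (n - k))) := by
      rw [← htot', Finset.mul_sum, ← Finset.sum_neg_distrib]
      refine Finset.sum_congr rfl fun e _ => ?_
      have : wt Q e = 0 ∨ wt Q e = 1 := by have := hwt1 e; omega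
      rcases this with h | h <;> rw [h]
      · simp
      · simp only [Nat.cast_one, mul_one, hexp]; ring
    rw [hsum]
    refine mul_le_mul_of_nonneg_left ?_ (by positivity)
    rw [Real.exp_le_exp]
    have hpd : d = p * (n - 1) := (edge_prob hn m).symm
    have e1 : ℓ * (k * (τ / (2 * ℓ) * d)) = k * (τ / 2 * d) := by field_simp
    rw [neg_neg, e1]
    have e2 : p * -((1 - τ / 2) * (k * (n - k))) = -((1 - τ / 2) * (k * d)) + (1 - τ / 2) * (k * (p * (k - 1))) := by
      rw [hpd]; ring
    rw [e2]
    have e3 : (1 - τ / 2) * (k * (p * (k - 1))) ≤ k ^ 2 := by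
      have : p * (k - 1) ≤ k := by nlinarith
      have h7 : k * (p * (k - 1)) ≤ k ^ 2 := by nlinarith
      have h8 : k * (p * (k - 1)) * (τ / 2) ≥ 0 := by
        rcases Nat.eq_zero_or_pos I.card with h | h
        · have : k = 0 := by rw [hk, h]; simp
          rw [this]; simp
        · have : (1 : ℝ) ≤ k := by rw [hk]; exact_mod_cast h
          have : 0 ≤ k - 1 := by linarith
          positivity
      nlinarith
    nlinarith

/-- A copy of a fixed configuration with a prescribed set of vertices of small degree. -/
lemma PP_config {τ : ℝ} (hτ : 0 < τ) (hτ1 : τ < 1) : ∃ δ : ℝ, 0 < δ ∧ ∀ n : ℕ, 2 ≤ n →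
    ∀ m₀ m₁ : ℕ, 0 < m₀ → m₀ ≤ m₁ → m₁ ≤ Fintype.card (EdgeType n) →
    ∀ (v : ℕ) (E : Finset (Fin v × Fin v)) (I : Finset (Fin v)), (∀ q ∈ E, q.1 < q.2) →
    PP (fun σ : ProcessSpace n => ∃ f : Fin v → Fin n, Function.Injective f ∧
      (∀ q ∈ E, (gr (pre σ m₁)).Adj (f q.1) (f q.2)) ∧
      ∀ i ∈ I, f i ∈ low (gr (pre σ m₀)) δ (2 * m₀ / n)) ≤
    (n : ℝ) ^ v * ((42 * ((m₁ : ℝ) / Fintype.card (EdgeType n))) ^ E.card *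
      Real.exp ((I.card : ℝ) ^ 2 - I.card * ((1 - τ) * (2 * m₀ / n)))) := by
  obtain ⟨δ, hδ, h⟩ := Pr_low_degrees hτ hτ1
  refine ⟨δ, hδ, ?_⟩
  intro n hn m₀ m₁ hm0 h01 hm₁ v E I hE
  set B := Real.exp ((I.card : ℝ) ^ 2 - I.card * ((1 - τ) * (2 * m₀ / n))) with hB
  set R := (42 * ((m₁ : ℝ) / Fintype.card (EdgeType n))) ^ E.card * B with hR
  have h1 : ∀ f ∈ (Finset.univ : Finset (Fin v → Fin n)).filter Function.Injective,
      PP (fun σ : ProcessSpace n => (∀ q ∈ E, (gr (pre σ m₁)).Adj (f q.1) (f q.2)) ∧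
        ∀ i ∈ I, f i ∈ low (gr (pre σ m₀)) δ (2 * m₀ / n)) ≤ R := by
    intro f hf
    have hf : Function.Injective f := by simpa using hf
    have hdiag : ∀ q ∈ E, ¬ (s(f q.1, f q.2)).IsDiag := by
      intro q hq
      simp only [Sym2.mk_isDiag_iff]
      exact fun h => (hE q hq).ne (hf h)
    set F : Finset (EdgeType n) := Finset.univ.filter
      (fun e => ∃ q ∈ E, s(f q.1, f q.2) = (e : Sym2 (Fin n))) with hF
    have hFc : E.card = F.card := by
      refine Finset.card_bij (fun q hq => ⟨s(f q.1, f q.2), hdiag q hq⟩) ?_ ?_ ?_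
      · intro q hq
        simp only [hF, Finset.mem_filter, Finset.mem_univ, true_and]
        exact ⟨q, hq, rfl⟩
      · rintro ⟨a, b⟩ hq ⟨c, d⟩ hq' h
        have h3 := congrArg Subtype.val h
        simp only [Sym2.eq_iff] at h3
        have o1 := hE _ hq
        have o2 := hE _ hq'
        simp only at o1 o2
        rcases h3 with ⟨h4, h5⟩ | ⟨h4, h5⟩
        · rw [hf h4, hf h5]
        · rw [hf h4, hf h5] at o1
          exact absurd o1 (lt_asymm o2)
      · intro e he
        obtain ⟨q, hq, h3⟩ := (Finset.mem_filter.1 he).2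
        exact ⟨q, hq, Subtype.ext h3⟩
    have hIc : (I.image f).card = I.card := Finset.card_image_of_injective _ hf
    have h2 := PP_planted h01 hm₁
      (fun A => ∀ i ∈ I.image f, ((nb (gr A) i).card : ℝ) < δ * (2 * m₀ / n)) (B := B)
      (fun F => by
        have := h n hn m₀ hm0 (h01.trans hm₁) (I.image f) F
        rwa [hIc] at this) (Real.exp_pos _).le F
    rw [← hFc, ← hR] at h2
    refine (PP_mono fun σ hσ => ?_).trans h2
    refine ⟨?_, ?_⟩
    · intro e he
      obtain ⟨q, hq, h3⟩ := (Finset.mem_filter.1 he).2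
      obtain ⟨h4, h5⟩ := gr_adj.1 (hσ.1 q hq)
      have : (⟨s(f q.1, f q.2), h4⟩ : EdgeType n) = e := Subtype.ext h3
      rwa [← this]
    · intro i hi
      obtain ⟨j, hj, rfl⟩ := Finset.mem_image.1 hi
      exact (Finset.mem_filter.1 (hσ.2 j hj)).2
  have h2 := PP_exists_le ((Finset.univ : Finset (Fin v → Fin n)).filter Function.Injective)
    (fun f (σ : ProcessSpace n) => (∀ q ∈ E, (gr (pre σ m₁)).Adj (f q.1) (f q.2)) ∧
        ∀ i ∈ I, f i ∈ low (gr (pre σ m₀)) δ (2 * m₀ / n))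
  refine (PP_mono fun σ hσ => ?_).trans (h2.trans ((Finset.sum_le_sum h1).trans ?_))
  · obtain ⟨f, hf, hσ⟩ := hσ
    exact ⟨f, by simpa using hf, hσ⟩
  · rw [Finset.sum_const, nsmul_eq_mul]
    have hR0 : 0 ≤ R := by positivity
    refine mul_le_mul_of_nonneg_right ?_ hR0
    have : ((Finset.univ : Finset (Fin v → Fin n)).filter Function.Injective).card ≤ n ^ v := by
      refine (Finset.card_filter_le _ _).trans ?_
      simp
    exact_mod_cast this

end Configurations

section NoConfigurations

open scoped Classical

/-- A copy of a configuration: pairs in `E` are adjacent and positions in `I` are in `T`. -/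
def Copy (G : SimpleGraph V) (T : Finset V) {v : ℕ} (E : Finset (Fin v × Fin v))
    (I : Finset (Fin v)) : Prop :=
  ∃ f : Fin v → V, Function.Injective f ∧ (∀ q ∈ E, G.Adj (f q.1) (f q.2)) ∧ ∀ i ∈ I, f i ∈ T

lemma spread_of_not_copy {G : SimpleGraph V} {T₀ T : Finset V} (hT : T ⊆ T₀)
    (h : ¬ (Copy G T₀ {((0 : Fin 4), (1 : Fin 4)), (0, 2), (0, 3)} {1, 2, 3} ∨
      Copy G T₀ {((0 : Fin 3), (1 : Fin 3)), (1, 2)} {0, 1, 2} ∨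
      Copy G T₀ {((0 : Fin 4), (1 : Fin 4)), (1, 2), (2, 3)} {0, 2, 3} ∨
      Copy G T₀ {((0 : Fin 5), (1 : Fin 5)), (1, 2), (2, 3), (3, 4)} {0, 2, 4} ∨
      Copy G T₀ {((0 : Fin 7), (1 : Fin 7)), (0, 2), (0, 3), (1, 4), (2, 5), (3, 6)} {4, 5, 6} ∨
      Copy G T₀ {((0 : Fin 3), (1 : Fin 3)), (1, 2), (0, 2)} {0} ∨
      Copy G T₀ {((0 : Fin 4), (1 : Fin 4)), (1, 2), (2, 3), (0, 3)} {0})) : Spread G T := by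
  simp only [not_or] at h
  obtain ⟨h1, h2, h3, h4, h5, h6, h7⟩ := h
  constructor
  · intro v a b c ha hb hc hab hac hbc h₁ h₂ h₃
    refine h1 ⟨![v, a, b, c], ?_, ?_, ?_⟩
    · rw [← List.nodup_ofFn]
      have := h₁.ne; have := h₂.ne; have := h₃.ne
      simp [List.ofFn_succ]
      tauto
    · simp [h₁, h₂, h₃]
    · simp [hT ha, hT hb, hT hc]
  · intro a b c ha hb hc hac h₁ h₂
    refine h2 ⟨![a, b, c], ?_, ?_, ?_⟩
    · rw [← List.nodup_ofFn]
      have := h₁.ne; have := h₂.ne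
      simp [List.ofFn_succ]
      tauto
    · simp [h₁, h₂]
    · simp [hT ha, hT hb, hT hc]
  · intro a x b c ha hx hb hc hab hac h₁ h₂ h₃
    refine h3 ⟨![a, x, b, c], ?_, ?_, ?_⟩
    · rw [← List.nodup_ofFn]
      have := h₁.ne; have := h₂.ne; have := h₃.ne
      have : x ≠ c := fun h => hx (h ▸ hc)
      simp [List.ofFn_succ]
      tauto
    · simp [h₁, h₂, h₃]
    · simp [hT ha, hT hb, hT hc]
  · intro a x b y c ha hx hb hy hc hab hac hbc hxy h₁ h₂ h₃ h₄
    refine h4 ⟨![a, x, b, y, c], ?_, ?_, ?_⟩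
    · rw [← List.nodup_ofFn]
      have := h₁.ne; have := h₂.ne; have := h₃.ne; have := h₄.ne
      have : x ≠ c := fun h => hx (h ▸ hc)
      have : a ≠ y := fun h => hy (h ▸ ha)
      simp [List.ofFn_succ]
      tauto
    · simp [h₁, h₂, h₃, h₄]
    · simp [hT ha, hT hb, hT hc]
  · intro y x₁ x₂ x₃ t₁ t₂ t₃ hy hx₁ hx₂ hx₃ ht₁ ht₂ ht₃ h12 h13 h23 k12 k13 k23 a1 a2 a3 b1 b2 b3
    refine h5 ⟨![y, x₁, x₂, x₃, t₁, t₂, t₃], ?_, ?_, ?_⟩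
    · rw [← List.nodup_ofFn]
      have := a1.ne; have := a2.ne; have := a3.ne
      have hne : ∀ {x t : V}, x ∉ T → t ∈ T → x ≠ t := fun hx ht h => hx (h ▸ ht)
      simp [List.ofFn_succ, *]
    · simp [a1, a2, a3, b1, b2, b3]
    · simp [hT ht₁, hT ht₂, hT ht₃]
  · intro a b c ha h₁ h₂ h₃
    refine h6 ⟨![a, b, c], ?_, ?_, ?_⟩
    · rw [← List.nodup_ofFn]
      have := h₁.ne; have := h₂.ne; have := h₃.ne
      simp [List.ofFn_succ]
      tauto
    · simp [h₁, h₂, h₃]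
    · simp [hT ha]
  · intro a b c e ha hac hbe h₁ h₂ h₃ h₄
    refine h7 ⟨![a, b, c, e], ?_, ?_, ?_⟩
    · rw [← List.nodup_ofFn]
      have := h₁.ne; have := h₂.ne; have := h₃.ne; have := h₄.ne'
      simp [List.ofFn_succ]
      tauto
    · simp [h₁, h₂, h₃, h₄.symm]
    · simp [hT ha]

lemma PP_not_spread {ε : ℝ} (hε : 0 < ε) (hε1 : ε ≤ 1 / 10) {C : ℝ} (hC : 0 < C) : ∃ δ : ℝ, 0 < δ ∧ ∀ n : ℕ, 2 ≤ n →
    ∀ m₀ m₁ : ℕ, 0 < m₀ → m₀ ≤ m₁ → m₁ ≤ Fintype.card (EdgeType n) → (m₁ : ℝ) ≤ C * m₀ →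
    (1 + ε) * Real.log n ≤ 3 * (2 * m₀ / n) → 1 ≤ 84 * C * (2 * (m₀ : ℝ) / n) →
    PP (fun σ : ProcessSpace n => ¬ ∀ T ⊆ low (gr (pre σ m₀)) δ (2 * m₀ / n),
      Spread (gr (pre σ m₁)) T) ≤
    7 * ((84 * C * (2 * (m₀ : ℝ) / n)) ^ 6 * Real.exp (9 - ε / 4 * (2 * m₀ / n))) := by
  obtain ⟨δ, hδ, h⟩ := PP_config (τ := ε / 2) (by linarith) (by linarith)
  refine ⟨δ, hδ, ?_⟩
  intro n hn m₀ m₁ hm0 h01 hm₁ h10 hlog h168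
  set d : ℝ := 2 * (m₀ : ℝ) / n with hd
  set R : ℝ := (84 * C * d) ^ 6 * Real.exp (9 - ε / 4 * d) with hR
  have hn0 : (0 : ℝ) < n := by exact_mod_cast (by omega : 0 < n)
  have hd0 : 0 < d := by positivity
  have hnexp : (n : ℝ) ≤ Real.exp (3 * (1 - ε / 2) * d - ε / 4 * d) := by
    rw [← Real.log_le_iff_le_exp hn0]
    have h1 : (1 + ε) * Real.log n ≤ (1 + ε) * (3 * (1 - ε / 2) * d - ε / 4 * d) := by
      refine hlog.trans ?_
      have : 3 ≤ (1 + ε) * (3 * (1 - ε / 2) - ε / 4) := by nlinarith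
      nlinarith
    exact le_of_mul_le_mul_left h1 (by linarith)
  set p : ℝ := (m₁ : ℝ) / Fintype.card (EdgeType n) with hp
  have hp0 : 0 ≤ p := by positivity
  have hpn : 42 * p * n ≤ 84 * C * d := by
    have h1 := edge_prob_mul_le hn m₁
    have h2 : 2 * (m₁ : ℝ) / n ≤ C * d := by
      rw [hd, ← mul_div_assoc]
      gcongr ?_ / _
      linarith
    linarith
  have key : ∀ (v : ℕ) (E : Finset (Fin v × Fin v)) (I : Finset (Fin v)), (∀ q ∈ E, q.1 < q.2) →
      E.card ≤ 6 → (v = E.card + 1 ∧ I.card = 3 ∨ v = E.card ∧ I.card = 1) →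
      PP (fun σ : ProcessSpace n => Copy (gr (pre σ m₁)) (low (gr (pre σ m₀)) δ d) E I) ≤ R := by
    intro v E I hE hE6 hv
    refine (h n hn m₀ m₁ hm0 h01 hm₁ v E I hE).trans ?_
    rw [← hp, ← hd]
    have hpow : (42 * p * n) ^ E.card ≤ (84 * C * d) ^ 6 :=
      (pow_le_pow_left₀ (by positivity) hpn _).trans (pow_le_pow_right₀ h168 hE6)
    rcases hv with ⟨hv, hI⟩ | ⟨hv, hI⟩
    · rw [hI]
      calc (n : ℝ) ^ v * ((42 * p) ^ E.card * Real.exp (((3 : ℕ) : ℝ) ^ 2 - (3 : ℕ) * ((1 - ε / 2) * d)))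
          = (42 * p * n) ^ E.card * (n * Real.exp (((3 : ℕ) : ℝ) ^ 2 - (3 : ℕ) * ((1 - ε / 2) * d))) := by
            rw [mul_pow _ (n : ℝ), (congrArg _ hv : (n : ℝ) ^ v = n ^ (E.card + 1)), pow_succ]; ring
        _ ≤ (84 * C * d) ^ 6 * (Real.exp (3 * (1 - ε / 2) * d - ε / 4 * d) *
            Real.exp (((3 : ℕ) : ℝ) ^ 2 - (3 : ℕ) * ((1 - ε / 2) * d))) := by gcongr
        _ = R := by
            rw [hR, ← Real.exp_add]
            congr 2
            push_cast
            ring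
    · rw [hI]
      calc (n : ℝ) ^ v * ((42 * p) ^ E.card * Real.exp (((1 : ℕ) : ℝ) ^ 2 - (1 : ℕ) * ((1 - ε / 2) * d)))
          = (42 * p * n) ^ E.card * Real.exp (((1 : ℕ) : ℝ) ^ 2 - (1 : ℕ) * ((1 - ε / 2) * d)) := by
            rw [mul_pow _ (n : ℝ), (congrArg _ hv : (n : ℝ) ^ v = n ^ E.card)]; ring
        _ ≤ (84 * C * d) ^ 6 * Real.exp (9 - ε / 4 * d) := by
            refine mul_le_mul hpow (Real.exp_le_exp.2 ?_) (Real.exp_pos _).le (by positivity)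
            push_cast
            nlinarith
        _ = R := rfl
  refine (PP_mono (fun σ hσ => not_imp_comm.1
    (fun hc T hT => spread_of_not_copy hT hc) hσ)).trans ((PP_or_le _ _).trans ?_)
  have k1 := key 4 {((0 : Fin 4), (1 : Fin 4)), (0, 2), (0, 3)} {1, 2, 3} (by decide) (by decide) (by decide)
  refine (add_le_add k1 ((PP_or_le _ _).trans (add_le_add (key _ _ _ (by decide) (by decide) (by decide))
      ((PP_or_le _ _).trans (add_le_add (key _ _ _ (by decide) (by decide) (by decide))
      ((PP_or_le _ _).trans (add_le_add (key _ _ _ (by decide) (by decide) (by decide))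
      ((PP_or_le _ _).trans (add_le_add (key _ _ _ (by decide) (by decide) (by decide))
      ((PP_or_le _ _).trans (add_le_add (key _ _ _ (by decide) (by decide) (by decide))
      (key _ _ _ (by decide) (by decide) (by decide))))))))))))).trans (le_of_eq ?_)
  ring

lemma eventually_spread_bound {ε η C : ℝ} (hε : 0 < ε) (hη : 0 < η) :
    ∃ D : ℝ, ∀ d ≥ D, 7 * ((84 * C * d) ^ 6 * Real.exp (9 - ε / 4 * d)) ≤ η := by
  have h1 := (Real.tendsto_pow_mul_exp_neg_atTop_nhds_zero 6).comp
    (tendsto_id.const_mul_atTop (by positivity : (0 : ℝ) < ε / 4))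
  have h2 := h1.const_mul (7 * (84 * C / (ε / 4)) ^ 6 * Real.exp 9)
  rw [mul_zero] at h2
  obtain ⟨D, hD⟩ := eventually_atTop.1 (h2.eventually (ge_mem_nhds hη))
  refine ⟨D, fun d hd => ?_⟩
  have h3 := hD d hd
  simp only [Function.comp_apply, id] at h3
  refine le_trans (le_of_eq ?_) h3
  have : Real.exp (9 - ε / 4 * d) = Real.exp 9 * Real.exp (-(ε / 4 * d)) := by
    rw [← Real.exp_add]; ring_nf
  rw [this]
  field_simp

end NoConfigurations

section Limit

open scoped Classical

lemma card_edgeType_add_one_le {n : ℕ} (hn : 2 ≤ n) : Fintype.card (EdgeType n) + 1 ≤ n ^ 2 := by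
  rw [card_edgeType, Nat.choose_two_right]
  obtain ⟨k, rfl⟩ : ∃ k, n = k + 1 := ⟨n - 1, by omega⟩
  have h := Nat.div_le_self ((k + 1) * (k + 1 - 1)) 2
  simp only [Nat.add_sub_cancel] at h ⊢
  nlinarith

lemma log_le_avg_deg {ε : ℝ} {n m : ℕ} (hn : 2 ≤ n)
    (hm : (1 + ε) * n * Real.log n / 6 ≤ (m : ℝ)) :
    (1 + min ε (1 / 10)) * Real.log n ≤
      3 * (2 * ((min m (Fintype.card (EdgeType n)) : ℕ) : ℝ) / n) := by
  have hn0 : (2 : ℝ) ≤ n := by exact_mod_cast hn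
  have hlog : 0 ≤ Real.log n := Real.log_nonneg (by linarith)
  rcases le_total m (Fintype.card (EdgeType n)) with h | h
  · rw [min_eq_left h, ← mul_div_assoc, le_div_iff₀ (by linarith)]
    have h1 : (1 + min ε (1 / 10)) * Real.log n ≤ (1 + ε) * Real.log n := by
      gcongr
      exact min_le_left _ _
    nlinarith
  · rw [min_eq_right h]
    have h1 : 2 * (Fintype.card (EdgeType n) : ℝ) / n = n - 1 := by
      rw [card_edgeType, Nat.cast_choose_two]
      field_simp
    have h2 := Real.log_le_sub_one_of_pos (by linarith : (0 : ℝ) < n)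
    have h3 : min ε (1 / 10) ≤ 1 / 10 := min_le_right _ _
    rw [h1]
    nlinarith

lemma low_subset {n : ℕ} {G H : SimpleGraph (Fin n)} (h : H ≤ G) {δ₀ δ d d₀ : ℝ}
    (hd : δ₀ * d ≤ δ * d₀) : low G δ₀ d ⊆ low H δ d₀ := by
  intro v hv
  simp only [low, Finset.mem_filter, Finset.mem_univ, true_and] at hv ⊢
  refine lt_of_le_of_lt ?_ (hv.trans_le hd)
  exact_mod_cast Finset.card_le_card fun u hu => mem_nb.2 (h (mem_nb.1 hu))

lemma gr_mono {n : ℕ} {A B : Finset (EdgeType n)} (h : A ⊆ B) : gr A ≤ gr B := by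
  intro u v huv
  obtain ⟨h1, h2⟩ := gr_adj.1 huv
  exact gr_adj.2 ⟨h1, h h2⟩

/-- Resilience of the 2-core throughout the whole time window. -/
lemma tendsto_resilient {ε : ℝ} (hε : 0 < ε) :
    ∃ δt δa : ℝ, ∃ K : ℕ, 0 < δt ∧ 0 < δa ∧ 0 < K ∧
      ∀ m₀ : ℕ → ℕ, (∀ n : ℕ, (1 + ε) * n * Real.log n / 6 ≤ (m₀ n : ℝ)) →
        ∀ η : ℝ, 0 < η → ∀ᶠ n : ℕ in atTop,
          PP (fun σ : ProcessSpace n => ¬ ∀ m : ℕ, m₀ n ≤ m → (m : ℝ) ≤ (1 + ε / 6) * m₀ n →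
            StrongResilient (twoCore (processGraph σ m)) (1 / 2 - ε) δt 2 δa K IsHam) ≤ η := by
  set ε' := min ε (1 / 10) with hε'
  have hε0 : 0 < ε' := lt_min hε (by norm_num)
  have hε1 : ε' ≤ 1 / 10 := min_le_right _ _
  set C : ℝ := 1 + ε / 6 with hC
  have hC1 : 1 ≤ C := by linarith
  have hC0 : 0 < C := by linarith
  obtain ⟨δ, hδ, hspread⟩ := PP_not_spread hε0 hε1 hC0
  obtain ⟨β, K, hβ, hK, hres⟩ := Pr_not_resilient hε0 hε1
  set δ₀ := min (1 / 2) (δ / C) with hδ₀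
  have hδ₀0 : 0 < δ₀ := lt_min (by norm_num) (by positivity)
  refine ⟨δ₀ / 4, 4 * β, K, by positivity, by positivity, hK, ?_⟩
  intro m₀ hm₀ η hη
  obtain ⟨D, hD⟩ := eventually_spread_bound (C := C) hε0 (half_pos hη)
  have hlogt : Tendsto (fun n : ℕ => Real.log n / 3) atTop atTop :=
    (Real.tendsto_log_atTop.comp tendsto_natCast_atTop_atTop).atTop_div_const (by norm_num)
  have hinv : Tendsto (fun n : ℕ => ((n : ℝ))⁻¹) atTop (nhds 0) :=
    tendsto_inv_atTop_zero.comp tendsto_natCast_atTop_atTop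
  filter_upwards [hres δ₀ hδ₀0 (min_le_left _ _), eventually_ge_atTop 2,
    hlogt.eventually_ge_atTop (max D (1 / (84 * C))), hinv.eventually (ge_mem_nhds (half_pos hη))]
    with n hres hn hlogn hinv
  have hn0 : (2 : ℝ) ≤ n := by exact_mod_cast hn
  set N := Fintype.card (EdgeType n) with hN
  set a := min (m₀ n) N with ha
  set b := min ⌊C * m₀ n⌋₊ N with hb
  have hlog0 : 0 < Real.log n := Real.log_pos (by linarith)
  have hla : (1 + ε') * Real.log n ≤ 3 * (2 * (a : ℝ) / n) := log_le_avg_deg hn (hm₀ n)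
  have hda : Real.log n / 3 ≤ 2 * (a : ℝ) / n := by nlinarith
  have ha0 : 0 < a := by
    rcases Nat.eq_zero_or_pos a with h | h
    · rw [h] at hda
      simp only [Nat.cast_zero, mul_zero, zero_div] at hda
      linarith
    · exact h
  have hab : a ≤ b := by
    refine min_le_min_right _ (Nat.le_floor ?_)
    have : (0 : ℝ) ≤ m₀ n := Nat.cast_nonneg _
    nlinarith
  have hbN : b ≤ N := min_le_right _ _
  have hbC : (b : ℝ) ≤ C * a := by
    rcases le_total (m₀ n) N with h | h
    · rw [ha, min_eq_left h]
      exact (Nat.cast_le.2 (min_le_left _ _)).trans (Nat.floor_le (by positivity))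
    · rw [ha, min_eq_right h]
      have : (b : ℝ) ≤ N := by exact_mod_cast hbN
      have : (0 : ℝ) ≤ N := Nat.cast_nonneg _
      nlinarith
  have hdD := hlogn.trans hda
  have h84 : 1 ≤ 84 * C * (2 * (a : ℝ) / n) := by
    have := (le_max_right D (1 / (84 * C))).trans hdD
    rwa [div_le_iff₀' (by positivity)] at this
  have h1 := (hspread n hn a b ha0 hab hbN hbC hla h84).trans (hD _ ((le_max_left _ _).trans hdD))
  set Q : ℕ → Finset (EdgeType n) → Prop := fun m A =>
    ¬ ((∀ T ⊆ low (gr A) δ₀ (2 * m / n), Spread (gr A) T) →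
      StrongResilient (twoCore (gr A)) (1 / 2 - ε') (δ₀ / 4) 2 (4 * β) K IsHam) with hQ
  have h2 : PP (fun σ : ProcessSpace n => ∃ m ∈ Finset.Icc a N, Q m (pre σ m)) ≤ η / 2 := by
    refine (PP_exists_le _ _).trans ?_
    have h3 : ∀ m ∈ Finset.Icc a N, PP (fun σ : ProcessSpace n => Q m (pre σ m)) ≤ ((n : ℝ) ^ 4)⁻¹ := by
      intro m hm
      rw [Finset.mem_Icc] at hm
      rw [PP_pre hm.2 (Q m)]
      refine hres m hm.2 (hda.trans ?_)
      have : (a : ℝ) ≤ m := by exact_mod_cast hm.1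
      gcongr
    refine (Finset.sum_le_sum h3).trans ?_
    rw [Finset.sum_const, nsmul_eq_mul]
    refine le_trans ?_ hinv
    have h4 : ((Finset.Icc a N).card : ℝ) ≤ (n : ℝ) ^ 2 := by
      have := card_edgeType_add_one_le hn
      have h5 : (Finset.Icc a N).card ≤ n ^ 2 := by rw [Nat.card_Icc]; omega
      exact_mod_cast h5
    calc ((Finset.Icc a N).card : ℝ) * ((n : ℝ) ^ 4)⁻¹ ≤ (n : ℝ) ^ 2 * ((n : ℝ) ^ 4)⁻¹ := by gcongr
      _ = (n : ℝ)⁻¹ * (n : ℝ)⁻¹ := by field_simp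
      _ ≤ (n : ℝ)⁻¹ * 1 := by
        gcongr
        exact inv_le_one_of_one_le₀ (by linarith)
      _ = _ := mul_one _
  refine (PP_mono fun σ hσ => ?_).trans ((PP_or_le _ _).trans ((add_le_add h1 h2).trans (by linarith)))
  by_contra hgood
  rw [not_or, not_not, not_exists] at hgood
  obtain ⟨hsp, hrs⟩ := hgood
  refine hσ fun m hm hmC => ?_
  rw [processGraph_cap]
  set m' := min m N with hm'
  have hm'a : a ≤ m' := min_le_min_right _ hm
  have hm'b : m' ≤ b := min_le_min_right _ (Nat.le_floor hmC)
  have h5 := hrs m'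
  simp only [hQ, not_and, not_not, Finset.mem_Icc] at h5
  refine (h5 ⟨hm'a, min_le_right _ _⟩ fun T hT => ?_).mono (by have := min_le_left ε (1 / 10); linarith)
  refine (hsp T (hT.trans (low_subset (gr_mono (pre_mono σ hm'a)) ?_))).mono
    (gr_mono (pre_mono σ hm'b))
  have h6 : (m' : ℝ) ≤ C * a := le_trans (by exact_mod_cast hm'b) hbC
  calc δ₀ * (2 * m' / n) ≤ δ / C * (2 * (C * a) / n) := by
        gcongr
        exact min_le_right _ _
    _ = _ := by field_simp

end Limit

theorem statement_15 (ε : ℝ) (hε : 0 < ε) :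
    ∃ δt δa : ℝ, ∃ K : ℕ, 0 < δt ∧ 0 < δa ∧ 0 < K ∧
      ∀ m₀ : ℕ → ℕ,
        (∀ n : ℕ, (1 + ε) * n * Real.log n / 6 ≤ (m₀ n : ℝ)) →
        Tendsto (fun n : ℕ =>
          processMeasure n {σ : ProcessSpace n |
            ∀ m : ℕ, m₀ n ≤ m → (m : ℝ) ≤ (1 + ε / 6) * m₀ n →
              StrongResilient (twoCore (processGraph σ m)) (1 / 2 - ε) δt 2 δa K IsHam})
          atTop (nhds 1) := by
  obtain ⟨δt, δa, K, hδt, hδa, hK, h⟩ := tendsto_resilient hε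
  refine ⟨δt, δa, K, hδt, hδa, hK, fun m₀ hm₀ => ?_⟩
  simp only [processMeasure_apply]
  rw [← ENNReal.ofReal_one]
  refine ENNReal.tendsto_ofReal ?_
  have h0 := tendsto_order.2 ⟨fun a ha => Eventually.of_forall fun n =>
    ha.trans_le (PP_nonneg (fun σ : ProcessSpace n => ¬ ∀ m : ℕ, m₀ n ≤ m →
      (m : ℝ) ≤ (1 + ε / 6) * m₀ n →
        StrongResilient (twoCore (processGraph σ m)) (1 / 2 - ε) δt 2 δa K IsHam)),
    fun a ha => (h m₀ hm₀ (a / 2) (by linarith)).mono fun n hn => hn.trans_lt (half_lt_self ha)⟩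
  have h1 := h0.const_sub 1
  rw [sub_zero] at h1
  exact h1.congr fun n => (PP_not _).symm

end
end RGP
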